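/- arXiv:1701.01978 — 4 statements merged into one kernel-verified Lean document; each statement's English description precedes it below -/
import Mathlib

section
/- For 0 ≤ m ≤ ν write the m-th index of inseparability of L/K as i_m = A_m·n − b_m with 1 ≤ b_m ≤ n. Let π_L and π̃_L be uniformizers for L, with minimum polynomials f(X) = X^n − c_1X^{n−1} + ⋯ + (−1)^n c_n and f̃(X) = X^n − c̃_1X^{n−1} + ⋯ + (−1)^n c̃_n over K, and suppose there exist ℓ ≥ 1, r ∈ O_K and a K-automorphism σ of L with σ(π̃_L) ≡ π_L + r·π_L^{ℓ+1} (mod M_L^{ℓ+2}). Let 0 ≤ j ≤ ν satisfy v̄_p(φ_j(ℓ)) = j, let h be the unique integer with 1 ≤ h ≤ n such that n divides φ_j(ℓ) + h, and set k = (φ_j(ℓ) + h)/n and h₀ = h/p^j. Set S_j = { m : 0 ≤ m ≤ j, φ_j(ℓ) = φ̃_m(ℓ) }, and for m ∈ S_j define g_m = (−1)^{k+ℓ+A_m}(h₀p^{j−m} + ℓ − u·p^{ν−m}) if b_m < h; g_m = (−1)^{k+ℓ+A_m}(h₀p^{j−m} + ℓ) if h ≤ b_m < n; and g_m = (−1)^{k+ℓ+A_m}·u·p^{ν−m}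 if b_m = n. Then c̃_h ≡ c_h + Σ_{m ∈ S_j} g_m · c_n^{k−A_m} · c_{b_m} · r^{p^m} (mod M_K^{k+1}). -/
open scoped Classical

noncomputable section

/-- `v` is a normalized (surjective onto `ℤ`) additive discrete valuation on the field `F`. -/
structure IsDiscreteValuationOn {F : Type*} [Field F] (v : F → WithTop ℤ) : Prop where
  eq_top_iff : ∀ x : F, v x = ⊤ ↔ x = 0
  map_mul : ∀ x y : F, v (x * y) = v x + v y
  min_le_add : ∀ x y : F, min (v x) (v y) ≤ v (x + y)
  surjective : ∀ m : ℤ, ∃ x : F, v x = (m : WithTop ℤ)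

/-- `F` is complete with respect to the additive valuation `v`: every Cauchy sequence
(with respect to `v`) converges. -/
def IsCompleteWrt {F : Type*} [Field F] (v : F → WithTop ℤ) : Prop :=
  ∀ f : ℕ → F,
    (∀ N : ℤ, ∃ M : ℕ, ∀ i ≥ M, ∀ k ≥ M, (N : WithTop ℤ) ≤ v (f i - f k)) →
      ∃ a : F, ∀ N : ℤ, ∃ M : ℕ, ∀ i ≥ M, (N : WithTop ℤ) ≤ v (f i - a)

/-- The residue field of `v` is perfect of characteristic `p`: the rational prime `p`
lies in the maximal ideal, and modulo the maximal ideal every integral element is the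
`p`-th power of an integral element. -/
def HasPerfectResidueFieldCharP {F : Type*} [Field F] (v : F → WithTop ℤ) (p : ℕ) : Prop :=
  (1 : WithTop ℤ) ≤ v (p : F) ∧
    ∀ x : F, (0 : WithTop ℤ) ≤ v x →
      ∃ y : F, (0 : WithTop ℤ) ≤ v y ∧ (1 : WithTop ℤ) ≤ v (x - y ^ p)

/-- `v̄_p(k) = min(v_p(k), ν)`. -/
def vbar (p ν k : ℕ) : ℕ := min (padicValNat p k) ν

/-- The coefficient `c_h` of the minimal polynomial
`f(X) = X^n - c_1 X^{n-1} + ... + (-1)^{n-1} c_{n-1} X + (-1)^n c_n` of `π` over `K`,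
where `n = [L:K]`; i.e. `c_h = (-1)^h · (coefficient of X^{n-h} in f)`. -/
def minpolyCoeff (K : Type*) {L : Type*} [Field K] [Field L] [Algebra K L]
    (n : ℕ) (π : L) (h : ℕ) : K :=
  (-1) ^ h * (minpoly K π).coeff (n - h)

/-- `i_j^{π_L} = min { n·v_K(c_h) - h : 1 ≤ h ≤ n, v̄_p(h) ≤ j }` (an element of
`WithTop ℤ`, the `min` of the empty set being `⊤`). -/
def iPi {K : Type*} [Field K] (vK : K → WithTop ℤ) (p ν n : ℕ) (c : ℕ → K) (j : ℕ) :
    WithTop ℤ :=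
  ((Finset.Icc 1 n).filter fun h => vbar p ν h ≤ j).inf
    fun h => (vK (c h)).map fun a => (n : ℤ) * a - (h : ℤ)

/-- The `j`-th index of inseparability
`i_j = min { i_{j'}^{π_L} + (j' - j)·e_L : j ≤ j' ≤ ν }`, where `eL = v_L(p)`. -/
def insepIdx {K : Type*} [Field K] (vK : K → WithTop ℤ) (p ν n : ℕ) (eL : WithTop ℤ)
    (c : ℕ → K) (j : ℕ) : WithTop ℤ :=
  (Finset.Icc j ν).inf fun j' => iPi vK p ν n c j' + (j' - j) • eL

/-- `φ̃_j(x) = i_j + p^j·x`. -/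
def phiTilde {K : Type*} [Field K] (vK : K → WithTop ℤ) (p ν n : ℕ) (eL : WithTop ℤ)
    (c : ℕ → K) (j x : ℕ) : WithTop ℤ :=
  insepIdx vK p ν n eL c j + (((p ^ j * x : ℕ) : ℤ) : WithTop ℤ)

/-- `φ_j(x) = min { φ̃_{j₀}(x) : 0 ≤ j₀ ≤ j }`. -/
def phiIdx {K : Type*} [Field K] (vK : K → WithTop ℤ) (p ν n : ℕ) (eL : WithTop ℤ)
    (c : ℕ → K) (j x : ℕ) : WithTop ℤ :=
  (Finset.Icc 0 j).inf fun j0 => phiTilde vK p ν n eL c j0 x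


/-! ### Basic valuation estimates -/

/-- `v x ≥ N`. -/
def VGe {F : Type*} (v : F → WithTop ℤ) (N : ℤ) (x : F) : Prop := (N : WithTop ℤ) ≤ v x

section basic
variable {F : Type*} [Field F] {v : F → WithTop ℤ}

theorem IsDiscreteValuationOn.zero (hv : IsDiscreteValuationOn v) : v 0 = ⊤ :=
  (hv.eq_top_iff 0).2 rfl

theorem wt_self_add {a : WithTop ℤ} (h : a ≠ ⊤) (h2 : a = a + a) : a = 0 := by
  lift a to ℤ using h
  norm_cast at h2 ⊢
  omega

theorem IsDiscreteValuationOn.one (hv : IsDiscreteValuationOn v) : v 1 = 0 := by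
  have h1 : v 1 ≠ ⊤ := fun h => one_ne_zero ((hv.eq_top_iff 1).1 h)
  have h2 := hv.map_mul 1 1
  rw [mul_one] at h2
  exact wt_self_add h1 h2

theorem wt_add_self_zero {a : WithTop ℤ} (h2 : a + a = 0) : a = 0 := by
  cases a with
  | top => simp at h2
  | coe a =>
    norm_cast at h2 ⊢
    omega

theorem IsDiscreteValuationOn.neg_one (hv : IsDiscreteValuationOn v) : v (-1) = 0 := by
  have h2 := hv.map_mul (-1) (-1)
  rw [neg_mul_neg, one_mul, hv.one] at h2
  exact wt_add_self_zero h2.symm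

theorem IsDiscreteValuationOn.neg (hv : IsDiscreteValuationOn v) (x : F) : v (-x) = v x := by
  rw [← neg_one_mul, hv.map_mul, hv.neg_one, zero_add]

theorem IsDiscreteValuationOn.pow (hv : IsDiscreteValuationOn v) (x : F) (m : ℕ) :
    v (x ^ m) = m • v x := by
  induction m with
  | zero => simp [hv.one]
  | succ m ih => rw [pow_succ, hv.map_mul, ih, succ_nsmul]

theorem VGe.mono {N M : ℤ} {x : F} (h : VGe v N x) (hM : M ≤ N) : VGe v M x :=
  le_trans (by exact_mod_cast hM) h

theorem VGe.zero (hv : IsDiscreteValuationOn v) (N : ℤ) : VGe v N (0 : F) := by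
  unfold VGe; rw [hv.zero]; exact le_top

theorem VGe.add (hv : IsDiscreteValuationOn v) {N : ℤ} {x y : F} (hx : VGe v N x)
    (hy : VGe v N y) : VGe v N (x + y) :=
  le_trans (le_min hx hy) (hv.min_le_add x y)

theorem VGe.neg (hv : IsDiscreteValuationOn v) {N : ℤ} {x : F} (hx : VGe v N x) :
    VGe v N (-x) := by
  unfold VGe; rw [hv.neg]; exact hx

theorem VGe.sub (hv : IsDiscreteValuationOn v) {N : ℤ} {x y : F} (hx : VGe v N x)
    (hy : VGe v N y) : VGe v N (x - y) := by
  rw [sub_eq_add_neg]; exact hx.add hv (hy.neg hv)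

theorem VGe.sum (hv : IsDiscreteValuationOn v) {ι : Type*} {N : ℤ} (s : Finset ι) (f : ι → F)
    (h : ∀ i ∈ s, VGe v N (f i)) : VGe v N (∑ i ∈ s, f i) :=
  Finset.sum_induction f (VGe v N) (fun _ _ hx hy => hx.add hv hy) (VGe.zero hv N) h

theorem VGe.mul (hv : IsDiscreteValuationOn v) {N M : ℤ} {x y : F} (hx : VGe v N x)
    (hy : VGe v M y) : VGe v (N + M) (x * y) := by
  unfold VGe; rw [hv.map_mul]; push_cast; exact add_le_add hx hy

theorem VGe.one (hv : IsDiscreteValuationOn v) : VGe v 0 (1 : F) := by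
  unfold VGe; rw [hv.one]; rfl

theorem VGe.pow (hv : IsDiscreteValuationOn v) {N : ℤ} {x : F} (hx : VGe v N x) (m : ℕ) :
    VGe v (m * N) (x ^ m) := by
  induction m with
  | zero => simpa using VGe.one hv
  | succ m ih =>
    rw [pow_succ]
    exact (ih.mul hv hx).mono (by push_cast; linarith)

theorem VGe.natCast (hv : IsDiscreteValuationOn v) (m : ℕ) : VGe v 0 (m : F) := by
  induction m with
  | zero => simpa using VGe.zero hv 0
  | succ m ih => push_cast; exact ih.add hv (VGe.one hv)

theorem VGe.intCast (hv : IsDiscreteValuationOn v) (m : ℤ) : VGe v 0 (m : F) := by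
  obtain ⟨a, rfl | rfl⟩ := m.eq_nat_or_neg
  · simpa using VGe.natCast hv a
  · simpa using (VGe.natCast hv a).neg hv

theorem VGe.negOnePow (hv : IsDiscreteValuationOn v) (m : ℕ) : VGe v 0 ((-1 : F) ^ m) := by
  simpa using ((VGe.one hv).neg hv).pow hv m

theorem VGe.prod (hv : IsDiscreteValuationOn v) {ι : Type*} (s : Finset ι) (f : ι → F)
    (N : ι → ℤ) (h : ∀ i ∈ s, VGe v (N i) (f i)) : VGe v (∑ i ∈ s, N i) (∏ i ∈ s, f i) := by
  induction s using Finset.induction_on with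
  | empty => simpa using VGe.one hv
  | insert a s ha ih =>
    rw [Finset.prod_insert ha, Finset.sum_insert ha]
    exact (h a (by simp)).mul hv (ih fun i hi => h i (by simp [hi]))

/-- cancel a factor of known valuation. -/
theorem VGe.of_mul_right (hv : IsDiscreteValuationOn v) {N M : ℤ} {x y : F} (hy : v y = M)
    (h : VGe v N (x * y)) : VGe v (N - M) x := by
  unfold VGe at *
  rw [hv.map_mul, hy] at h
  cases hx : v x with
  | top => exact le_top
  | coe a =>
    rw [hx] at h
    norm_cast at h ⊢
    omega

theorem VGe.sub_pow (hv : IsDiscreteValuationOn v) {N : ℤ} {x y : F} (hx : VGe v N x)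
    (hy : VGe v N y) (hxy : VGe v (N + 1) (x - y)) (m : ℕ) :
    VGe v (m * N + 1) (x ^ m - y ^ m) := by
  induction m with
  | zero => simpa using VGe.zero hv _
  | succ m ih =>
    have : x ^ (m + 1) - y ^ (m + 1) = (x ^ m - y ^ m) * x + y ^ m * (x - y) := by ring
    rw [this]
    refine VGe.add hv ((ih.mul hv hx).mono ?_) (((hy.pow hv m).mul hv hxy).mono ?_) <;>
    · push_cast; linarith

theorem VGe.dvd (hv : IsDiscreteValuationOn v) {N : ℤ} {x : F} {a b : ℕ} (hab : a ∣ b)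
    (h : VGe v N ((a : F) * x)) : VGe v N ((b : F) * x) := by
  obtain ⟨c, rfl⟩ := hab
  have := (VGe.natCast hv c).mul hv h
  rw [zero_add] at this
  convert this using 1
  push_cast; ring

end basic

/-! ### The extension -/

/-- The standing hypotheses. -/
structure Ctx {K L : Type*} [Field K] [Field L] [Algebra K L] (p n : ℕ) (vK : K → WithTop ℤ)
    (vL : L → WithTop ℤ) : Prop where
  hp : p.Prime
  npos : 0 < n
  hK : IsDiscreteValuationOn vK
  hL : IsDiscreteValuationOn vL
  ram : ∀ x : K, vL (algebraMap K L x) = n • vK x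
  pm : (1 : WithTop ℤ) ≤ vK (p : K)

section ext
variable {K L : Type*} [Field K] [Field L] [Algebra K L] {p n : ℕ} {vK : K → WithTop ℤ}
    {vL : L → WithTop ℤ}

theorem Ctx.up (C : Ctx p n vK vL) {M : ℤ} {x : K} (h : VGe vK M x) :
    VGe vL (n * M) (algebraMap K L x) := by
  unfold VGe at *
  rw [C.ram]
  cases hx : vK x with
  | top => have := C.npos; cases n with
    | zero => omega
    | succ n => rw [succ_nsmul]; simp
  | coe a =>
    rw [hx] at h
    rw [← WithTop.coe_nsmul]
    norm_cast at h ⊢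
    rw [nsmul_eq_mul]
    exact mul_le_mul_of_nonneg_left h (by positivity)

theorem Ctx.down (C : Ctx p n vK vL) {M N : ℤ} {x : K} (h : VGe vL N (algebraMap K L x))
    (hMN : n * (M - 1) < N) : VGe vK M x := by
  unfold VGe at *
  rw [C.ram] at h
  cases hx : vK x with
  | top => exact le_top
  | coe a =>
    rw [hx, ← WithTop.coe_nsmul] at h
    norm_cast at h ⊢
    rw [nsmul_eq_mul] at h
    have hn : (0:ℤ) < n := by exact_mod_cast C.npos
    have : (n:ℤ) * (M - 1) < n * a := lt_of_lt_of_le hMN h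
    have := lt_of_mul_lt_mul_left this hn.le
    omega

theorem Ctx.pL (C : Ctx p n vK vL) : VGe vL n (p : L) := by
  have := C.up (M := 1) (x := (p : K)) C.pm
  simpa using this

/-- no cancellation between the powers of a uniformizer. -/
theorem Ctx.nocancel (C : Ctx p n vK vL) {y : L} (hy : vL y = 1) (a : ℕ → K) {M : ℤ}
    (h : VGe vL M (∑ t ∈ Finset.range n, algebraMap K L (a t) * y ^ t)) :
    ∀ t < n, VGe vL M (algebraMap K L (a t) * y ^ t) := by
  have hv : ∀ t, vL (algebraMap K L (a t) * y ^ t) = n • vK (a t) + ((t : ℤ) : WithTop ℤ) := by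
    intro t
    rw [C.hL.map_mul, C.ram, C.hL.pow, hy, nsmul_one]; simp
  obtain ⟨t0, ht0, hmin⟩ := Finset.exists_min_image (Finset.range n)
    (fun t => vL (algebraMap K L (a t) * y ^ t)) ⟨0, by simpa using C.npos⟩
  suffices hs : VGe vL M (algebraMap K L (a t0) * y ^ t0) from
    fun t ht => le_trans hs (hmin t (by simpa using ht))
  by_contra hcon
  have h0 := hv t0
  unfold VGe at hcon
  rw [not_le] at hcon
  cases hx : vK (a t0) with
  | top =>
    rw [h0, hx] at hcon
    have := C.npos
    obtain ⟨n', rfl⟩ : ∃ n', n = n' + 1 := ⟨n - 1, by omega⟩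
    rw [succ_nsmul] at hcon; simp at hcon
  | coe w =>
    rw [hx, ← WithTop.coe_nsmul, ← WithTop.coe_add, nsmul_eq_mul] at h0
    have hothers : VGe vL (n * w + t0 + 1)
        (∑ t ∈ (Finset.range n).erase t0, algebraMap K L (a t) * y ^ t) := by
      refine VGe.sum C.hL _ _ fun t ht => ?_
      rw [Finset.mem_erase] at ht
      have h1 := hmin t ht.2
      have h2 := hv t
      unfold VGe
      rw [h0, h2] at h1
      rw [h2]
      cases hx' : vK (a t) with
      | top =>
        have := C.npos
        obtain ⟨n', rfl⟩ : ∃ n', n = n' + 1 := ⟨n - 1, by omega⟩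
        rw [succ_nsmul]; simp
      | coe w' =>
        rw [hx', ← WithTop.coe_nsmul, ← WithTop.coe_add, nsmul_eq_mul] at h1
        rw [← WithTop.coe_nsmul, ← WithTop.coe_add, nsmul_eq_mul]
        rw [WithTop.coe_le_coe] at h1 ⊢
        have hne : (n:ℤ) * w + t0 ≠ n * w' + t := by
          intro he
          have e1 : ((n:ℤ) * w + t0) % n = t0 := by
            rw [add_comm, Int.add_mul_emod_self_left]
            exact Int.emod_eq_of_lt (by positivity)
              (by exact_mod_cast Finset.mem_range.1 ht0)
          have e2 : ((n:ℤ) * w' + t) % n = t := by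
            rw [add_comm, Int.add_mul_emod_self_left]
            exact Int.emod_eq_of_lt (by positivity)
              (by exact_mod_cast Finset.mem_range.1 ht.2)
          rw [he, e2] at e1
          exact ht.1 (by exact_mod_cast e1)
        omega
    rw [h0, WithTop.coe_lt_coe] at hcon
    rw [← Finset.add_sum_erase _ _ ht0] at h
    have h3 := (h.mono (show (n:ℤ) * w + t0 + 1 ≤ M by omega)).sub C.hL hothers
    rw [add_sub_cancel_right] at h3
    unfold VGe at h3
    rw [h0, WithTop.coe_le_coe] at h3
    omega

theorem Ctx.eq_zero (C : Ctx p n vK vL) {x : L} (h : ∀ M, VGe vL M x) : x = 0 := by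
  rw [← C.hL.eq_top_iff]
  cases hx : vL x with
  | top => rfl
  | coe a =>
    have := h (a + 1)
    unfold VGe at this
    rw [hx, WithTop.coe_le_coe] at this
    omega

theorem vy_pow (hL : IsDiscreteValuationOn vL) {y : L} (hy : vL y = 1) (t : ℕ) :
    vL (y ^ t) = ((t : ℤ) : WithTop ℤ) := by
  rw [hL.pow, hy, nsmul_one]; simp

theorem VGe.ypow (hL : IsDiscreteValuationOn vL) {y : L} (hy : vL y = 1) (t : ℕ) :
    VGe vL t (y ^ t) := by
  unfold VGe; rw [vy_pow hL hy]

/-- Coordinates with respect to the powers of `y`. -/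
structure YData (n : ℕ) (vL : L → WithTop ℤ) (y : L) (κ : ℕ → L →ₗ[K] K) : Prop where
  vy : vL y = 1
  expand : ∀ x, x = ∑ t ∈ Finset.range n, algebraMap K L (κ t x) * y ^ t
  single : ∀ t < n, ∀ s < n, κ t (y ^ s) = if s = t then 1 else 0
  ge : ∀ t < n, ∀ x M, VGe vL M x → VGe vL M (algebraMap K L (κ t x) * y ^ t)

theorem Ctx.indep (C : Ctx p n vK vL) {y : L} (hy : vL y = 1) (a : ℕ → K)
    (h : ∑ t ∈ Finset.range n, algebraMap K L (a t) * y ^ t = 0) : ∀ t < n, a t = 0 := by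
  intro t ht
  have h1 : algebraMap K L (a t) * y ^ t = 0 := C.eq_zero fun M =>
    C.nocancel hy a (by rw [h]; exact VGe.zero C.hL M) t ht
  have hy0 : y ≠ 0 := by
    intro h0; rw [h0, C.hL.zero] at hy; exact absurd hy (by decide)
  rcases mul_eq_zero.1 h1 with h2 | h2
  · exact (map_eq_zero _).1 h2
  · exact absurd h2 (pow_ne_zero _ hy0)

theorem Ctx.exists_ydata [FiniteDimensional K L] (C : Ctx p n vK vL)
    (hdim : Module.finrank K L = n) {y : L} (hy : vL y = 1) :
    ∃ κ : ℕ → L →ₗ[K] K, YData n vL y κ := by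
  have hli : LinearIndependent K (fun t : Fin n => y ^ (t : ℕ)) := by
    rw [Fintype.linearIndependent_iff]
    intro g hg i
    have := C.indep hy (fun t => if ht : t < n then g ⟨t, ht⟩ else 0) (by
      rw [Finset.sum_range]
      rw [← hg]
      refine Finset.sum_congr rfl fun i _ => ?_
      simp [Algebra.smul_def]) i i.2
    simpa using this
  have : Nonempty (Fin n) := ⟨⟨0, C.npos⟩⟩
  let B := basisOfLinearIndependentOfCardEqFinrank hli (by simp [hdim])
  have hB : ∀ i, B i = y ^ (i : ℕ) := fun i => by simp [B]
  let κ : ℕ → L →ₗ[K] K := fun t => if ht : t < n then B.coord ⟨t, ht⟩ else 0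
  have hex : ∀ x, x = ∑ t ∈ Finset.range n, algebraMap K L (κ t x) * y ^ t := by
    intro x
    rw [Finset.sum_range]
    conv_lhs => rw [← B.sum_repr x]
    refine Finset.sum_congr rfl fun i _ => ?_
    simp [κ, hB, Algebra.smul_def]
  refine ⟨κ, hy, hex, ?_, ?_⟩
  · intro t ht s hs
    have : y ^ s = B ⟨s, hs⟩ := by rw [hB]
    rw [this]
    simp [κ, ht, Finsupp.single_apply]
  · intro t ht x M hx
    rw [hex x] at hx
    exact C.nocancel hy (fun t => κ t x) hx t ht

theorem minpolyCoeff_eval (y x : L) (hdeg : (minpoly K y).natDegree = n) :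
    Polynomial.aeval x (minpoly K y) = ∑ g ∈ Finset.range (n + 1),
      (-1) ^ g * algebraMap K L (minpolyCoeff K n y g) * x ^ (n - g) := by
  rw [Polynomial.aeval_eq_sum_range, hdeg, ← Finset.sum_range_reflect]
  refine Finset.sum_congr rfl fun g hg => ?_
  rw [minpolyCoeff, map_mul, Algebra.smul_def, Nat.add_sub_cancel, map_pow, map_neg, map_one,
    ← mul_assoc, ← mul_pow]
  simp

theorem Ctx.natDegree [FiniteDimensional K L] (C : Ctx p n vK vL)
    (hdim : Module.finrank K L = n) {y : L} (hy : vL y = 1) :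
    (minpoly K y).natDegree = n := by
  have hyint : IsIntegral K y := Algebra.IsIntegral.isIntegral y
  refine le_antisymm (hdim ▸ minpoly.natDegree_le y) ?_
  by_contra hlt
  rw [not_le] at hlt
  have h0 := minpoly.aeval K y
  rw [Polynomial.aeval_eq_sum_range' hlt] at h0
  have := C.indep hy (fun t => (minpoly K y).coeff t)
    (by simpa [Algebra.smul_def] using h0) _ hlt
  have hm := minpoly.monic hyint
  rw [Polynomial.Monic, Polynomial.leadingCoeff, this] at hm
  exact zero_ne_one hm

end ext

section eis
variable {K L : Type*} [Field K] [Field L] [Algebra K L] {p n : ℕ} {vK : K → WithTop ℤ}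
    {vL : L → WithTop ℤ}

/-- Eisenstein data of a uniformizer. -/
structure Eis (n : ℕ) (vK : K → WithTop ℤ) (vL : L → WithTop ℤ) (y : L) (c : ℕ → K) : Prop where
  vy : vL y = 1
  c0 : c 0 = 1
  ge1 : ∀ g, 1 ≤ g → g ≤ n → VGe vL n (algebraMap K L (c g))
  rel : ∑ g ∈ Finset.range (n + 1), (-1) ^ g * algebraMap K L (c g) * y ^ (n - g) = 0
  top : vK (c n) = 1

theorem Eis.ge (C : Ctx p n vK vL) {y : L} {c : ℕ → K} (E : Eis n vK vL y c) (g : ℕ)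
    (hg : g ≤ n) : VGe vL g (algebraMap K L (c g)) := by
  rcases Nat.eq_zero_or_pos g with rfl | h
  · rw [E.c0, map_one]; exact VGe.one C.hL
  · exact (E.ge1 g h hg).mono (by exact_mod_cast hg)

theorem Eis.rel' {y : L} {c : ℕ → K} (E : Eis n vK vL y c) :
    y ^ n = - ∑ g ∈ Finset.Icc 1 n, (-1) ^ g * algebraMap K L (c g) * y ^ (n - g) := by
  have h := E.rel
  rw [Finset.range_eq_Ico, Finset.sum_eq_sum_Ico_succ_bot (by omega)] at h
  simp only [E.c0, pow_zero, map_one, one_mul, Nat.sub_zero, zero_add] at h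
  rw [eq_neg_iff_add_eq_zero]
  exact h

theorem sum_Icc_reflect {M : Type*} [AddCommMonoid M] (f : ℕ → M) :
    ∑ g ∈ Finset.Icc 1 n, f (n - g) = ∑ t ∈ Finset.range n, f t := by
  rw [← Finset.sum_range_reflect]
  refine Finset.sum_bij' (fun g _ => g - 1) (fun t _ => t + 1) ?_ ?_ ?_ ?_ ?_
  · intro a ha; simp at ha ⊢; omega
  · intro a ha; simp at ha ⊢; omega
  · intro a ha; simp at ha ⊢; omega
  · intro a ha; simp
  · intro a ha; simp at ha ⊢; congr 1; omega

theorem sum_Icc_reflect' {M : Type*} [AddCommMonoid M] (f : ℕ → ℕ → M) :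
    ∑ g ∈ Finset.Icc 1 n, f g (n - g) = ∑ t ∈ Finset.range n, f (n - t) t := by
  rw [← sum_Icc_reflect (fun t => f (n - t) t)]
  refine Finset.sum_congr rfl fun g hg => ?_
  rw [Finset.mem_Icc] at hg
  congr 1; omega

theorem Eis.norm (C : Ctx p n vK vL) {y : L} {c : ℕ → K} (hy : vL y = 1)
    (ge1 : ∀ g, 1 ≤ g → g ≤ n → VGe vL n (algebraMap K L (c g)))
    (rel : y ^ n = - ∑ g ∈ Finset.Icc 1 n, (-1) ^ g * algebraMap K L (c g) * y ^ (n - g)) :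
    VGe vL (n + 1) (y ^ n + (-1) ^ n * algebraMap K L (c n)) := by
  have hn := C.npos
  have hmem : n ∈ Finset.Icc 1 n := by simp; omega
  rw [rel, ← Finset.add_sum_erase _ _ hmem]
  simp only [Nat.sub_self, pow_zero, mul_one]
  rw [neg_add_rev, add_assoc, neg_add_cancel, add_zero]
  refine (VGe.sum C.hL _ _ fun g hg => ?_).neg C.hL
  simp only [Finset.mem_erase, Finset.mem_Icc] at hg
  have h1 := ((VGe.negOnePow C.hL g).mul C.hL (ge1 g hg.2.1 hg.2.2)).mul C.hL
    (VGe.ypow C.hL hy (n - g))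
  refine h1.mono ?_
  have : g < n := by omega
  push_cast [Nat.cast_sub this.le]
  have : (g:ℤ) < n := by exact_mod_cast this
  omega

theorem Ctx.eis [FiniteDimensional K L] (C : Ctx p n vK vL)
    (hdim : Module.finrank K L = n) {y : L} (hy : vL y = 1) :
    Eis n vK vL y (minpolyCoeff K n y) := by
  have hdeg := C.natDegree hdim hy
  have hn := C.npos
  have hyint : IsIntegral K y := Algebra.IsIntegral.isIntegral y
  have hc0 : minpolyCoeff K n y 0 = 1 := by
    have hm := minpoly.monic hyint
    rw [Polynomial.Monic, Polynomial.leadingCoeff, hdeg] at hm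
    simp [minpolyCoeff, hm]
  have hrel := minpolyCoeff_eval y y hdeg
  rw [minpoly.aeval] at hrel
  have hrel' : y ^ n = - ∑ g ∈ Finset.Icc 1 n,
      (-1) ^ g * algebraMap K L (minpolyCoeff K n y g) * y ^ (n - g) := by
    have h := hrel.symm
    rw [Finset.range_eq_Ico, Finset.sum_eq_sum_Ico_succ_bot (by omega)] at h
    simp only [hc0, pow_zero, map_one, one_mul, Nat.sub_zero, zero_add] at h
    rw [eq_neg_iff_add_eq_zero]
    exact h
  have hge1 : ∀ g, 1 ≤ g → g ≤ n → VGe vL n (algebraMap K L (minpolyCoeff K n y g)) := by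
    intro g hg1 hgn
    have h1 : VGe vL n (∑ t ∈ Finset.range n,
        algebraMap K L ((-1) ^ (n - t) * minpolyCoeff K n y (n - t)) * y ^ t) := by
      have h2 : VGe vL n (-(y ^ n)) := (VGe.ypow C.hL hy n).neg C.hL
      rw [hrel', neg_neg, sum_Icc_reflect' (fun g s =>
        (-1) ^ g * algebraMap K L (minpolyCoeff K n y g) * y ^ s)] at h2
      simpa using h2
    have h3 := C.nocancel hy _ h1 (n - g) (by omega)
    have h4 := h3.of_mul_right C.hL (vy_pow C.hL hy _)
    rw [Nat.sub_sub_self hgn] at h4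
    have h5 := C.down (M := 1) h4 (by push_cast [Nat.cast_sub hgn]; omega)
    have h6 := (VGe.negOnePow C.hK g).mul C.hK h5
    rw [← mul_assoc, ← mul_pow] at h6
    simp only [mul_neg, mul_one, neg_neg, one_pow, one_mul, zero_add] at h6
    simpa using C.up h6
  refine ⟨hy, hc0, hge1, hrel.symm, ?_⟩
  have hnorm := Eis.norm C hy hge1 hrel'
  have h1 := C.down (M := 1) (hge1 n hn le_rfl) (by simpa using hn)
  refine le_antisymm ?_ h1
  by_contra hlt
  rw [not_le] at hlt
  have h2 : VGe vK 2 (minpolyCoeff K n y n) := by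
    unfold VGe
    cases hx : vK (minpolyCoeff K n y n) with
    | top => exact le_top
    | coe a =>
      rw [hx] at hlt
      have : (1 : ℤ) < a := by exact_mod_cast hlt
      rw [WithTop.coe_le_coe]; omega
  have h3 := (VGe.negOnePow C.hL n).mul C.hL (C.up h2)
  have h4 := hnorm.sub C.hL (h3.mono (show (n:ℤ) + 1 ≤ _ by omega))
  rw [add_sub_cancel_right] at h4
  unfold VGe at h4
  rw [vy_pow C.hL hy] at h4
  have := WithTop.coe_le_coe.1 h4
  omega

/-- The basic estimate: indices of inseparability bound coefficients. -/
theorem Ctx.star (C : Ctx p n vK vL) {y : L} {c : ℕ → K} (E : Eis n vK vL y c) {ν u : ℕ}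
    (hn : n = u * p ^ ν) {s : ℕ} (hs : s ≤ ν) {I : ℤ}
    (hI : (I : WithTop ℤ) ≤ insepIdx vK p ν n (vL (p : L)) c s) {h' : ℕ} (hh' : h' < n)
    {w : ℕ} (hw : ∀ e ≤ ν, p ^ e ∣ n - h' → p ^ e ∣ w * p ^ s) :
    VGe vL (I + h') ((w : L) * algebraMap K L (c h')) := by
  have hp := C.hp
  have : Fact p.Prime := ⟨hp⟩
  set a := min (padicValNat p (n - h')) ν with ha
  have hadvd : p ^ a ∣ n - h' :=
    (pow_dvd_pow p (min_le_left _ _)).trans pow_padicValNat_dvd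
  have h1 : p ^ (a - s) ∣ w := by
    rcases le_total a s with h | h
    · rw [Nat.sub_eq_zero_of_le h, pow_zero]; exact one_dvd _
    · have h2 := hw a (min_le_right _ _) hadvd
      rw [← Nat.sub_add_cancel h, pow_add] at h2
      exact Nat.dvd_of_mul_dvd_mul_right (pow_pos hp.pos s) h2
  refine VGe.dvd C.hL h1 ?_
  -- the index `g ∈ [1,n]` used
  have key : ∃ g, 1 ≤ g ∧ g ≤ n ∧ vbar p ν g ≤ a ∧ ∃ z : WithTop ℤ, vK (c g) = z ∧
      (∀ x : ℤ, z.map (fun a => (n : ℤ) * a - (g : ℤ)) = (x : WithTop ℤ) →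
        VGe vL (x + h') (algebraMap K L (c h'))) ∧ (z = ⊤ → c h' = 0) := by
    rcases Nat.eq_zero_or_pos h' with rfl | hpos
    · refine ⟨n, C.npos, le_rfl, ?_, 1, E.top, ?_, fun h => absurd h (by decide)⟩
      · unfold vbar; rw [ha]; simp
      · intro x hx
        have : (n : ℤ) * 1 - n = x := WithTop.coe_injective hx
        rw [E.c0, map_one]
        refine (VGe.one C.hL).mono ?_
        push_cast; omega
    · refine ⟨h', hpos, hh'.le, ?_, _, rfl, ?_, (C.hK.eq_top_iff _).1⟩
      · unfold vbar
        refine le_min ?_ (min_le_right _ _)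
        rw [← padicValNat_dvd_iff_le (by omega)]
        set b := min (padicValNat p h') ν
        have e1 : p ^ b ∣ h' := (pow_dvd_pow p (min_le_left _ _)).trans pow_padicValNat_dvd
        have e2 : p ^ b ∣ n := by
          rw [hn]; exact ((pow_dvd_pow p (min_le_right _ _))).trans (dvd_mul_left _ _)
        exact Nat.dvd_sub e2 e1
      · intro x hx
        cases hz : vK (c h') with
        | top => rw [hz] at hx; simp at hx
        | coe z =>
          rw [hz] at hx
          have hx : (n : ℤ) * z - h' = x := WithTop.coe_injective hx
          unfold VGe
          rw [C.ram, hz, ← WithTop.coe_nsmul, WithTop.coe_le_coe, nsmul_eq_mul]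
          linarith
  obtain ⟨g, hg1, hgn, hga, z, hz, hzx, hzt⟩ := key
  have hle : insepIdx vK p ν n (vL (p : L)) c s ≤
      z.map (fun a => (n : ℤ) * a - (g : ℤ)) + (a - s) • vL (p : L) := by
    unfold insepIdx
    have hmax : max a s ∈ Finset.Icc s ν := by
      rw [Finset.mem_Icc]; exact ⟨le_max_right _ _, max_le (min_le_right _ _) hs⟩
    refine (Finset.inf_le hmax).trans ?_
    have : max a s - s = a - s := by omega
    rw [this]
    gcongr
    unfold iPi
    have hg : g ∈ (Finset.Icc 1 n).filter fun h => vbar p ν h ≤ max a s := by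
      rw [Finset.mem_filter, Finset.mem_Icc]
      exact ⟨⟨hg1, hgn⟩, hga.trans (le_max_left _ _)⟩
    refine (Finset.inf_le hg).trans ?_
    rw [hz]
  have hle2 := hI.trans hle
  cases hm : z.map (fun a => (n : ℤ) * a - (g : ℤ)) with
  | top =>
    have : z = ⊤ := by simpa using hm
    rw [hzt this, map_zero, mul_zero]
    exact VGe.zero C.hL _
  | coe x =>
    rw [hm] at hle2
    have h3 := hzx x hm
    rw [Nat.cast_pow]
    unfold VGe at *
    rw [C.hL.map_mul, C.hL.pow]
    refine le_trans ?_ (add_le_add_right h3 _)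
    cases hq : (a - s) • vL (p : L) with
    | top => simp
    | coe q =>
      rw [hq] at hle2
      norm_cast at hle2 ⊢
      omega

theorem insepIdx_nonneg (C : Ctx p n vK vL) {y : L} {c : ℕ → K} (E : Eis n vK vL y c)
    (ν s : ℕ) : (0 : WithTop ℤ) ≤ insepIdx vK p ν n (vL (p : L)) c s := by
  unfold insepIdx
  refine Finset.le_inf fun j' _ => ?_
  refine add_nonneg ?_ (nsmul_nonneg ?_ _)
  · unfold iPi
    refine Finset.le_inf fun g hg => ?_
    rw [Finset.mem_filter, Finset.mem_Icc] at hg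
    have h1 := E.ge C g hg.1.2
    cases hz : vK (c g) with
    | top => simp
    | coe z =>
      unfold VGe at h1
      rw [C.ram, hz, ← WithTop.coe_nsmul, WithTop.coe_le_coe, nsmul_eq_mul] at h1
      have : (0:ℤ) ≤ n * z - g := by linarith
      exact WithTop.coe_le_coe.2 this
  · have := C.pL
    unfold VGe at this
    refine le_trans ?_ this
    exact_mod_cast Nat.zero_le n

end eis

/-! ### Arithmetic of binomial and multinomial coefficients -/

theorem dvd_mul_multinomial {ι : Type*} (s : Finset ι) (f : ι → ℕ) {t : ι} (ht : t ∈ s) :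
    (∑ i ∈ s, f i) ∣ f t * Nat.multinomial s f := by
  have h1 : s = insert t (s.erase t) := (Finset.insert_erase ht).symm
  rcases Nat.eq_zero_or_pos (f t) with h0 | hpos
  · rw [h0, zero_mul]; exact dvd_zero _
  have h2 : Nat.multinomial s f =
      (f t + ∑ i ∈ s.erase t, f i).choose (f t) * Nat.multinomial (s.erase t) f := by
    conv_lhs => rw [h1]
    rw [Nat.multinomial_insert (Finset.notMem_erase t s)]
  rw [h2, Finset.add_sum_erase s f ht]
  have hle : f t ≤ ∑ i ∈ s, f i := Finset.single_le_sum (fun _ _ => Nat.zero_le _) ht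
  obtain ⟨a, ha⟩ : ∃ a, f t = a + 1 := ⟨f t - 1, by omega⟩
  obtain ⟨b, hb⟩ : ∃ b, ∑ i ∈ s, f i = b + 1 := ⟨(∑ i ∈ s, f i) - 1, by omega⟩
  rw [ha, hb, ← mul_assoc, mul_comm (a + 1), ← Nat.add_one_mul_choose_eq, mul_assoc]
  exact dvd_mul_right _ _

theorem dvd_mul_choose {N i : ℕ} (hN : 1 ≤ N) (hi : 1 ≤ i) : N ∣ i * N.choose i := by
  obtain ⟨a, rfl⟩ : ∃ a, N = a + 1 := ⟨N - 1, by omega⟩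
  obtain ⟨b, rfl⟩ : ∃ b, i = b + 1 := ⟨i - 1, by omega⟩
  rw [mul_comm, ← Nat.add_one_mul_choose_eq]
  exact dvd_mul_right _ _

theorem pow_dvd_of_not_dvd {p : ℕ} (hp : p.Prime) {m j x w : ℕ} (hjm : j ≤ m)
    (h : p ^ m ∣ x * w) (hx : ¬ p ^ (j + 1) ∣ x) : p ^ (m - j) ∣ w := by
  have hx0 : x ≠ 0 := by rintro rfl; exact hx (dvd_zero _)
  obtain ⟨e, x', hx', rfl⟩ := Nat.exists_eq_pow_mul_and_not_dvd hx0 p hp.ne_one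
  have hej : e ≤ j := by
    by_contra hlt
    exact hx ((pow_dvd_pow p (by omega)).trans (dvd_mul_right _ _))
  have h1 : p ^ (m - e) ∣ x' * w := by
    have : p ^ m = p ^ e * p ^ (m - e) := by rw [← pow_add]; congr 1; omega
    rw [this, mul_assoc] at h
    exact Nat.dvd_of_mul_dvd_mul_left (pow_pos hp.pos e) h
  have hc : Nat.Coprime (p ^ (m - e)) x' :=
    Nat.Coprime.pow_left _ ((Nat.Prime.coprime_iff_not_dvd hp).2 hx')
  exact (pow_dvd_pow p (by omega)).trans (hc.dvd_of_dvd_mul_left h1)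

theorem choose_modEq_one {p : ℕ} (hp : p.Prime) (m M : ℕ) (hM : 1 ≤ M) :
    (p ^ m * M - 1).choose (p ^ m - 1) ≡ 1 [MOD p] := by
  have : Fact p.Prime := ⟨hp⟩
  have hp2 := hp.two_le
  induction m with
  | zero => simp; rfl
  | succ m ih =>
    have key : ∀ X, 1 ≤ X → (p * X - 1) % p = p - 1 ∧ (p * X - 1) / p = X - 1 := by
      intro X hX
      have e : p * X - 1 = (p - 1) + p * (X - 1) := by
        obtain ⟨Y, rfl⟩ : ∃ Y, X = Y + 1 := ⟨X - 1, by omega⟩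
        rw [mul_add, Nat.add_sub_cancel]; omega
      rw [e, Nat.add_mul_mod_self_left, Nat.add_mul_div_left _ _ hp.pos,
        Nat.mod_eq_of_lt (by omega), Nat.div_eq_of_lt (by omega), zero_add]
      exact ⟨rfl, rfl⟩
    have h1 := Choose.choose_modEq_choose_mod_mul_choose_div_nat (p := p)
      (n := p ^ (m + 1) * M - 1) (k := p ^ (m + 1) - 1)
    have hq : 1 ≤ p ^ m := Nat.one_le_pow _ _ hp.pos
    have k1 := key (p ^ m * M) (Nat.mul_pos hq hM)
    have k2 := key (p ^ m) hq
    rw [← mul_assoc, ← pow_succ'] at k1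
    rw [← pow_succ'] at k2
    rw [k1.1, k1.2, k2.1, k2.2, Nat.choose_self, one_mul] at h1
    exact h1.trans ih

theorem choose_pow_eq {p : ℕ} (hp : p.Prime) (m M : ℕ) (hM : 1 ≤ M) :
    ∃ d : ℤ, ((p ^ m * M).choose (p ^ m) : ℤ) = M + M * (p * d) := by
  have hq : 1 ≤ p ^ m := Nat.one_le_pow _ _ hp.pos
  have h1 := choose_modEq_one hp m M hM
  have hqM := Nat.mul_pos hq hM
  obtain ⟨d, hd⟩ := (Nat.modEq_iff_dvd.1 h1.symm)
  refine ⟨d, ?_⟩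
  have h2 := Nat.add_one_mul_choose_eq (p ^ m * M - 1) (p ^ m - 1)
  rw [Nat.sub_add_cancel hq, Nat.sub_add_cancel hqM] at h2
  have h3 : M * (p ^ m * M - 1).choose (p ^ m - 1) = (p ^ m * M).choose (p ^ m) := by
    apply Nat.eq_of_mul_eq_mul_left hq
    rw [← mul_assoc, h2, mul_comm]
  rw [← h3]
  push_cast at hd ⊢
  rw [← hd]; ring

/-! ### The negligible terms -/

section negl
variable {K L : Type*} [Field K] [Field L] [Algebra K L] {p n : ℕ} {vK : K → WithTop ℤ}
    {vL : L → WithTop ℤ}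

/-- All the coordinates of `x` with index `g` of small `p`-valuation are small. -/
def InR (p ν n j : ℕ) (vL : L → WithTop ℤ) (y : L) (κ : ℕ → L →ₗ[K] K) (Q : ℤ) (x : L) : Prop :=
  ∀ g, 1 ≤ g → g ≤ n → (j < ν → ¬ p ^ (j + 1) ∣ g) →
    VGe vL (Q + n) (algebraMap K L (κ (n - g) x) * y ^ (n - g))

variable {ν j : ℕ} {y : L} {κ : ℕ → L →ₗ[K] K} {Q : ℤ}

theorem InR.add (C : Ctx p n vK vL) {x z : L} (hx : InR p ν n j vL y κ Q x)
    (hz : InR p ν n j vL y κ Q z) : InR p ν n j vL y κ Q (x + z) := by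
  intro g h1 h2 h3
  rw [map_add, map_add, add_mul]
  exact (hx g h1 h2 h3).add C.hL (hz g h1 h2 h3)

theorem InR.of_VGe (Y : YData n vL y κ) {x : L} (hx : VGe vL (Q + n) x) :
    InR p ν n j vL y κ Q x := fun g h1 h2 _ => Y.ge (n - g) (by omega) x _ hx

theorem InR.sum (C : Ctx p n vK vL) (Y : YData n vL y κ) {ι : Type*} (s : Finset ι) (f : ι → L)
    (h : ∀ i ∈ s, InR p ν n j vL y κ Q (f i)) : InR p ν n j vL y κ Q (∑ i ∈ s, f i) :=
  Finset.sum_induction f _ (fun _ _ hx hy => InR.add C hx hy) (InR.of_VGe Y (VGe.zero C.hL _)) h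

theorem InR.mono {x : L} {Q' : ℤ} (hx : InR p ν n j vL y κ Q x) (h : Q' ≤ Q) :
    InR p ν n j vL y κ Q' x := fun g h1 h2 h3 => (hx g h1 h2 h3).mono (by omega)

theorem InR.neg (C : Ctx p n vK vL) {x : L} (hx : InR p ν n j vL y κ Q x) :
    InR p ν n j vL y κ Q (-x) := by
  intro g h1 h2 h3
  rw [map_neg, map_neg, neg_mul]
  exact (hx g h1 h2 h3).neg C.hL

theorem InR.ypow (C : Ctx p n vK vL) (Y : YData n vL y κ) {ct : ℕ → K}
    (E : Eis n vK vL y ct) (hjν : j < ν) (hjn : p ^ (j + 1) ∣ n) {B D : ℤ}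
    (HB : ∀ g, 1 ≤ g → g ≤ n → (j < ν → ¬ p ^ (j + 1) ∣ g) →
      VGe vL (B + g) (algebraMap K L (ct g))) (hQ : Q ≤ B + D) :
    ∀ T, p ^ (j + 1) ∣ T → ∀ β : K, VGe vL (n + D) (algebraMap K L β * y ^ T) →
      InR p ν n j vL y κ Q (algebraMap K L β * y ^ T) := by
  intro T
  induction T using Nat.strong_induction_on with
  | _ T ih =>
    intro hT β hβ
    rcases lt_or_ge T n with hlt | hge
    · intro g h1 h2 h3
      have : κ (n - g) (algebraMap K L β * y ^ T) = 0 := by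
        rw [← Algebra.smul_def, map_smul, Y.single (n - g) (by omega) T hlt, if_neg, smul_zero]
        intro he
        apply h3 hjν
        have : g = n - T := by omega
        rw [this]
        exact Nat.dvd_sub hjn hT
      rw [this, map_zero, zero_mul]
      exact VGe.zero C.hL _
    · have e : algebraMap K L β * y ^ T = ∑ g ∈ Finset.Icc 1 n,
          algebraMap K L (-(β * ((-1) ^ g * ct g))) * y ^ (T - g) := by
        have : y ^ T = y ^ (T - n) * y ^ n := by rw [← pow_add]; congr 1; omega
        rw [this, E.rel', mul_neg, mul_neg, Finset.mul_sum,
          Finset.mul_sum, ← Finset.sum_neg_distrib]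
        refine Finset.sum_congr rfl fun g hg => ?_
        rw [Finset.mem_Icc] at hg
        have : y ^ (T - g) = y ^ (T - n) * y ^ (n - g) := by rw [← pow_add]; congr 1; omega
        rw [this]
        simp only [map_neg, map_mul, map_pow, map_one]
        ring
      have hβ' := hβ.of_mul_right C.hL (vy_pow C.hL E.vy T)
      have hterm : ∀ g, 1 ≤ g → g ≤ n → ∀ Z : ℤ, VGe vL (Z + g) (algebraMap K L (ct g)) →
          VGe vL (n + D + Z) (algebraMap K L (-(β * ((-1) ^ g * ct g))) * y ^ (T - g)) := by
        intro g hg1 hgn Z hZ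
        rw [map_neg, map_mul, map_mul, map_pow, map_neg, map_one]
        have h1 := ((hβ'.mul C.hL ((VGe.negOnePow C.hL g).mul C.hL hZ)).neg C.hL).mul C.hL
          (VGe.ypow C.hL E.vy (T - g))
        refine h1.mono ?_
        push_cast [Nat.cast_sub (hgn.trans hge)]
        linarith
      rw [e]
      refine InR.sum C Y _ _ fun g hg => ?_
      rw [Finset.mem_Icc] at hg
      by_cases hd : p ^ (j + 1) ∣ g
      · refine ih (T - g) (by omega) (Nat.dvd_sub hT hd) _ ?_
        have := hterm g hg.1 hg.2 0 (by rw [zero_add]; exact E.ge C g hg.2)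
        rwa [add_zero] at this
      · refine InR.of_VGe Y ((hterm g hg.1 hg.2 B (HB g hg.1 hg.2 fun _ => hd)).mono ?_)
        linarith

theorem InR.primePow (C : Ctx p n vK vL) (Y : YData n vL y κ) {ct : ℕ → K}
    (E : Eis n vK vL y ct) (hjν : j < ν) (hjn : p ^ (j + 1) ∣ n) {B D : ℤ}
    (HB : ∀ g, 1 ≤ g → g ≤ n → (j < ν → ¬ p ^ (j + 1) ∣ g) →
      VGe vL (B + g) (algebraMap K L (ct g))) (hQ : Q ≤ B + D)
    {m : ℕ} (hm : j ≤ m) {G : ℤ} {z : L} (hz : VGe vL G z) {γ : K}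
    (h1 : VGe vL (n + D - p ^ m * G) (algebraMap K L γ))
    (h2 : VGe vL (Q + n - p ^ m * G) (((p ^ (m - j) : ℕ) : L) * algebraMap K L γ)) :
    InR p ν n j vL y κ Q (algebraMap K L γ * z ^ (p ^ m)) := by
  rw [Y.expand z, Finset.sum_pow_eq_sum_piAntidiag, Finset.mul_sum]
  refine InR.sum C Y _ _ fun e he => ?_
  rw [Finset.mem_piAntidiag] at he
  have hprod : VGe vL (p ^ m * G)
      (∏ t ∈ Finset.range n, (algebraMap K L (κ t z) * y ^ t) ^ e t) := by
    have := VGe.prod C.hL (Finset.range n) (fun t => (algebraMap K L (κ t z) * y ^ t) ^ e t)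
      (fun t => (e t : ℤ) * G) fun t ht =>
        (Y.ge t (Finset.mem_range.1 ht) z G hz).pow C.hL (e t)
    rw [← Finset.sum_mul] at this
    have e1 : ∑ t ∈ Finset.range n, (e t : ℤ) = (p : ℤ) ^ m := by exact_mod_cast he.1
    rwa [e1] at this
  by_cases hall : ∀ t ∈ Finset.range n, p ^ (j + 1) ∣ e t
  · have e2 : algebraMap K L γ * ((Nat.multinomial (Finset.range n) e : L) *
        ∏ t ∈ Finset.range n, (algebraMap K L (κ t z) * y ^ t) ^ e t) =
        algebraMap K L (γ * (Nat.multinomial (Finset.range n) e *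
          ∏ t ∈ Finset.range n, κ t z ^ e t)) * y ^ (∑ t ∈ Finset.range n, t * e t) := by
      simp only [mul_pow, Finset.prod_mul_distrib, map_mul, map_prod, map_pow, map_natCast,
        ← pow_mul, Finset.prod_pow_eq_pow_sum]
      ring
    have h3 := h1.mul C.hL ((VGe.natCast C.hL (Nat.multinomial (Finset.range n) e)).mul
      C.hL hprod)
    rw [e2] at h3 ⊢
    refine InR.ypow C Y E hjν hjn HB hQ _ ?_ _ (h3.mono (by linarith))
    exact Finset.dvd_sum fun t ht => Dvd.dvd.mul_left (hall t ht) _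
  · push Not at hall
    obtain ⟨t, ht, hnd⟩ := hall
    refine InR.of_VGe Y ?_
    have h3 := dvd_mul_multinomial (Finset.range n) e ht
    rw [he.1] at h3
    have h4 := VGe.dvd C.hL (pow_dvd_of_not_dvd C.hp hm h3 hnd) h2
    rw [mul_left_comm, ← mul_assoc]
    exact (h4.mul C.hL hprod).mono (by linarith)

/-- The terms of the expansion whose exponent `i` is divisible by `p^(j+1)`. -/
theorem Ctx.termHigh (C : Ctx p n vK vL) (Y : YData n vL y κ) {ct : ℕ → K}
    (Et : Eis n vK vL y ct) {π : L} {c : ℕ → K} (E : Eis n vK vL π c) {u : ℕ}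
    (hn : n = u * p ^ ν) (hj : j ≤ ν) {I : ℤ}
    (hI : (I : WithTop ℤ) ≤ insepIdx vK p ν n (vL (p : L)) c j) {B : ℤ}
    (HB : ∀ g, 1 ≤ g → g ≤ n → (j < ν → ¬ p ^ (j + 1) ∣ g) →
      VGe vL (B + g) (algebraMap K L (ct g))) {ℓ : ℕ}
    (hQ : Q ≤ B + p ^ (j + 1) * ℓ) (hQ2 : Q ≤ I + p ^ (j + 1) * ℓ)
    {η : L} (hη : VGe vL ℓ η) {h' i : ℕ} (hh' : h' < n) (hi : 1 ≤ i)
    (hpi : p ^ (j + 1) ∣ i) :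
    InR p ν n j vL y κ Q ((-1) ^ h' * algebraMap K L (c h') * ((n - h').choose i : L) *
      y ^ (n - h') * η ^ i) := by
  have hp := C.hp
  set N := n - h' with hN
  have hNh : (N : ℤ) + h' = n := by rw [hN]; push_cast [Nat.cast_sub hh'.le]; ring
  have hile : p ^ (j + 1) ≤ i := Nat.le_of_dvd hi hpi
  have hiℓ : (p : ℤ) ^ (j + 1) * ℓ ≤ i * ℓ := by
    have : ((p ^ (j + 1) : ℕ) : ℤ) ≤ i := by exact_mod_cast hile
    push_cast at this
    exact mul_le_mul_of_nonneg_right this (by positivity)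
  have hyη : VGe vL (N + i * ℓ) (y ^ N * η ^ i) :=
    (VGe.ypow C.hL Y.vy N).mul C.hL (hη.pow C.hL i)
  by_cases hcase : j < ν ∧ p ^ (j + 1) ∣ N
  · obtain ⟨hjν, hjN⟩ := hcase
    have hjn : p ^ (j + 1) ∣ n := by
      rw [hn]; exact (pow_dvd_pow p hjν).trans (dvd_mul_left _ _)
    -- the largest exponent `m ≤ ν` with `p^m` dividing both `N` and `i`
    obtain ⟨m, hm, hmax⟩ : ∃ m, (m ≤ ν ∧ p ^ m ∣ N ∧ p ^ m ∣ i) ∧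
        ∀ m', m' ≤ ν ∧ p ^ m' ∣ N ∧ p ^ m' ∣ i → m' ≤ m := by
      refine ⟨Nat.findGreatest (fun m => m ≤ ν ∧ p ^ m ∣ N ∧ p ^ m ∣ i) ν, ?_, ?_⟩
      · exact Nat.findGreatest_spec (P := fun m => m ≤ ν ∧ p ^ m ∣ N ∧ p ^ m ∣ i)
          (Nat.zero_le ν) ⟨Nat.zero_le _, by simp, by simp⟩
      · intro m' h
        exact Nat.le_findGreatest h.1 h
    have hjm : j + 1 ≤ m := hmax _ ⟨hjν, hjN, hpi⟩
    obtain ⟨N', hN'⟩ := hm.2.1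
    obtain ⟨i', hi'⟩ := hm.2.2
    have e1 : (-1) ^ h' * algebraMap K L (c h') * (N.choose i : L) * y ^ N * η ^ i =
        algebraMap K L ((-1) ^ h' * c h' * N.choose i) * (y ^ N' * η ^ i') ^ (p ^ m) := by
      rw [mul_pow, ← pow_mul, ← pow_mul, mul_comm N', mul_comm i', ← hN', ← hi']
      simp only [map_mul, map_pow, map_neg, map_one, map_natCast]
      ring
    rw [e1]
    have hG : (p : ℤ) ^ m * (N' + i' * ℓ) = N + i * ℓ := by
      rw [hN', hi']; push_cast; ring
    refine InR.primePow C Y Et hjν hjn HB hQ (by omega) (G := N' + i' * ℓ)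
      ((VGe.ypow C.hL Y.vy N').mul C.hL (hη.pow C.hL i')) ?_ ?_
    · rw [hG]
      simp only [map_mul, map_pow, map_neg, map_one, map_natCast]
      refine (((VGe.negOnePow C.hL h').mul C.hL (E.ge C h' hh'.le)).mul C.hL
        (VGe.natCast C.hL _)).mono ?_
      linarith
    · rw [hG]
      have hs := C.star E hn hj hI hh' (w := p ^ (m - j) * N.choose i) (by
        intro e he hdv
        rw [mul_right_comm, ← pow_add, Nat.sub_add_cancel (by omega)]
        have hd2 : p ^ e ∣ i * N.choose i :=
          hdv.trans (dvd_mul_choose (by omega) hi)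
        by_cases hem : e ≤ m
        · exact (pow_dvd_pow p hem).trans (dvd_mul_right _ _)
        · have hmi : ¬ p ^ (m + 1) ∣ i := by
            intro hd
            have := hmax (m + 1) ⟨by omega, (pow_dvd_pow p (by omega)).trans hdv, hd⟩
            omega
          have := pow_dvd_of_not_dvd hp (by omega) hd2 hmi
          have h5 : p ^ e = p ^ m * p ^ (e - m) := by rw [← pow_add]; congr 1; omega
          rw [h5]
          exact Nat.mul_dvd_mul_left _ this)
      have e3 : ((p ^ (m - j) : ℕ) : L) * algebraMap K L ((-1) ^ h' * c h' * N.choose i) =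
          (-1) ^ h' * (((p ^ (m - j) * N.choose i : ℕ) : L) * algebraMap K L (c h')) := by
        simp only [map_mul, map_pow, map_neg, map_one, map_natCast]
        push_cast; ring
      rw [e3]
      refine ((VGe.negOnePow C.hL h').mul C.hL hs).mono ?_
      linarith
  · refine InR.of_VGe Y ?_
    have hs := C.star E hn hj hI hh' (w := 1) (by
      intro e he hdv
      rw [one_mul]
      refine pow_dvd_pow p ?_
      by_contra hlt
      exact hcase ⟨by omega, (pow_dvd_pow p (by omega)).trans hdv⟩)
    rw [Nat.cast_one, one_mul] at hs
    have := (((VGe.negOnePow C.hL h').mul C.hL hs).mul C.hL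
      (VGe.natCast C.hL (N.choose i))).mul C.hL hyη
    rw [← mul_assoc] at this
    exact this.mono (by linarith)

/-- The terms whose exponent is not divisible by `p^(s+1)`. -/
theorem Ctx.termLow (C : Ctx p n vK vL) (hy : vL y = 1)
    {π : L} {c : ℕ → K} (E : Eis n vK vL π c) {u : ℕ}
    (hn : n = u * p ^ ν) {s : ℕ} (hs : s ≤ ν) {I : ℤ}
    (hI : (I : WithTop ℤ) ≤ insepIdx vK p ν n (vL (p : L)) c s)
    {h' i : ℕ} (hh' : h' < n) (hi : 1 ≤ i) (hpi : ¬ p ^ (s + 1) ∣ i)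
    {z : L} {M : ℤ} (hz : VGe vL M z) :
    VGe vL (I + n + M) ((-1) ^ h' * algebraMap K L (c h') * ((n - h').choose i : L) *
      y ^ (n - h') * z) := by
  have hst := C.star E hn hs hI hh' (w := (n - h').choose i) (by
    intro e he hdv
    by_cases hes : e ≤ s
    · exact (pow_dvd_pow p hes).trans (dvd_mul_left _ _)
    · have := pow_dvd_of_not_dvd C.hp (by omega)
        (hdv.trans (dvd_mul_choose (by omega) hi)) hpi
      have h5 : p ^ e = p ^ (e - s) * p ^ s := by rw [← pow_add]; congr 1; omega
      rw [h5]
      exact Nat.mul_dvd_mul_right this _)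
  have := (((VGe.negOnePow C.hL h').mul C.hL hst).mul C.hL
      (VGe.ypow C.hL hy (n - h'))).mul C.hL hz
  have e : (-1) ^ h' * (((n - h').choose i : L) * algebraMap K L (c h')) * y ^ (n - h') * z =
    (-1) ^ h' * algebraMap K L (c h') * ((n - h').choose i : L) * y ^ (n - h') * z := by ring
  rw [e] at this
  refine this.mono ?_
  push_cast [Nat.cast_sub hh'.le]
  linarith

end negl

/-! ### Expansion, bootstrap and main terms -/

section main
variable {K L : Type*} [Field K] [Field L] [Algebra K L] {p n : ℕ} {vK : K → WithTop ℤ}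
    {vL : L → WithTop ℤ} {ν j : ℕ} {y : L} {κ : ℕ → L →ₗ[K] K} {Q : ℤ}

theorem expandD {π η : L} {c ct : ℕ → K} (E : Eis n vK vL π c) (Et : Eis n vK vL y ct)
    (hπ : π = y * (1 + η)) :
    ∑ g ∈ Finset.Icc 1 n, (-1) ^ g * algebraMap K L (ct g - c g) * y ^ (n - g) =
      ∑ h' ∈ Finset.range n, ∑ i ∈ Finset.Icc 1 n,
        (-1) ^ h' * algebraMap K L (c h') * ((n - h').choose i : L) * y ^ (n - h') * η ^ i := by
  have h1 : ∀ N ≤ n, π ^ N - y ^ N =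
      ∑ i ∈ Finset.Icc 1 n, (N.choose i : L) * y ^ N * η ^ i := by
    intro N hN
    have e1 : (1 + η) ^ N = ∑ i ∈ Finset.range (n + 1), (N.choose i : L) * η ^ i := by
      rw [add_comm, add_pow]
      have hsub : Finset.range (N + 1) ⊆ Finset.range (n + 1) :=
        Finset.range_subset_range.2 (by omega)
      rw [← Finset.sum_subset hsub]
      · refine Finset.sum_congr rfl fun i _ => ?_
        rw [one_pow]; ring
      · intro i _ hi
        rw [Finset.mem_range, not_lt] at hi
        rw [Nat.choose_eq_zero_of_lt (by omega)]; simp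
    rw [hπ, mul_pow, e1, Finset.range_eq_Ico, Finset.sum_eq_sum_Ico_succ_bot (by omega)]
    simp only [Nat.choose_zero_right, Nat.cast_one, pow_zero, mul_one, zero_add, mul_add]
    rw [add_sub_cancel_left, Finset.mul_sum]
    refine Finset.sum_congr rfl fun i _ => ?_
    ring
  have h2 : ∑ g ∈ Finset.Icc 1 n, (-1) ^ g * algebraMap K L (ct g - c g) * y ^ (n - g) =
      ∑ g ∈ Finset.range (n + 1), (-1) ^ g * algebraMap K L (ct g - c g) * y ^ (n - g) := by
    rw [Finset.range_eq_Ico, Finset.sum_eq_sum_Ico_succ_bot (by omega), E.c0, Et.c0]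
    simp only [sub_self, map_zero, mul_zero, zero_mul, zero_add]
    rfl
  have h3 : ∑ h' ∈ Finset.range n, ∑ i ∈ Finset.Icc 1 n,
        (-1) ^ h' * algebraMap K L (c h') * ((n - h').choose i : L) * y ^ (n - h') * η ^ i =
      ∑ h' ∈ Finset.range (n + 1),
        (-1) ^ h' * algebraMap K L (c h') * (π ^ (n - h') - y ^ (n - h')) := by
    rw [Finset.sum_range_succ]
    simp only [Nat.sub_self, pow_zero, sub_self, mul_zero, add_zero]
    refine Finset.sum_congr rfl fun h' _ => ?_
    rw [h1 _ (by omega), Finset.mul_sum]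
    refine Finset.sum_congr rfl fun i _ => ?_
    ring
  rw [h2, h3]
  have h4 : ∀ g, (-1) ^ g * algebraMap K L (ct g - c g) * y ^ (n - g) =
      (-1) ^ g * algebraMap K L (ct g) * y ^ (n - g) -
        (-1) ^ g * algebraMap K L (c g) * y ^ (n - g) := by
    intro g; rw [map_sub]; ring
  simp only [h4, mul_sub, Finset.sum_sub_distrib]
  rw [E.rel, Et.rel]

theorem YData.coordD (C : Ctx p n vK vL) (Y : YData n vL y κ) (d : ℕ → K) {g : ℕ} (hg : 1 ≤ g)
    (hgn : g ≤ n) : κ (n - g) (∑ g ∈ Finset.Icc 1 n,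
      (-1) ^ g * algebraMap K L (d g) * y ^ (n - g)) = (-1) ^ g * d g := by
  rw [map_sum, Finset.sum_eq_single g]
  · have : (-1) ^ g * algebraMap K L (d g) * y ^ (n - g) = ((-1) ^ g * d g) • y ^ (n - g) := by
      rw [Algebra.smul_def]; simp
    rw [this, map_smul, Y.single _ (by omega) _ (by omega)]; simp
  · intro b hb hne
    rw [Finset.mem_Icc] at hb
    have : (-1) ^ b * algebraMap K L (d b) * y ^ (n - b) = ((-1) ^ b * d b) • y ^ (n - b) := by
      rw [Algebra.smul_def]; simp
    rw [this, map_smul, Y.single _ (by omega) _ (by omega), if_neg (by omega), smul_zero]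
  · intro h; exact absurd (Finset.mem_Icc.2 ⟨hg, hgn⟩) h

theorem exists_exact {p : ℕ} (hp : p.Prime) {j i : ℕ} (hi : ¬ p ^ (j + 1) ∣ i) :
    ∃ s ≤ j, p ^ s ∣ i ∧ ¬ p ^ (s + 1) ∣ i := by
  have hx0 : i ≠ 0 := by rintro rfl; exact hi (dvd_zero _)
  obtain ⟨e, x', hx', rfl⟩ := Nat.exists_eq_pow_mul_and_not_dvd hx0 p hp.ne_one
  refine ⟨e, ?_, dvd_mul_right _ _, ?_⟩
  · by_contra hlt
    exact hi ((pow_dvd_pow p (by omega)).trans (dvd_mul_right _ _))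
  · rw [pow_succ]
    intro h
    exact hx' (Nat.dvd_of_mul_dvd_mul_left (pow_pos hp.pos e) h)

/-- A priori bound for the coefficients of the perturbed polynomial. -/
theorem Ctx.boot (C : Ctx p n vK vL) (Y : YData n vL y κ) {ct : ℕ → K}
    (Et : Eis n vK vL y ct) {π : L} {c : ℕ → K} (E : Eis n vK vL π c) {u : ℕ}
    (hn : n = u * p ^ ν) (hj : j ≤ ν) {ℓ Φ : ℕ} (hℓ : 1 ≤ ℓ)
    (hI : ∀ m ≤ j, (((Φ : ℤ) - p ^ m * ℓ : ℤ) : WithTop ℤ) ≤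
      insepIdx vK p ν n (vL (p : L)) c m)
    {η : L} (hη : VGe vL ℓ η) (hπ : π = y * (1 + η)) (B : ℕ)
    (hB : (B : ℤ) ≤ Φ - p ^ j * ℓ) :
    ∀ g, 1 ≤ g → g ≤ n → (j < ν → ¬ p ^ (j + 1) ∣ g) →
      VGe vL (B + g) (algebraMap K L (ct g)) := by
  have hp := C.hp
  have hpow : (p : ℤ) ^ j * ℓ + 1 ≤ p ^ (j + 1) * ℓ := by
    have h1 : p ^ j * ℓ < p ^ (j + 1) * ℓ :=
      Nat.mul_lt_mul_of_pos_right (Nat.pow_lt_pow_right hp.one_lt (by omega)) hℓ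
    exact_mod_cast h1
  have hpow0 : (0 : ℤ) ≤ p ^ j * ℓ := by positivity
  induction B with
  | zero => intro g _ hgn _; simpa using Et.ge C g hgn
  | succ B ih =>
    push_cast at hB ⊢
    have HB := ih (by omega)
    have hD : InR p ν n j vL y κ (B + 1)
        (∑ g ∈ Finset.Icc 1 n, (-1) ^ g * algebraMap K L (ct g - c g) * y ^ (n - g)) := by
      rw [expandD E Et hπ]
      refine InR.sum C Y _ _ fun h' hh' => InR.sum C Y _ _ fun i hi => ?_
      rw [Finset.mem_range] at hh'
      rw [Finset.mem_Icc] at hi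
      by_cases hpi : p ^ (j + 1) ∣ i
      · exact C.termHigh Y Et E hn hj (hI j le_rfl) HB (by omega) (by omega) hη hh' hi.1 hpi
      · obtain ⟨s, hsj, hs1, hs2⟩ := exists_exact hp hpi
        refine InR.of_VGe Y ((C.termLow Y.vy E hn (hsj.trans hj) (hI s hsj) hh' hi.1 hs2
          (hη.pow C.hL i)).mono ?_)
        have : (p : ℤ) ^ s * ℓ ≤ i * ℓ := by
          have : p ^ s ≤ i := Nat.le_of_dvd hi.1 hs1
          exact_mod_cast Nat.mul_le_mul_right ℓ this
        omega
    intro g hg1 hgn hgp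
    have h1 := hD g hg1 hgn hgp
    rw [Y.coordD C (fun g => ct g - c g) hg1 hgn] at h1
    have h2 := h1.of_mul_right C.hL (vy_pow C.hL Y.vy (n - g))
    have h3 := (VGe.negOnePow C.hL g).mul C.hL h2
    rw [map_mul, map_pow, map_neg, map_one, ← mul_assoc, ← mul_pow] at h3
    simp only [mul_neg, mul_one, neg_neg, one_pow, one_mul, zero_add] at h3
    have h4 : VGe vL (B + 1 + g) (algebraMap K L (c g)) := by
      rcases hgn.lt_or_eq with hlt | rfl
      · have hs := C.star E hn hj (hI j le_rfl) hlt (w := 1) (by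
          intro e he hdv
          rw [one_mul]
          refine pow_dvd_pow p ?_
          by_contra hcon
          have hjν : j < ν := by omega
          apply hgp hjν
          have d1 : p ^ (j + 1) ∣ n := by
            rw [hn]; exact (pow_dvd_pow p hjν).trans (dvd_mul_left _ _)
          have d2 : p ^ (j + 1) ∣ n - g := (pow_dvd_pow p (by omega)).trans hdv
          have := Nat.dvd_sub d1 d2
          rwa [Nat.sub_sub_self hgn] at this)
        rw [Nat.cast_one, one_mul] at hs
        exact hs.mono (by omega)
      · -- `g = n` : only possible if `j = ν`
        exfalso
        have hjν : ¬ j < ν := fun hjν => hgp hjν (by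
          conv_rhs => rw [hn]
          exact (pow_dvd_pow p hjν).trans (dvd_mul_left _ _))
        have hjν : j = ν := by omega
        subst hjν
        have h5 := C.star E hn le_rfl (hI j le_rfl) (h' := 0) C.npos (w := 1) (by
          intro e he _
          rw [one_mul]; exact pow_dvd_pow p he)
        rw [E.c0, map_one] at h5
        unfold VGe at h5
        have h6 : (((Φ : ℤ) - p ^ j * ℓ + ((0 : ℕ) : ℤ) : ℤ) : WithTop ℤ) ≤ ((0 : ℤ) : WithTop ℤ) := by
          simpa [C.hL.one] using h5
        rw [WithTop.coe_le_coe] at h6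
        push_cast at h6
        omega
    have h5 := h4.add C.hL (h3.mono (show (B:ℤ) + 1 + g ≤ _ by
      push_cast [Nat.cast_sub hgn]; omega))
    rw [← map_add] at h5
    simpa using h5

theorem sign_lemma {p : ℕ} (hp : p.Prime) (m ℓ h d : ℕ) :
    ∃ t : ℤ, (-1 : ℤ) ^ (p ^ m + ℓ * p ^ m + h + d) - (-1) ^ (1 + ℓ + h + d) = p * t := by
  rcases hp.eq_two_or_odd' with rfl | hodd
  · rcases neg_one_pow_eq_or ℤ (2 ^ m + ℓ * 2 ^ m + h + d) with e1 | e1 <;>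
    rcases neg_one_pow_eq_or ℤ (1 + ℓ + h + d) with e2 | e2 <;> rw [e1, e2]
    · exact ⟨0, by norm_num⟩
    · exact ⟨1, by norm_num⟩
    · exact ⟨-1, by norm_num⟩
    · exact ⟨0, by norm_num⟩
  · refine ⟨0, ?_⟩
    have h1 : Odd (p ^ m) := hodd.pow
    have e : p ^ m + ℓ * p ^ m + h + d = p ^ m * (1 + ℓ) + (h + d) := by ring
    have e' : 1 + ℓ + h + d = (1 + ℓ) + (h + d) := by ring
    rw [e, e', pow_add _ _ (h + d), pow_add _ (1 + ℓ) (h + d), pow_mul, h1.neg_one_pow]; ring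

theorem Ctx.mainTerm (C : Ctx p n vK vL) (hy : vL y = 1)
    {π : L} {c : ℕ → K} (E : Eis n vK vL π c) {u : ℕ}
    (hn : n = u * p ^ ν) {m : ℕ} (hm : m ≤ ν) {ℓ Φ : ℕ}
    (hI : (((Φ : ℤ) - p ^ m * ℓ : ℤ) : WithTop ℤ) ≤ insepIdx vK p ν n (vL (p : L)) c m)
    {η : L} (hη : VGe vL ℓ η) {r : K} (hr : VGe vL 0 (algebraMap K L r))
    (hηr : VGe vL (ℓ + 1) (η - -(algebraMap K L r * y ^ ℓ)))
    (hyn : VGe vL (n + 1) (y ^ n - (-1) ^ (n + 1) * algebraMap K L (c n)))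
    {β M d h : ℕ} (hβ : β < n) (hM : 1 ≤ M) (hqM : p ^ m * M = n - β) (hhn : h ≤ n)
    (hd : n * d + β = h + ℓ * p ^ m) :
    VGe vL (Φ + 1 + n) ((-1) ^ β * algebraMap K L (c β) * ((n - β).choose (p ^ m) : L) *
        y ^ (n - β) * η ^ (p ^ m) -
      (-1) ^ (1 + ℓ + h + d) * ((M : L) * algebraMap K L (c β)) * algebraMap K L (c n) ^ d *
        algebraMap K L r ^ (p ^ m) * y ^ (n - h)) := by
  have hp := C.hp
  have hL := C.hL
  set q := p ^ m with hq
  set R := algebraMap K L r with hR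
  set P := (-1) ^ (n + 1) * algebraMap K L (c n) with hP
  have hq1 : 1 ≤ q := Nat.one_le_pow _ _ hp.pos
  have hqL : ((p : ℤ) ^ m * ℓ) = q * ℓ := by rw [hq]; push_cast; ring
  rw [hqL] at hI
  have hdL : (n : ℤ) * d + β = h + ℓ * q := by exact_mod_cast hd
  have hn1 : (1 : ℤ) ≤ n := by exact_mod_cast C.npos
  -- replacing `η`
  have hRy : VGe vL ℓ (-(R * y ^ ℓ)) := by
    have := (hr.mul hL (VGe.ypow hL hy ℓ)).neg hL
    rwa [zero_add] at this
  have ha := C.termLow hy E hn hm hI hβ hq1 (by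
    intro hdv
    have := Nat.le_of_dvd hq1 hdv
    have := Nat.pow_lt_pow_right hp.one_lt (show m < m + 1 by omega)
    omega) (VGe.sub_pow hL hη hRy hηr q)
  -- the basic estimate
  have hX0 := C.star E hn hm hI hβ (w := M) (by
    intro e _ hdv
    rw [mul_comm, ← hq, hqM]; exact hdv)
  have hRq : VGe vL 0 (R ^ q) := by simpa using hr.pow hL q
  have hcn : VGe vL n (algebraMap K L (c n)) := E.ge1 n C.npos le_rfl
  have hX : VGe vL (Φ + h) ((M : L) * algebraMap K L (c β) * algebraMap K L (c n) ^ d * R ^ q) :=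
    ((hX0.mul hL (hcn.pow hL d)).mul hL hRq).mono (by linarith)
  have hyh := VGe.ypow hL hy (n - h)
  have hcast : ((n - h : ℕ) : ℤ) = n - h := by push_cast [Nat.cast_sub hhn]; ring
  have hcast' : ((n - β : ℕ) : ℤ) = n - β := by push_cast [Nat.cast_sub hβ.le]; ring
  -- the binomial coefficient
  obtain ⟨D, hD⟩ := choose_pow_eq hp m M hM
  rw [← hq, hqM] at hD
  have hDL : ((n - β).choose q : L) = M + M * (p * D) := by exact_mod_cast congrArg (Int.cast : ℤ → L) hD
  have hb : VGe vL (Φ + 1 + n) ((-1) ^ β * ((M : L) * algebraMap K L (c β)) * (p * (D : L)) *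
      y ^ (n - β) * (-(R * y ^ ℓ)) ^ q) := by
    refine (((((VGe.negOnePow hL β).mul hL hX0).mul hL (C.pL.mul hL (VGe.intCast hL D))).mul hL
      (VGe.ypow hL hy (n - β))).mul hL (hRy.pow hL q)).mono ?_
    rw [hcast']; linarith
  -- the power of `y`
  have hPn : VGe vL n P := by
    have := (VGe.negOnePow hL (n + 1)).mul hL hcn
    rwa [zero_add] at this
  have hc := VGe.sub_pow hL (VGe.ypow hL hy n) hPn hyn d
  have hnegq : VGe vL 0 ((-1 : L) ^ q) := VGe.negOnePow hL q
  have hc' : VGe vL (Φ + 1 + n) ((-1) ^ β * ((M : L) * algebraMap K L (c β)) *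
      ((-1) ^ q * R ^ q) * y ^ (n - h) * ((y ^ n) ^ d - P ^ d)) := by
    refine (((((VGe.negOnePow hL β).mul hL hX0).mul hL (hnegq.mul hL hRq)).mul hL hyh).mul hL
      hc).mono ?_
    rw [hcast]; linarith
  -- the sign
  obtain ⟨t, ht⟩ := sign_lemma hp m ℓ h d
  have htL : (-1 : L) ^ (q + ℓ * q + h + d) - (-1) ^ (1 + ℓ + h + d) = p * t := by
    exact_mod_cast congrArg (Int.cast : ℤ → L) ht
  have hd' : VGe vL (Φ + 1 + n) ((p * (t : L)) *
      ((M : L) * algebraMap K L (c β) * algebraMap K L (c n) ^ d * R ^ q) * y ^ (n - h)) := by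
    refine (((C.pL.mul hL (VGe.intCast hL t)).mul hL hX).mul hL hyh).mono ?_
    rw [hcast]; linarith
  have hyy : y ^ (n - β) * (y ^ ℓ) ^ q = y ^ (n - h) * (y ^ n) ^ d := by
    rw [← pow_mul, ← pow_mul, ← pow_add, ← pow_add]
    congr 1
    omega
  have hsg : (-1 : L) ^ β * (-1) ^ q * ((-1) ^ (n + 1)) ^ d = (-1) ^ (q + ℓ * q + h + d) := by
    rw [← pow_mul, ← pow_add, ← pow_add]
    congr 1
    rw [add_mul, one_mul]; omega
  have hfin := ((ha.mono (show (Φ : ℤ) + 1 + n ≤ _ by linarith)).add hL hb).add hL (hc'.add hL hd')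
  convert hfin using 1
  rw [← htL, ← hsg, hDL, hP, neg_pow (R * y ^ ℓ), mul_pow R, mul_pow _ (algebraMap K L (c n))]
  linear_combination ((-1) ^ β * (M : L) * algebraMap K L (c β) * (-1) ^ q * R ^ q) * hyy

end main

/-! ### Comparison with the terms of the statement -/

section target
variable {K L : Type*} [Field K] [Field L] [Algebra K L] {p n : ℕ} {vK : K → WithTop ℤ}
    {vL : L → WithTop ℤ} {ν j : ℕ} {y : L} {κ : ℕ → L →ₗ[K] K} {Q : ℤ}

theorem Ctx.bump (C : Ctx p n vK vL) {Z : ℤ} {x : K} (h : VGe vL Z (algebraMap K L x))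
    (hZ : ¬ (n : ℤ) ∣ Z) : VGe vL (Z + 1) (algebraMap K L x) := by
  have hn : (0 : ℤ) < n := by exact_mod_cast C.npos
  have h1 := Int.emod_add_mul_ediv Z n
  have h2 := Int.emod_nonneg Z hn.ne'
  have h3 := Int.emod_lt_of_pos Z hn
  have h4 : Z % n ≠ 0 := fun h0 => hZ (Int.dvd_of_emod_eq_zero h0)
  have h5 : 0 < Z % n := lt_of_le_of_ne h2 (Ne.symm h4)
  have h6 : VGe vK (Z / n + 1) x := C.down h (by rw [add_sub_cancel_right]; linarith)
  refine (C.up h6).mono ?_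
  rw [mul_add, mul_one]; linarith

/-- `u p^{ν-m} c_b` is negligible. -/
theorem Ctx.negl (C : Ctx p n vK vL)
    {π : L} {c : ℕ → K} (E : Eis n vK vL π c) {u : ℕ}
    (hn : n = u * p ^ ν) {m : ℕ} (hm : m ≤ ν) {I : ℤ}
    (hI : (I : WithTop ℤ) ≤ insepIdx vK p ν n (vL (p : L)) c m)
    {b : ℕ} (hb1 : 1 ≤ b) (hbn : b < n) (hmb : p ^ m ∣ b) :
    VGe vL (I + b + 1) (((u * p ^ (ν - m) : ℕ) : L) * algebraMap K L (c b)) := by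
  have hp := C.hp
  have hL := C.hL
  have hbn' : (b : ℤ) + 1 ≤ n := by exact_mod_cast hbn
  by_cases hνb : p ^ ν ∣ b
  · have h1 := C.star E hn hm hI (h' := 0) C.npos (w := p ^ (ν - m)) (by
      intro e he _
      rw [← pow_add, Nat.sub_add_cancel hm]; exact pow_dvd_pow p he)
    rw [E.c0, map_one, mul_one] at h1
    have h2 := ((VGe.natCast hL u).mul hL h1).mul hL (E.ge1 b hb1 hbn.le)
    push_cast at h2 ⊢
    exact h2.mono (by linarith)
  · have hlt : m < ν := by
      rcases hm.lt_or_eq with h | rfl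
      · exact h
      · exact absurd hmb hνb
    have hνn : p ^ ν ∣ n := by rw [hn]; exact dvd_mul_left _ _
    have h1 := C.star E hn hm hI hbn (w := p ^ (ν - 1 - m)) (by
      intro e he hdv
      rw [← pow_add]
      refine pow_dvd_pow p ?_
      by_contra hcon
      have he : e = ν := by omega
      subst he
      apply hνb
      have := Nat.dvd_sub hνn hdv
      rwa [Nat.sub_sub_self hbn.le] at this)
    have h2 := ((VGe.natCast hL u).mul hL C.pL).mul hL h1
    have e : ν - m = (ν - 1 - m) + 1 := by omega
    rw [e, pow_succ]
    push_cast at h2 ⊢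
    have hn1 : (1 : ℤ) ≤ n := by exact_mod_cast C.npos
    convert h2.mono (show I + b + 1 ≤ 0 + n + (I + b) by linarith) using 1
    ring

theorem Ctx.target (C : Ctx p n vK vL) (hy : vL y = 1)
    {π : L} {c : ℕ → K} (E : Eis n vK vL π c) {u : ℕ}
    (hn : n = u * p ^ ν) {m : ℕ} (hm : m ≤ j) (hj : j ≤ ν) {ℓ Φ : ℕ}
    (hI : (((Φ : ℤ) - p ^ m * ℓ : ℤ) : WithTop ℤ) ≤ insepIdx vK p ν n (vL (p : L)) c m)
    {r : K} (hr : VGe vL 0 (algebraMap K L r)) {A b h k h₀ : ℕ}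
    (hb1 : 1 ≤ b) (hbn : b ≤ n) (hΦ : (Φ : ℤ) = A * n - b + p ^ m * ℓ)
    (hk : Φ + h = k * n) (hh₀ : h = h₀ * p ^ j) (hh1 : 1 ≤ h) (hhn : h ≤ n) :
    ∃ M d : ℕ, 1 ≤ M ∧ p ^ m * M = n - (if b = n then 0 else b) ∧
      n * d + (if b = n then 0 else b) = h + ℓ * p ^ m ∧
      VGe vL (Φ + 1 + n)
        ((-1) ^ h * algebraMap K L ((((-1 : ℤ) ^ (k + ℓ + A) *
                (if b = n then ((u * p ^ (ν - m) : ℕ) : ℤ)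
                 else if b < h then
                   ((h₀ * p ^ (j - m) + ℓ : ℕ) : ℤ) - ((u * p ^ (ν - m) : ℕ) : ℤ)
                 else ((h₀ * p ^ (j - m) + ℓ : ℕ) : ℤ)) : ℤ) : K) *
              c n ^ (k - A) * c b * r ^ (p ^ m)) * y ^ (n - h) -
        (-1) ^ (1 + ℓ + h + d) * ((M : L) * algebraMap K L (c (if b = n then 0 else b))) *
          algebraMap K L (c n) ^ d * algebraMap K L r ^ (p ^ m) * y ^ (n - h)) := by
  have hp := C.hp
  have hL := C.hL
  have hq0 : 0 < p ^ m := pow_pos hp.pos m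
  have hnpos : (0 : ℤ) < n := by exact_mod_cast C.npos
  have hkZ : (Φ : ℤ) + h = k * n := by exact_mod_cast hk
  have hqℓ : (0 : ℤ) ≤ p ^ m * ℓ := by positivity
  have hAk : A ≤ k := by
    by_contra hcon
    have h1 : (k : ℤ) + 1 ≤ A := by exact_mod_cast not_le.1 hcon
    have h2 : ((k : ℤ) + 1) * n ≤ A * n := mul_le_mul_of_nonneg_right h1 hnpos.le
    have h3 : (b : ℤ) ≤ n := by exact_mod_cast hbn
    have h4 : (1 : ℤ) ≤ h := by exact_mod_cast hh1
    linarith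
  obtain ⟨D, rfl⟩ := Nat.exists_eq_add_of_le hAk
  have hnU : n = p ^ m * (u * p ^ (ν - m)) := by
    rw [hn, mul_left_comm, ← pow_add]; congr 2; omega
  have hhH : h = p ^ m * (h₀ * p ^ (j - m)) := by
    rw [hh₀, mul_left_comm, ← pow_add]; congr 2; omega
  set U := u * p ^ (ν - m) with hU
  set H := h₀ * p ^ (j - m) with hH
  have hU0 : 1 ≤ U := by
    rcases Nat.eq_zero_or_pos U with h0 | h0
    · rw [h0] at hnU; have := C.npos; omega
    · exact h0
  have hmain : n * D + b = h + ℓ * p ^ m := by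
    zify
    push_cast at hkZ
    linarith
  by_cases hb : b = n
  · subst hb
    refine ⟨U, D + 1, hU0, by simp [← hnU], ?_, ?_⟩
    · simp only [if_true, add_zero]; rw [mul_add, mul_one]; exact hmain
    · simp only [if_true]
      convert VGe.zero hL _ using 1
      rw [E.c0, Nat.add_sub_cancel_left]
      have e : (-1 : L) ^ (1 + ℓ + h + (D + 1)) = (-1) ^ h * (-1) ^ (A + D + ℓ + A) := by
        rw [← pow_add, show h + (A + D + ℓ + A) = (ℓ + h + D) + 2 * A by ring,
          show 1 + ℓ + h + (D + 1) = (ℓ + h + D) + 2 * 1 by ring, pow_add _ _ (2 * A),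
          pow_add _ _ (2 * 1), pow_mul, pow_mul]
        simp
      rw [e]
      push_cast
      ring
  · simp only [if_neg hb]
    have hlt : b < n := lt_of_le_of_ne hbn hb
    have hmb : p ^ m ∣ b := by
      have h1 : p ^ m ∣ n * D + b := by
        rw [hmain, hhH]; exact dvd_add (dvd_mul_right _ _) (dvd_mul_left _ _)
      exact (Nat.dvd_add_right ((Dvd.intro _ hnU.symm).mul_right D)).1 h1
    have hneg := C.negl E hn (hm.trans hj) hI hb1 hlt hmb
    rw [← hU] at hneg
    obtain ⟨b', rfl⟩ := hmb
    have hb'U : b' < U := by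
      rw [hnU] at hlt; exact lt_of_mul_lt_mul_left hlt (Nat.zero_le _)
    have hrel : U * D + b' = H + ℓ := by
      apply Nat.eq_of_mul_eq_mul_left hq0
      calc p ^ m * (U * D + b') = (p ^ m * U) * D + p ^ m * b' := by ring
        _ = n * D + p ^ m * b' := by rw [← hnU]
        _ = p ^ m * H + ℓ * p ^ m := by rw [hmain, ← hhH]
        _ = p ^ m * (H + ℓ) := by ring
    refine ⟨U - b', D, by omega, ?_, hmain, ?_⟩
    · rw [Nat.mul_sub, ← hnU]
    set b := p ^ m * b' with hbdef
    obtain ⟨t, ht⟩ : ∃ t : ℤ, (if b < h then ((H + ℓ : ℕ) : ℤ) - (U : ℤ)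
        else ((H + ℓ : ℕ) : ℤ)) = -((U - b' : ℕ) : ℤ) + t * U := by
      rw [← hrel]
      split_ifs
      · exact ⟨D, by push_cast [Nat.cast_sub hb'U.le]; ring⟩
      · exact ⟨D + 1, by push_cast [Nat.cast_sub hb'U.le]; ring⟩
    rw [ht, Nat.add_sub_cancel_left]
    have e : (-1 : L) ^ h * (-1) ^ (A + D + ℓ + A) = -(-1) ^ (1 + ℓ + h + D) := by
      rw [← pow_add, show h + (A + D + ℓ + A) = (ℓ + h + D) + 2 * A by ring,
        show 1 + ℓ + h + D = (ℓ + h + D) + 1 by ring, pow_add _ _ (2 * A),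
        pow_succ, pow_mul]
      simp
    have hcn : VGe vL n (algebraMap K L (c n)) := E.ge1 n C.npos le_rfl
    have hRq : VGe vL 0 (algebraMap K L r ^ (p ^ m)) := by simpa using hr.pow hL (p ^ m)
    have hcast : ((n - h : ℕ) : ℤ) = n - h := by push_cast [Nat.cast_sub hhn]; ring
    have hmZ : (n : ℤ) * D + b = h + ℓ * p ^ m := by exact_mod_cast hmain
    have hfin : VGe vL (Φ + 1 + n) (-(-1) ^ (1 + ℓ + h + D) * (t : L) *
        ((U : L) * algebraMap K L (c b)) * algebraMap K L (c n) ^ D *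
        algebraMap K L r ^ (p ^ m) * y ^ (n - h)) := by
      refine (((((((VGe.negOnePow hL _).neg hL).mul hL (VGe.intCast hL t)).mul hL hneg).mul hL
        (hcn.pow hL D)).mul hL hRq).mul hL (VGe.ypow hL hy (n - h))).mono ?_
      rw [hcast]; linarith
    convert hfin using 1
    push_cast
    simp only [map_intCast]
    linear_combination (-(U - b' : ℕ) + (t : L) * U) * algebraMap K L (c n) ^ D *
      algebraMap K L (c b) * algebraMap K L r ^ p ^ m * y ^ (n - h) * e

/-- A term with `i = p^m`, `m ∈ S`, but the wrong `h'`. -/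
theorem Ctx.offTerm (C : Ctx p n vK vL) (hy : vL y = 1)
    {π : L} {c : ℕ → K} (E : Eis n vK vL π c) {u : ℕ}
    (hn : n = u * p ^ ν) {m : ℕ} (hm : m ≤ ν) {ℓ Φ : ℕ}
    (hI : (((Φ : ℤ) - p ^ m * ℓ : ℤ) : WithTop ℤ) ≤ insepIdx vK p ν n (vL (p : L)) c m)
    {η : L} (hη : VGe vL ℓ η) {r : K} (hr : VGe vL 0 (algebraMap K L r))
    (hηr : VGe vL (ℓ + 1) (η - -(algebraMap K L r * y ^ ℓ)))
    {A b : ℕ} (hb1 : 1 ≤ b) (hbn : b ≤ n) (hΦ : (Φ : ℤ) = A * n - b + p ^ m * ℓ)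
    {h' : ℕ} (hh' : h' < n) (hne : h' ≠ if b = n then 0 else b) :
    VGe vL (Φ + 1 + n) ((-1) ^ h' * algebraMap K L (c h') * ((n - h').choose (p ^ m) : L) *
        y ^ (n - h') * η ^ (p ^ m)) := by
  have hp := C.hp
  have hL := C.hL
  have hq1 : 1 ≤ p ^ m := Nat.one_le_pow _ _ hp.pos
  have hpi : ¬ p ^ (m + 1) ∣ p ^ m := by
    intro hdv
    have := Nat.le_of_dvd hq1 hdv
    have := Nat.pow_lt_pow_right hp.one_lt (show m < m + 1 by omega)
    omega
  have hRy : VGe vL ℓ (-(algebraMap K L r * y ^ ℓ)) := by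
    have := (hr.mul hL (VGe.ypow hL hy ℓ)).neg hL
    rwa [zero_add] at this
  have ha := C.termLow hy E hn hm hI hh' hq1 hpi (VGe.sub_pow hL hη hRy hηr (p ^ m))
  have hb := C.termLow hy E hn hm hI hh' hq1 hpi (hRy.pow hL (p ^ m))
  have hyy := vy_pow hL hy (n - h' + ℓ * p ^ m)
  have hcast : ((n - h' : ℕ) : ℤ) = n - h' := by push_cast [Nat.cast_sub hh'.le]; ring
  set X : K := (-1) ^ h' * c h' * ((n - h').choose (p ^ m) : K) * ((-1) ^ (p ^ m) * r ^ (p ^ m))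
    with hX
  have e : (-1) ^ h' * algebraMap K L (c h') * ((n - h').choose (p ^ m) : L) *
      y ^ (n - h') * (-(algebraMap K L r * y ^ ℓ)) ^ (p ^ m) =
      algebraMap K L X * y ^ (n - h' + ℓ * p ^ m) := by
    rw [hX, neg_pow (algebraMap K L r * y ^ ℓ), mul_pow (algebraMap K L r), ← pow_mul, pow_add]
    simp only [map_mul, map_pow, map_neg, map_one, map_natCast]
    ring
  rw [e] at hb
  have h1 := C.bump (hb.of_mul_right hL hyy) (by
    have e2 : ((Φ : ℤ) - p ^ m * ℓ + n + ((p ^ m : ℕ) : ℤ) * ℓ - ((n - h' + ℓ * p ^ m : ℕ) : ℤ))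
        = A * n + (h' - b) := by
      push_cast [hcast]; rw [hΦ]; ring
    rw [e2]
    intro hdv
    have h3 : (n : ℤ) ∣ (h' : ℤ) - b := (Int.dvd_add_right (dvd_mul_left _ _)).1 hdv
    obtain ⟨t, ht⟩ := h3
    have hn0 : (0 : ℤ) < n := by exact_mod_cast C.npos
    have a1 : (h' : ℤ) < n := by exact_mod_cast hh'
    have a2 : (b : ℤ) ≤ n := by exact_mod_cast hbn
    have a3 : (1 : ℤ) ≤ b := by exact_mod_cast hb1
    have a4 : (0 : ℤ) ≤ h' := by positivity
    have t1 : t < 1 := by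
      by_contra hc
      have : (n : ℤ) * 1 ≤ n * t := mul_le_mul_of_nonneg_left (by omega) hn0.le
      linarith
    have t2 : -1 ≤ t := by
      by_contra hc
      have : (n : ℤ) * t ≤ n * (-2) := mul_le_mul_of_nonneg_left (by omega) hn0.le
      linarith
    have : t = 0 ∨ t = -1 := by omega
    rcases this with rfl | rfl
    · split_ifs at hne <;> omega
    · split_ifs at hne <;> omega)
  have h2 := h1.mul hL (VGe.ypow hL hy (n - h' + ℓ * p ^ m))
  rw [← e] at h2
  have h3 := (h2.mono (show (Φ : ℤ) + 1 + n ≤ _ by push_cast [hcast]; linarith)).add hL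
    (ha.mono (show (Φ : ℤ) + 1 + n ≤ _ by push_cast; linarith))
  convert h3 using 1
  ring

end target

/-! ### Assembly -/

section assembly
variable {K L : Type*} [Field K] [Field L] [Algebra K L] {p n : ℕ} {vK : K → WithTop ℤ}
    {vL : L → WithTop ℤ} {ν j : ℕ} {y : L} {κ : ℕ → L →ₗ[K] K} {Q : ℤ}

theorem Ctx.core (C : Ctx p n vK vL) (Y : YData n vL y κ) {ct : ℕ → K}
    (Et : Eis n vK vL y ct) {π : L} {c : ℕ → K} (E : Eis n vK vL π c) {u : ℕ}
    (hn : n = u * p ^ ν) (hj : j ≤ ν) {ℓ Φ : ℕ} (hℓ : 1 ≤ ℓ)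
    (hI : ∀ m ≤ j, (((Φ : ℤ) - p ^ m * ℓ : ℤ) : WithTop ℤ) ≤
      insepIdx vK p ν n (vL (p : L)) c m)
    {η : L} (hη : VGe vL ℓ η) (hπ : π = y * (1 + η))
    {h : ℕ} (hh1 : 1 ≤ h) (hhn : h ≤ n) (hhp : j < ν → ¬ p ^ (j + 1) ∣ h)
    (S : Finset ℕ) (β : ℕ → ℕ) (G : ℕ → K) (hSj : ∀ m ∈ S, m ≤ j) (hβ : ∀ m ∈ S, β m < n)
    (hS' : ∀ m ≤ j, m ∉ S → (((Φ : ℤ) - p ^ m * ℓ + 1 : ℤ) : WithTop ℤ) ≤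
      insepIdx vK p ν n (vL (p : L)) c m)
    (hmain : ∀ m ∈ S, VGe vL (Φ + 1 + n) ((-1) ^ (β m) * algebraMap K L (c (β m)) *
        ((n - β m).choose (p ^ m) : L) * y ^ (n - β m) * η ^ (p ^ m) -
        (-1) ^ h * algebraMap K L (G m) * y ^ (n - h)))
    (hoff : ∀ m ∈ S, ∀ h' < n, h' ≠ β m → VGe vL (Φ + 1 + n) ((-1) ^ h' * algebraMap K L (c h') *
        ((n - h').choose (p ^ m) : L) * y ^ (n - h') * η ^ (p ^ m))) :
    VGe vL (Φ + 1 + h) (algebraMap K L (ct h - (c h + ∑ m ∈ S, G m))) := by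
  have hp := C.hp
  have hL := C.hL
  have hpow : (p : ℤ) ^ j * ℓ + 1 ≤ p ^ (j + 1) * ℓ := by
    have h1 : p ^ j * ℓ < p ^ (j + 1) * ℓ :=
      Nat.mul_lt_mul_of_pos_right (Nat.pow_lt_pow_right hp.one_lt (by omega)) hℓ
    exact_mod_cast h1
  obtain ⟨B, hBQ, HB⟩ : ∃ B : ℕ, (Φ : ℤ) + 1 ≤ B + p ^ (j + 1) * ℓ ∧
      ∀ g, 1 ≤ g → g ≤ n → (j < ν → ¬ p ^ (j + 1) ∣ g) →
      VGe vL ((B : ℤ) + g) (algebraMap K L (ct g)) := by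
    rcases le_total (0 : ℤ) ((Φ : ℤ) - p ^ j * ℓ) with h0 | h0
    · refine ⟨((Φ : ℤ) - p ^ j * ℓ).toNat, ?_, C.boot Y Et E hn hj hℓ hI hη hπ _ ?_⟩
      · rw [Int.toNat_of_nonneg h0]; linarith
      · rw [Int.toNat_of_nonneg h0]
    · refine ⟨0, by push_cast; linarith, fun g _ hgn _ => ?_⟩
      simpa using Et.ge C g hgn
  have hn0 := C.npos
  have hpn : ∀ m ∈ S, p ^ m ≤ n := by
    intro m hm
    refine Nat.le_of_dvd hn0 ?_
    rw [hn]
    exact (pow_dvd_pow p ((hSj m hm).trans hj)).trans (dvd_mul_left _ _)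
  set W : ℕ → L := fun m => (-1) ^ h * algebraMap K L (G m) * y ^ (n - h) with hW
  have hWsum : ∑ m ∈ S, W m = ∑ h' ∈ Finset.range n, ∑ i ∈ Finset.Icc 1 n,
      ∑ m ∈ S, if h' = β m ∧ i = p ^ m then W m else 0 := by
    have e1 : ∀ m ∈ S, W m = ∑ h' ∈ Finset.range n, ∑ i ∈ Finset.Icc 1 n,
        if h' = β m ∧ i = p ^ m then W m else 0 := by
      intro m hm
      rw [Finset.sum_eq_single (β m), Finset.sum_eq_single (p ^ m)]
      · simp
      · intro i _ hne; rw [if_neg]; exact fun h => hne h.2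
      · intro h
        exact absurd (Finset.mem_Icc.2 ⟨Nat.one_le_pow _ _ hp.pos, hpn m hm⟩) h
      · intro h' _ hne
        exact Finset.sum_eq_zero fun i _ => if_neg fun h => hne h.1
      · intro h
        exact absurd (Finset.mem_range.2 (hβ m hm)) h
    rw [Finset.sum_congr rfl e1, Finset.sum_comm]
    refine Finset.sum_congr rfl fun h' _ => ?_
    rw [Finset.sum_comm]
  have hR : InR p ν n j vL y κ (Φ + 1)
      (∑ g ∈ Finset.Icc 1 n, (-1) ^ g * algebraMap K L (ct g - c g) * y ^ (n - g) -
        ∑ m ∈ S, W m) := by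
    rw [expandD E Et hπ, hWsum, ← Finset.sum_sub_distrib]
    refine InR.sum C Y _ _ fun h' hh' => ?_
    rw [← Finset.sum_sub_distrib]
    refine InR.sum C Y _ _ fun i hi => ?_
    rw [Finset.mem_range] at hh'
    rw [Finset.mem_Icc] at hi
    by_cases hpi : p ^ (j + 1) ∣ i
    · rw [Finset.sum_eq_zero, sub_zero]
      · exact C.termHigh Y Et E hn hj (hI j le_rfl) HB hBQ (by linarith) hη hh' hi.1 hpi
      · intro m hm
        refine if_neg ?_
        rintro ⟨-, rfl⟩
        have := (Nat.pow_dvd_pow_iff_le_right hp.one_lt).1 hpi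
        have := hSj m hm
        omega
    · obtain ⟨s, hsj, hs1, hs2⟩ := exists_exact hp hpi
      have huniq : ∀ m, i = p ^ m → m = s := by
        rintro m rfl
        have a1 := (Nat.pow_dvd_pow_iff_le_right hp.one_lt).1 hs1
        rw [Nat.pow_dvd_pow_iff_le_right hp.one_lt] at hs2
        omega
      refine InR.of_VGe Y ?_
      by_cases his : i = p ^ s
      · subst his
        by_cases hsS : s ∈ S
        · rw [Finset.sum_eq_single s]
          · by_cases hb : h' = β s
            · subst hb
              simpa using hmain s hsS
            · rw [if_neg fun h => hb h.1, sub_zero]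
              exact hoff s hsS h' hh' hb
          · intro m _ hne
            exact if_neg fun h => hne (huniq m h.2)
          · intro h; exact absurd hsS h
        · rw [Finset.sum_eq_zero, sub_zero]
          · refine (C.termLow Y.vy E hn (hsj.trans hj) (hS' s hsj hsS) hh' hi.1 hs2
              (hη.pow hL _)).mono ?_
            push_cast; linarith
          · intro m hm
            refine if_neg fun h => hsS ?_
            rwa [← huniq m h.2]
      · rw [Finset.sum_eq_zero, sub_zero]
        · refine (C.termLow Y.vy E hn (hsj.trans hj) (hI s hsj) hh' hi.1 hs2
              (hη.pow hL _)).mono ?_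
          have a1 : p ^ s ≤ i := Nat.le_of_dvd hi.1 hs1
          have a2 : p ^ s * ℓ < i * ℓ :=
            Nat.mul_lt_mul_of_pos_right (lt_of_le_of_ne a1 (Ne.symm his)) hℓ
          have a3 : (p : ℤ) ^ s * ℓ + 1 ≤ i * ℓ := by exact_mod_cast a2
          linarith
        · intro m hm
          refine if_neg fun h => his ?_
          rw [← huniq m h.2]; exact h.2
  have h1 := hR h hh1 hhn hhp
  have hWk : κ (n - h) (∑ m ∈ S, W m) = (-1) ^ h * ∑ m ∈ S, G m := by
    rw [map_sum, Finset.mul_sum]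
    refine Finset.sum_congr rfl fun m _ => ?_
    have : W m = ((-1) ^ h * G m) • y ^ (n - h) := by
      rw [hW, Algebra.smul_def]; simp
    rw [this, map_smul, Y.single _ (by omega) _ (by omega)]; simp
  rw [map_sub, Y.coordD C (fun g => ct g - c g) hh1 hhn, hWk] at h1
  have h2 := h1.of_mul_right hL (vy_pow hL Y.vy (n - h))
  have h3 := (VGe.negOnePow hL h).mul hL h2
  have hcast : ((n - h : ℕ) : ℤ) = n - h := by push_cast [Nat.cast_sub hhn]; ring
  convert h3.mono (show (Φ : ℤ) + 1 + h ≤ _ by rw [hcast]; linarith) using 1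
  have e : (-1 : L) ^ h * (-1) ^ h = 1 := by rw [← mul_pow]; simp
  simp only [map_sub, map_add, map_mul, map_pow, map_neg, map_one]
  linear_combination (-(algebraMap K L (ct h) - algebraMap K L (c h) -
    algebraMap K L (∑ m ∈ S, G m))) * e

/-- Reduction of the congruence to `π = y (1 + η)`. -/
theorem Ctx.exists_eta (C : Ctx p n vK vL) {π y : L} (hπ : vL π = 1) {r : K}
    (hr : VGe vL 0 (algebraMap K L r)) {ℓ : ℕ} (hℓ : 1 ≤ ℓ)
    (hc : VGe vL (ℓ + 2) (y - (π + algebraMap K L r * π ^ (ℓ + 1)))) :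
    vL y = 1 ∧ VGe vL 2 (π - y) ∧ ∃ η : L, VGe vL ℓ η ∧ π = y * (1 + η) ∧
      VGe vL (ℓ + 1) (η - -(algebraMap K L r * y ^ ℓ)) := by
  have hL := C.hL
  have hℓ' : (1 : ℤ) ≤ ℓ := by exact_mod_cast hℓ
  have hπg : VGe vL 1 π := by unfold VGe; rw [hπ]; rfl
  have h1 : VGe vL (ℓ + 1) (algebraMap K L r * π ^ (ℓ + 1)) :=
    (hr.mul hL (VGe.ypow hL hπ (ℓ + 1))).mono (by push_cast; linarith)
  have h2 : VGe vL (ℓ + 1) (π - y) := by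
    have := ((hc.mono (show (ℓ : ℤ) + 1 ≤ ℓ + 2 by linarith)).add hL h1).neg hL
    convert this using 1; ring
  have h22 : VGe vL 2 (π - y) := h2.mono (by linarith)
  have hyg : VGe vL 1 y := by
    have := hπg.sub hL (h22.mono (show (1 : ℤ) ≤ 2 by norm_num))
    convert this using 1; ring
  have hy : vL y = 1 := by
    refine le_antisymm ?_ hyg
    by_contra hlt
    have h3 : VGe vL 2 y := by
      unfold VGe
      cases hv : vL y with
      | top => exact le_top
      | coe a =>
        rw [hv] at hlt
        have : ¬ ((a : WithTop ℤ) ≤ ((1 : ℤ) : WithTop ℤ)) := hlt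
        rw [WithTop.coe_le_coe] at this
        rw [WithTop.coe_le_coe]; omega
    have h4 := h22.add hL h3
    rw [sub_add_cancel] at h4
    unfold VGe at h4
    rw [hπ] at h4
    have h5 : ((2 : ℤ) : WithTop ℤ) ≤ ((1 : ℤ) : WithTop ℤ) := h4
    rw [WithTop.coe_le_coe] at h5
    omega
  have hy0 : y ≠ 0 := by
    intro h0; rw [h0, hL.zero] at hy; exact absurd hy (by decide)
  have hy1 : vL y = ((1 : ℤ) : WithTop ℤ) := hy
  refine ⟨hy, h22, π / y - 1, ?_, by field_simp; ring, ?_⟩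
  · have e : π - y = (π / y - 1) * y := by field_simp
    rw [e] at h2
    exact (h2.of_mul_right hL hy1).mono (by linarith)
  · have h3 := VGe.sub_pow hL hπg hyg h22 (ℓ + 1)
    have h4 := (hr.mul hL h3).mono (show (ℓ : ℤ) + 2 ≤ _ by push_cast; linarith)
    have h5 := (hc.add hL h4).neg hL
    have e : -(y - (π + algebraMap K L r * π ^ (ℓ + 1)) +
        algebraMap K L r * (π ^ (ℓ + 1) - y ^ (ℓ + 1))) =
        (π / y - 1 - -(algebraMap K L r * y ^ ℓ)) * y := by
      field_simp; ring
    rw [e] at h5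
    exact (h5.of_mul_right hL hy1).mono (by linarith)

end assembly

/-- **Theorem (special).**  Let `L/K` be totally ramified of degree `n = u·p^ν`, and for
`0 ≤ m ≤ ν` write `i_m = A_m·n - b_m` with `1 ≤ b_m ≤ n`.  Let `π_L`, `π̃_L` be
uniformizers of `L` with minimal polynomials `f`, `f̃`, and suppose
`σ(π̃_L) ≡ π_L + r·π_L^{ℓ+1} (mod M_L^{ℓ+2})` for some `ℓ ≥ 1`, `r ∈ O_K` and
`σ ∈ Aut_K(L)`.  Let `0 ≤ j ≤ ν` satisfy `v̄_p(φ_j(ℓ)) = j`, let `h` be the unique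
integer with `1 ≤ h ≤ n` and `n ∣ φ_j(ℓ) + h`, and set `k = (φ_j(ℓ) + h)/n`,
`h₀ = h/p^j`.  Then
`c̃_h ≡ c_h + Σ_{m ∈ S_j} g_m · c_n^{k - A_m} · c_{b_m} · r^{p^m}  (mod M_K^{k+1})`,
where `S_j = { m : 0 ≤ m ≤ j, φ_j(ℓ) = φ̃_m(ℓ) }` and
`g_m = (-1)^{k+ℓ+A_m}(h₀p^{j-m} + ℓ - up^{ν-m})` if `b_m < h`,
`g_m = (-1)^{k+ℓ+A_m}(h₀p^{j-m} + ℓ)` if `h ≤ b_m < n`, and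
`g_m = (-1)^{k+ℓ+A_m}·u·p^{ν-m}` if `b_m = n`. -/
theorem special {K L : Type*} [Field K] [Field L] [Algebra K L]
    [FiniteDimensional K L] [Algebra.IsSeparable K L]
    (p u ν n : ℕ) (hp : p.Prime) (hu : ¬ p ∣ u) (hn : n = u * p ^ ν)
    (hdim : Module.finrank K L = n)
    (vK : K → WithTop ℤ) (vL : L → WithTop ℤ)
    (hvK : IsDiscreteValuationOn vK) (hvL : IsDiscreteValuationOn vL)
    (hKcomplete : IsCompleteWrt vK)
    (hres : HasPerfectResidueFieldCharP vK p)
    (htotram : ∀ x : K, vL (algebraMap K L x) = n • vK x)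
    (π πt : L) (hπ : vL π = 1) (hπt : vL πt = 1)
    (A b : ℕ → ℕ)
    (hAb : ∀ m, m ≤ ν →
      insepIdx vK p ν n (vL (p : L)) (minpolyCoeff K n π) m
          = (((A m : ℤ) * (n : ℤ) - (b m : ℤ) : ℤ) : WithTop ℤ) ∧
        1 ≤ b m ∧ b m ≤ n)
    (ℓ : ℕ) (hℓ : 1 ≤ ℓ)
    (r : K) (hr : (0 : WithTop ℤ) ≤ vK r)
    (σ : L ≃ₐ[K] L)
    (hcong : (((ℓ + 2 : ℕ) : ℤ) : WithTop ℤ) ≤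
      vL (σ πt - (π + algebraMap K L r * π ^ (ℓ + 1))))
    (j : ℕ) (hj : j ≤ ν)
    (Φ : ℕ)
    (hΦ : phiIdx vK p ν n (vL (p : L)) (minpolyCoeff K n π) j ℓ = ((Φ : ℤ) : WithTop ℤ))
    (hvΦ : vbar p ν Φ = j)
    (h : ℕ) (hh1 : 1 ≤ h) (hhn : h ≤ n)
    (k : ℕ) (hk : Φ + h = k * n)
    (h₀ : ℕ) (hh₀ : h = h₀ * p ^ j) :
    (((k + 1 : ℕ) : ℤ) : WithTop ℤ) ≤
      vK (minpolyCoeff K n πt h -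
        (minpolyCoeff K n π h +
          ∑ m ∈ (Finset.Icc 0 j).filter fun m =>
              phiIdx vK p ν n (vL (p : L)) (minpolyCoeff K n π) j ℓ =
                phiTilde vK p ν n (vL (p : L)) (minpolyCoeff K n π) m ℓ,
            (((-1 : ℤ) ^ (k + ℓ + A m) *
                (if b m = n then ((u * p ^ (ν - m) : ℕ) : ℤ)
                 else if b m < h then
                   ((h₀ * p ^ (j - m) + ℓ : ℕ) : ℤ) - ((u * p ^ (ν - m) : ℕ) : ℤ)
                 else ((h₀ * p ^ (j - m) + ℓ : ℕ) : ℤ)) : ℤ) : K) *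
              minpolyCoeff K n π n ^ (k - A m) *
              minpolyCoeff K n π (b m) * r ^ (p ^ m))) := by
  have hnpos : 0 < n := hdim ▸ Module.finrank_pos
  have C : Ctx p n vK vL := ⟨hp, hnpos, hvK, hvL, htotram, hres.1⟩
  have hfact : Fact p.Prime := ⟨hp⟩
  have hrL : VGe vL 0 (algebraMap K L r) := by
    simpa using C.up (M := 0) (x := r) hr
  obtain ⟨hy, hπy, η, hη, hπη, hηr⟩ := C.exists_eta hπ hrL hℓ (y := σ πt)
    (by unfold VGe; exact_mod_cast hcong)
  set y := σ πt with hyd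
  have hct : minpolyCoeff K n πt = minpolyCoeff K n y := by
    funext g; unfold minpolyCoeff; rw [hyd, minpoly.algEquiv_eq]
  rw [hct]
  have E := C.eis hdim hπ
  have Et := C.eis hdim hy
  obtain ⟨κ, Y⟩ := C.exists_ydata hdim hy
  set c := minpolyCoeff K n π with hc
  set ct := minpolyCoeff K n y with hctd
  have htil : ∀ m ≤ ν, phiTilde vK p ν n (vL (p : L)) c m ℓ =
      (((A m : ℤ) * n - b m + p ^ m * ℓ : ℤ) : WithTop ℤ) := by
    intro m hm
    unfold phiTilde
    rw [(hAb m hm).1, ← WithTop.coe_add]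
    push_cast; rfl
  have hle : ∀ m ≤ j, (Φ : ℤ) ≤ (A m : ℤ) * n - b m + p ^ m * ℓ := by
    intro m hm
    have h1 : phiIdx vK p ν n (vL (p : L)) c j ℓ ≤ phiTilde vK p ν n (vL (p : L)) c m ℓ :=
      Finset.inf_le (Finset.mem_Icc.2 ⟨Nat.zero_le _, hm⟩)
    rw [hΦ, htil m (hm.trans hj), WithTop.coe_le_coe] at h1
    exact h1
  have hI : ∀ m ≤ j, (((Φ : ℤ) - p ^ m * ℓ : ℤ) : WithTop ℤ) ≤
      insepIdx vK p ν n (vL (p : L)) c m := by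
    intro m hm
    rw [(hAb m (hm.trans hj)).1, WithTop.coe_le_coe]
    linarith [hle m hm]
  have hΦpos : Φ ≠ 0 := by
    have h1 : ((1 : ℤ) : WithTop ℤ) ≤ phiIdx vK p ν n (vL (p : L)) c j ℓ := by
      unfold phiIdx
      refine Finset.le_inf fun m _ => ?_
      unfold phiTilde
      have h2 := insepIdx_nonneg C E ν m
      have h3 : ((1 : ℤ) : WithTop ℤ) ≤ (((p ^ m * ℓ : ℕ) : ℤ) : WithTop ℤ) := by
        rw [WithTop.coe_le_coe]
        exact_mod_cast Nat.mul_pos (pow_pos hp.pos m) hℓ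
      calc ((1 : ℤ) : WithTop ℤ) = 0 + ((1 : ℤ) : WithTop ℤ) := by rw [zero_add]
        _ ≤ _ := add_le_add h2 h3
    rw [hΦ, WithTop.coe_le_coe] at h1
    omega
  have hhp : j < ν → ¬ p ^ (j + 1) ∣ h := by
    intro hjν hdv
    have h1 : p ^ (j + 1) ∣ k * n := by
      rw [hn]; exact ((pow_dvd_pow p hjν).trans (dvd_mul_left _ _)).mul_left k
    rw [← hk] at h1
    have h2 := (Nat.dvd_add_left hdv).1 h1
    have h3 := (padicValNat_dvd_iff_le hΦpos).1 h2
    unfold vbar at hvΦ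
    omega
  set S := (Finset.Icc 0 j).filter fun m =>
    phiIdx vK p ν n (vL (p : L)) c j ℓ = phiTilde vK p ν n (vL (p : L)) c m ℓ with hS
  have hSm : ∀ m, m ∈ S ↔ m ≤ j ∧ (Φ : ℤ) = (A m : ℤ) * n - b m + p ^ m * ℓ := by
    intro m
    rw [hS, Finset.mem_filter, Finset.mem_Icc]
    constructor
    · rintro ⟨⟨-, h1⟩, h2⟩
      rw [hΦ, htil m (h1.trans hj), WithTop.coe_inj] at h2
      exact ⟨h1, h2⟩
    · rintro ⟨h1, h2⟩
      refine ⟨⟨Nat.zero_le _, h1⟩, ?_⟩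
      rw [hΦ, htil m (h1.trans hj), WithTop.coe_inj]
      exact h2
  have hyn : VGe vL (n + 1) (y ^ n - (-1) ^ (n + 1) * algebraMap K L (c n)) := by
    have h1 := Eis.norm C hπ E.ge1 E.rel'
    have hπg : VGe vL 1 π := by unfold VGe; rw [hπ]; rfl
    have hyg : VGe vL 1 y := by unfold VGe; rw [hy]; rfl
    have h2 := VGe.sub_pow C.hL hπg hyg hπy n
    rw [mul_one] at h2
    have h3 := h1.sub C.hL h2
    convert h3 using 1
    rw [pow_succ]; ring
  have hfin := C.core Y Et E hn hj hℓ hI hη hπη hh1 hhn hhp S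
    (fun m => if b m = n then 0 else b m)
    (fun m => (((-1 : ℤ) ^ (k + ℓ + A m) *
                (if b m = n then ((u * p ^ (ν - m) : ℕ) : ℤ)
                 else if b m < h then
                   ((h₀ * p ^ (j - m) + ℓ : ℕ) : ℤ) - ((u * p ^ (ν - m) : ℕ) : ℤ)
                 else ((h₀ * p ^ (j - m) + ℓ : ℕ) : ℤ)) : ℤ) : K) *
              c n ^ (k - A m) * c (b m) * r ^ (p ^ m))
    (fun m hm => ((hSm m).1 hm).1)
    (fun m hm => by
      obtain ⟨-, -, h3⟩ := hAb m (((hSm m).1 hm).1.trans hj)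
      split_ifs <;> omega)
    (fun m hm hmS => by
      rw [(hAb m (hm.trans hj)).1, WithTop.coe_le_coe]
      have h1 := hle m hm
      have h2 : (Φ : ℤ) ≠ (A m : ℤ) * n - b m + p ^ m * ℓ := fun h => hmS ((hSm m).2 ⟨hm, h⟩)
      have h3 := lt_of_le_of_ne h1 h2
      linarith)
    (fun m hm => by
      obtain ⟨hmj, hmΦ⟩ := (hSm m).1 hm
      obtain ⟨-, hb1, hbn⟩ := hAb m (hmj.trans hj)
      obtain ⟨M, d, hM, hqM, hd, hV⟩ := C.target hy E hn hmj hj (hI m hmj) hrL hb1 hbn hmΦ hk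
        hh₀ hh1 hhn
      have h1 := C.mainTerm hy E hn (hmj.trans hj) (hI m hmj) hη hrL hηr hyn
        (by split_ifs <;> omega) hM hqM hhn hd
      have h2 := h1.sub C.hL hV
      rwa [sub_sub_sub_cancel_right] at h2)
    (fun m hm h' hh' hne => by
      obtain ⟨hmj, hmΦ⟩ := (hSm m).1 hm
      obtain ⟨-, hb1, hbn⟩ := hAb m (hmj.trans hj)
      exact C.offTerm hy E hn (hmj.trans hj) (hI m hmj) hη hrL hηr hb1 hbn hmΦ hh' hne)
  have hkZ : (Φ : ℤ) + h = k * n := by exact_mod_cast hk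
  exact C.down (M := ((k + 1 : ℕ) : ℤ)) hfin (by push_cast; rw [add_sub_cancel_right]; linarith)

end
end

section
/- Let a, b, c, d, w be positive integers with a ≠ c and b ≠ d, and let r, s be nonnegative integers such that w = ra + c = sb + d and a > sb. Let λ be the partition of w consisting of r copies of a and one copy of c, and let μ be the partition of w consisting of s copies of b and one copy of d. Assume all parts of λ are at most n and μ has at most n parts. Then d_{λμ} = (−1)^{r+s+w+1}·w if b does not divide c or sb < c, and d_{λμ} = (−1)^{r+s+w+1}·(w − ab) if b divides c and sb ≥ c. -/
noncomputable section

/-- The exponent vector on `Fin n` attached to a multiset `lam` of parts in `[1, n]`: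
the variable `X i` gets exponent the multiplicity of `i + 1` in `lam`, so that
`X ^ (partExp n lam)` is the monomial `X_{λ_1} ⋯ X_{λ_k}`. -/
def partExp (n : ℕ) (lam : Multiset ℕ) : Fin n →₀ ℕ :=
  Finsupp.equivFunOnFinite.symm fun i => lam.count ((i : ℕ) + 1)

section Helpers
open MvPolynomial Finset

/-- The substitution `X i ↦ e_{i+1}`. -/
def PhiE (n : ℕ) : MvPolynomial (Fin n) ℤ →ₐ[ℤ] MvPolynomial (Fin n) ℤ :=
  aeval (fun i : Fin n => esymm (Fin n) ℤ ((i : ℕ) + 1))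

lemma PhiE_val (n : ℕ) (p : MvPolynomial (Fin n) ℤ) :
    PhiE n p = (esymmAlgHom (Fin n) ℤ n p : MvPolynomial (Fin n) ℤ) := by
  have : PhiE n = (symmetricSubalgebra (Fin n) ℤ).val.comp (esymmAlgHom (Fin n) ℤ n) := by
    ext i : 1
    simp [PhiE, esymmAlgHom]
  rw [this]; rfl

lemma PhiE_inj (n : ℕ) : Function.Injective (PhiE n) := by
  intro p q h
  rw [PhiE_val, PhiE_val] at h
  exact (esymmAlgHom_fin_bijective ℤ n).1 (Subtype.ext h)

lemma PhiE_surj (n : ℕ) (f : MvPolynomial (Fin n) ℤ) (hf : f.IsSymmetric) :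
    ∃ p, PhiE n p = f := by
  obtain ⟨p, hp⟩ := (esymmAlgHom_fin_bijective ℤ n).2 ⟨f, hf⟩
  exact ⟨p, by rw [PhiE_val, hp]⟩

lemma expand_symm (n b : ℕ) (f : MvPolynomial (Fin n) ℤ) (hf : f.IsSymmetric) :
    (expand b f).IsSymmetric := by
  intro e
  rw [rename_expand, hf e]

/-- preimage of the power sum -/
def PP (n k : ℕ) : MvPolynomial (Fin n) ℤ := (PhiE_surj n _ (psum_isSymmetric (Fin n) ℤ k)).choose

lemma PP_spec (n k : ℕ) : PhiE n (PP n k) = psum (Fin n) ℤ k :=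
  (PhiE_surj n _ (psum_isSymmetric (Fin n) ℤ k)).choose_spec

/-- preimage of the elementary symmetric polynomial in the `b`-th powers -/
def EE (n b j : ℕ) : MvPolynomial (Fin n) ℤ :=
  (PhiE_surj n _ (expand_symm n b _ (esymm_isSymmetric (Fin n) ℤ j))).choose

lemma EE_spec (n b j : ℕ) : PhiE n (EE n b j) = expand b (esymm (Fin n) ℤ j) :=
  (PhiE_surj n _ (expand_symm n b _ (esymm_isSymmetric (Fin n) ℤ j))).choose_spec

/-- preimage of `e_k` for `0 < k`. -/
def eg (n k : ℕ) : MvPolynomial (Fin n) ℤ := ∑ i : Fin n, if (i : ℕ) + 1 = k then X i else 0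

lemma eg_spec (n k : ℕ) (hk : 0 < k) : PhiE n (eg n k) = esymm (Fin n) ℤ k := by
  rw [eg, map_sum]
  by_cases h : k ≤ n
  · rw [Finset.sum_eq_single ⟨k - 1, by omega⟩]
    · have : k - 1 + 1 = k := by omega
      simp [this, PhiE]
    · intro i _ hi
      rw [if_neg, map_zero]
      intro h2; apply hi; ext; simp; omega
    · simp
  · rw [Finset.sum_eq_zero]
    · rw [esymm, Finset.powersetCard_eq_empty.2 (by simpa using h), Finset.sum_empty]
    · intro i _
      rw [if_neg (by omega), map_zero]

lemma EE_zero (n b : ℕ) : EE n b 0 = 1 := by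
  apply PhiE_inj
  simp [EE_spec]

lemma PP_newton (n k : ℕ) (hk : 0 < k) :
    PP n k = (-1) ^ (k + 1) * (k : MvPolynomial (Fin n) ℤ) * eg n k -
      ∑ i : Fin n, if (i : ℕ) + 1 < k then
        (-1) ^ ((i : ℕ) + 1) * (X i * PP n (k - ((i : ℕ) + 1))) else 0 := by
  apply PhiE_inj
  rw [PP_spec, psum_eq_mul_esymm_sub_sum _ _ k hk]
  simp only [map_sub, map_mul, map_pow, map_neg, map_one, map_natCast, eg_spec n k hk, map_sum]
  congr 1
  have h1 : ∀ i : Fin n, PhiE n (if (i : ℕ) + 1 < k then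
        (-1) ^ ((i : ℕ) + 1) * (X i * PP n (k - ((i : ℕ) + 1))) else 0) =
      (fun j => if j + 1 < k then (-1) ^ (j + 1) * (esymm (Fin n) ℤ (j+1) *
        psum (Fin n) ℤ (k - (j+1))) else 0) (i : ℕ) := by
    intro i
    simp only
    split_ifs
    · simp only [map_mul, map_pow, map_neg, map_one, PP_spec]
      simp [PhiE]
    · simp
  rw [Finset.sum_congr rfl (fun i _ => h1 i), Fin.sum_univ_eq_sum_range
    (fun j => if j + 1 < k then (-1) ^ (j + 1) * (esymm (Fin n) ℤ (j+1) *
        psum (Fin n) ℤ (k - (j+1))) else 0)]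
  have h2 : ∑ j ∈ range n, (if j + 1 < k then (-1) ^ (j + 1) * (esymm (Fin n) ℤ (j+1) *
        psum (Fin n) ℤ (k - (j+1))) else 0) =
      ∑ j ∈ range (k - 1), (-1) ^ (j + 1) * (esymm (Fin n) ℤ (j+1) *
        psum (Fin n) ℤ (k - (j+1))) := by
    rw [← Finset.sum_filter]
    apply Finset.sum_subset
    · intro j; simp; omega
    · intro j hj hj2
      simp at hj hj2
      rw [esymm, Finset.powersetCard_eq_empty.2 (by simp; by_contra; apply absurd hj2; omega)]
      simp
  rw [h2]
  symm
  apply Finset.sum_bij (fun j _ => (j + 1, k - (j + 1)))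
  · intro j hj
    simp at hj ⊢
    omega
  · intro i _ j _ h; simp at h; exact h.1
  · rintro ⟨x, y⟩ h
    simp at h
    exact ⟨x - 1, by simp; omega, by simp; omega⟩
  · intro j hj; ring

lemma EE_newton (n b j : ℕ) :
    (j : MvPolynomial (Fin n) ℤ) * EE n b j = (-1) ^ (j + 1) *
      ∑ a ∈ antidiagonal j with a.1 < j, (-1) ^ a.1 * EE n b a.1 * PP n (b * a.2) := by
  apply PhiE_inj
  have := congrArg (expand b) (mul_esymm_eq_sum (Fin n) ℤ j)
  simp only [map_mul, map_pow, map_neg, map_one, map_natCast, map_sum, EE_spec, PP_spec] at this ⊢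
  have h2 : ∀ k, expand b (psum (Fin n) ℤ k) = psum (Fin n) ℤ (b * k) := by
    intro k; simp [psum, pow_mul]
  simp only [h2] at this
  exact this

lemma coeff_eg (n k : ℕ) (m : Fin n →₀ ℕ) :
    coeff m (eg n k) = ∑ i : Fin n, if (i : ℕ) + 1 = k ∧ Finsupp.single i 1 = m then 1 else 0 := by
  rw [eg, coeff_sum]
  apply Finset.sum_congr rfl
  intro i _
  by_cases h : (i : ℕ) + 1 = k <;> simp [h, coeff_X]

lemma coeff_PP (n k : ℕ) (hk : 0 < k) (m : Fin n →₀ ℕ) :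
    coeff m (PP n k) = (-1) ^ (k + 1) * (k : ℤ) * coeff m (eg n k) -
      ∑ i : Fin n, if (i : ℕ) + 1 < k ∧ m i ≠ 0 then
        (-1) ^ ((i : ℕ) + 1) * coeff (m - Finsupp.single i 1) (PP n (k - ((i : ℕ) + 1))) else 0 := by
  rw [PP_newton n k hk, coeff_sub, coeff_sum]
  congr 1
  · rw [show ((-1) ^ (k + 1) * (k : MvPolynomial (Fin n) ℤ)) = C ((-1) ^ (k + 1) * (k : ℤ)) by simp,
      coeff_C_mul]
  · apply Finset.sum_congr rfl
    intro i _
    by_cases h : (i : ℕ) + 1 < k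
    · rw [if_pos h, show ((-1) ^ ((i : ℕ) + 1) : MvPolynomial (Fin n) ℤ) = C ((-1) ^ ((i : ℕ) + 1)) by simp,
        coeff_C_mul, coeff_X_mul']
      by_cases h2 : m i = 0 <;> simp [h, h2]
    · simp [h]

lemma coeff_zero_PP (n k : ℕ) (hk : 0 < k) : coeff 0 (PP n k) = 0 := by
  rw [coeff_PP n k hk, coeff_eg]
  simp

lemma coeff_single_PP (n k : ℕ) (hk : 0 < k) (i : Fin n) :
    coeff (Finsupp.single i 1) (PP n k) = if (i : ℕ) + 1 = k then (-1) ^ (k + 1) * (k : ℤ) else 0 := by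
  rw [coeff_PP n k hk, coeff_eg, Finset.sum_eq_single i]
  · rw [Finset.sum_eq_zero]
    · simp
    · intro j _
      by_cases h : j = i
      · subst h
        split_ifs with h
        · rw [tsub_self, coeff_zero_PP n _ (by omega), mul_zero]
        · rfl
      · rw [if_neg]
        simp [Finsupp.single_apply, Ne.symm h]
  · intro j _ h
    rw [if_neg]
    simp [Finsupp.single_left_inj, h]
  · simp

lemma coeff_pow_PP (n : ℕ) (i : Fin n) (r : ℕ) :
    coeff (Finsupp.single i (r + 1)) (PP n ((r + 1) * ((i : ℕ) + 1))) =
      (-1) ^ ((r + 1) * ((i : ℕ) + 1) + (r + 1)) * (((i : ℕ) + 1 : ℕ) : ℤ) := by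
  induction r with
  | zero => rw [zero_add, one_mul, coeff_single_PP n _ (by omega), if_pos rfl]
  | succ r ih =>
    rw [coeff_PP n _ (by positivity), coeff_eg, Finset.sum_eq_zero, Finset.sum_eq_single i]
    · rw [if_pos, ← Finsupp.single_tsub, show r + 1 + 1 - 1 = r + 1 by omega,
        show (r + 1 + 1) * ((i : ℕ) + 1) - ((i : ℕ) + 1) = (r + 1) * ((i : ℕ) + 1) by
          rw [Nat.sub_eq_iff_eq_add] <;> nlinarith, ih]
      · ring
      · constructor
        · nlinarith
        · simp
    · intro j _ hj
      rw [if_neg]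
      simp [Finsupp.single_apply, Ne.symm hj]
    · simp
    · intro j _
      rw [if_neg]
      rintro ⟨_, h⟩
      have := congrArg Finsupp.degree h
      simp at this

lemma coeff_main_PP (n : ℕ) (i l : Fin n) (hil : i ≠ l) (r : ℕ) :
    coeff (Finsupp.single i r + Finsupp.single l 1) (PP n (r * ((i : ℕ) + 1) + ((l : ℕ) + 1))) =
      (-1) ^ (r * ((i : ℕ) + 1) + ((l : ℕ) + 1) + r + 1) *
        ((r * ((i : ℕ) + 1) + ((l : ℕ) + 1) : ℕ) : ℤ) := by
  induction r with
  | zero =>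
    rw [zero_mul, zero_add, Finsupp.single_zero, zero_add, coeff_single_PP n _ (by omega), if_pos rfl]
  | succ r ih =>
    rw [coeff_PP n _ (by positivity), coeff_eg, Finset.sum_eq_zero,
      Finset.sum_eq_add_of_mem i l (mem_univ _) (mem_univ _) hil]
    · rw [if_pos, if_pos]
      · have e1 : Finsupp.single i (r + 1) + Finsupp.single l 1 - Finsupp.single i 1
            = Finsupp.single i r + Finsupp.single l 1 := by
          rw [Finsupp.single_add, add_right_comm, add_tsub_cancel_right]
        have e2 : (r + 1) * ((i : ℕ) + 1) + ((l : ℕ) + 1) - ((i : ℕ) + 1) =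
            r * ((i : ℕ) + 1) + ((l : ℕ) + 1) := by
          rw [Nat.sub_eq_iff_eq_add] <;> nlinarith
        rw [e1, e2, ih, add_tsub_cancel_right, add_tsub_cancel_right, coeff_pow_PP]
        push_cast
        ring
      · constructor
        · have : 0 < (r + 1) * ((i : ℕ) + 1) := by positivity
          omega
        · simp
      · constructor
        · nlinarith
        · simp
    · intro j _ hj
      rw [if_neg]
      simp [Finsupp.single_apply, Ne.symm hj.1, Ne.symm hj.2]
    · intro j _
      rw [if_neg]
      rintro ⟨_, h⟩
      have := congrArg Finsupp.degree h
      simp at this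

lemma PP_supported (n k : ℕ) (hk : 0 < k) :
    PP n k ∈ supported ℤ {i : Fin n | (i : ℕ) + 1 ≤ k} := by
  induction k using Nat.strong_induction_on with
  | _ k ih =>
  rw [PP_newton n k hk]
  have hc : ∀ j : ℕ, ((-1) ^ j : MvPolynomial (Fin n) ℤ) ∈ supported ℤ {i : Fin n | (i : ℕ) + 1 ≤ k} :=
    fun j => pow_mem (neg_mem (one_mem _)) _
  refine sub_mem (mul_mem (mul_mem (hc _) (natCast_mem _ _)) (sum_mem ?_)) (sum_mem ?_)
  · intro i _
    split_ifs with h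
    · exact X_mem_supported.2 h.le
    · exact zero_mem _
  · intro i _
    split_ifs with h
    · refine mul_mem (hc _) (mul_mem (X_mem_supported.2 (by simp; omega)) ?_)
      refine supported_mono ?_ (ih (k - (i + 1)) (by omega) (by omega))
      intro l hl
      simp at hl ⊢; omega
    · exact zero_mem _

lemma EE_supported (n b j : ℕ) (hb : 0 < b) :
    EE n b j ∈ supported ℤ {i : Fin n | (i : ℕ) + 1 ≤ b * j} := by
  induction j using Nat.strong_induction_on with
  | _ j ih =>
  rcases Nat.eq_zero_or_pos j with rfl | hj
  · rw [EE_zero]; exact one_mem _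
  have h : (j : MvPolynomial (Fin n) ℤ) * EE n b j ∈ supported ℤ {i : Fin n | (i : ℕ) + 1 ≤ b * j} := by
    rw [EE_newton]
    refine mul_mem (pow_mem (neg_mem (one_mem _)) _) (sum_mem ?_)
    rintro ⟨x, y⟩ hx
    simp only [mem_filter, HasAntidiagonal.mem_antidiagonal] at hx
    refine mul_mem (mul_mem (pow_mem (neg_mem (one_mem _)) _) ?_) ?_
    · refine supported_mono ?_ (ih x hx.2)
      intro l hl
      simp only [Set.mem_ofPred_eq] at hl ⊢
      exact hl.trans (Nat.mul_le_mul_left _ hx.2.le)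
    · refine supported_mono ?_ (PP_supported n (b * y) (Nat.mul_pos hb (by omega)))
      intro l hl
      simp only [Set.mem_ofPred_eq] at hl ⊢
      exact hl.trans (Nat.mul_le_mul_left _ (by omega))
  rw [show (j : MvPolynomial (Fin n) ℤ) = C (j : ℤ) by simp, mem_supported,
    vars_C_mul _ (by exact_mod_cast hj.ne')] at h
  exact mem_supported.2 h

lemma coeff_natCast_mul' (n j : ℕ) (p : MvPolynomial (Fin n) ℤ) (m : Fin n →₀ ℕ) :
    coeff m ((j : MvPolynomial (Fin n) ℤ) * p) = (j : ℤ) * coeff m p := by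
  rw [show (j : MvPolynomial (Fin n) ℤ) = C (j : ℤ) by simp, coeff_C_mul]

lemma coeff_sign_mul (n j : ℕ) (p : MvPolynomial (Fin n) ℤ) (m : Fin n →₀ ℕ) :
    coeff m ((-1) ^ j * p) = (-1) ^ j * coeff m p := by
  rw [show ((-1) ^ j : MvPolynomial (Fin n) ℤ) = C ((-1) ^ j) by simp, coeff_C_mul]

lemma coeff_zero_EE (n b j : ℕ) (hb : 0 < b) (hj : 0 < j) : coeff 0 (EE n b j) = 0 := by
  have h := congrArg (coeff 0) (EE_newton n b j)
  rw [coeff_natCast_mul', coeff_sign_mul, coeff_sum, Finset.sum_eq_zero, mul_zero] at h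
  · have : (j : ℤ) ≠ 0 := by exact_mod_cast hj.ne'
    
    rcases mul_eq_zero.1 h with h | h
    · exact absurd h this
    · exact h
  · rintro ⟨x, y⟩ hx
    simp only [mem_filter, HasAntidiagonal.mem_antidiagonal] at hx
    rw [← constantCoeff_eq, map_mul, constantCoeff_eq, coeff_zero_PP n _ (Nat.mul_pos hb (by omega)), mul_zero]

lemma coeff_single_mul (n : ℕ) (i : Fin n) (p q : MvPolynomial (Fin n) ℤ) :
    coeff (Finsupp.single i 1) (p * q) = coeff 0 p * coeff (Finsupp.single i 1) q +
      coeff (Finsupp.single i 1) p * coeff 0 q := by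
  classical
  rw [coeff_mul, Finsupp.antidiagonal_single]
  simp [Finset.Nat.antidiagonal_succ]

lemma coeff_single_EE (n b j : ℕ) (hb : 0 < b) (hj : 0 < j) (i : Fin n) :
    coeff (Finsupp.single i 1) (EE n b j) =
      if (i : ℕ) + 1 = b * j then (-1) ^ (b * j + j) * (b : ℤ) else 0 := by
  have h := congrArg (coeff (Finsupp.single i 1)) (EE_newton n b j)
  have hj' : (j : ℤ) ≠ 0 := by exact_mod_cast hj.ne'
  rw [coeff_natCast_mul', coeff_sign_mul, coeff_sum, Finset.sum_eq_single (0, j)] at h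
  · rw [pow_zero, one_mul, EE_zero, one_mul, coeff_single_PP n _ (Nat.mul_pos hb hj)] at h
    apply mul_left_cancel₀ hj'
    rw [h]
    split_ifs
    · push_cast; ring
    · simp
  · rintro ⟨x, y⟩ hx hne
    simp only [mem_filter, HasAntidiagonal.mem_antidiagonal] at hx
    have hx0 : 0 < x := by
      rcases Nat.eq_zero_or_pos x with rfl | h
      · exfalso; apply hne; simp; omega
      · exact h
    rw [mul_assoc, coeff_sign_mul, coeff_single_mul, coeff_zero_PP n _ (Nat.mul_pos hb (by omega)),
      coeff_zero_EE n b x hb hx0]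
    ring
  · intro h
    simp [hj] at h

lemma coeff_PP_mul_EE (n b j m : ℕ) (hb : 0 < b) (hj : 0 < j) (β : Fin n →₀ ℕ) (l : Fin n)
    (hβ : ∀ i : Fin n, β i ≠ 0 → b * j < (i : ℕ) + 1) :
    coeff (β + Finsupp.single l 1) (PP n m * EE n b j) =
      coeff β (PP n m) * coeff (Finsupp.single l 1) (EE n b j) := by
  classical
  rw [coeff_mul, Finset.sum_eq_single (β, Finsupp.single l 1)]
  · rintro ⟨u, v⟩ huv hne
    simp only [HasAntidiagonal.mem_antidiagonal] at huv
    simp only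
    by_contra hcon
    have hv : coeff v (EE n b j) ≠ 0 := right_ne_zero_of_mul hcon
    have hsup : ∀ i, v i ≠ 0 → (i : ℕ) + 1 ≤ b * j := by
      intro i hi
      have := mem_supported.1 (EE_supported n b j hb)
      apply this
      rw [Finset.mem_coe, mem_vars_iff_mem_support]
      exact ⟨v, mem_support_iff.2 hv, Finsupp.mem_support_iff.2 hi⟩
    have hle : ∀ i, v i ≤ (Finsupp.single l 1 : Fin n →₀ ℕ) i := by
      intro i
      by_cases h0 : v i = 0
      · omega
      have h1 := hsup i h0
      have h2 : β i = 0 := by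
        by_contra h; have := hβ i h; omega
      have := DFunLike.congr_fun huv i
      simp only [Finsupp.add_apply, h2] at this
      omega
    by_cases hvl : v l = 0
    · have : v = 0 := by
        ext i
        have := hle i
        by_cases hi : l = i
        · subst hi; simpa using hvl
        · simp [Finsupp.single_apply, hi] at this; simpa using this
      rw [this] at hv
      exact hv (coeff_zero_EE n b j hb hj)
    · have : v = Finsupp.single l 1 := by
        ext i
        have := hle i
        by_cases hi : l = i
        · subst hi; simp at this ⊢; omega
        · simp [Finsupp.single_apply, hi] at this ⊢; simpa using this
      subst this
      apply hne
      rw [add_right_cancel huv]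
  · intro h; simp at h


/-- sum of `x_i^d * prod_{t in T} x_t^b`, `i` not in `T`, `|T| = s` -/
def MM (n b s d : ℕ) : MvPolynomial (Fin n) ℤ :=
  ∑ i : Fin n, ∑ T ∈ powersetCard s (univ.erase i), X i ^ d * ∏ t ∈ T, X t ^ b

lemma MM_zero (n b d : ℕ) : MM n b 0 d = psum (Fin n) ℤ d := by
  simp [MM, psum]

lemma MM_succ (n b s d : ℕ) :
    MM n b (s + 1) d = psum (Fin n) ℤ d * expand b (esymm (Fin n) ℤ (s + 1)) - MM n b s (d + b) := by
  rw [eq_sub_iff_add_eq, MM, MM, ← Finset.sum_add_distrib, psum, Finset.sum_mul]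
  apply Finset.sum_congr rfl
  intro i _
  have hi : (univ : Finset (Fin n)) = insert i (univ.erase i) := by simp
  have hd : Disjoint (powersetCard (s + 1) (univ.erase i))
      ((powersetCard s (univ.erase i)).image (insert i)) := by
    rw [Finset.disjoint_left]
    intro T hT hT2
    rw [mem_image] at hT2
    obtain ⟨U, _, rfl⟩ := hT2
    have := (mem_powersetCard.1 hT).1 (mem_insert_self i U)
    simp at this
  rw [esymm, map_sum]
  conv_rhs => rw [hi]
  rw [Finset.powersetCard_succ_insert (by simp), Finset.sum_union hd, mul_add, Finset.mul_sum]
  congr 1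
  · apply Finset.sum_congr rfl
    intro T _
    simp
  · rw [Finset.sum_image, Finset.mul_sum]
    · apply Finset.sum_congr rfl
      intro T hT
      have hiT : i ∉ T := fun h => by
        have := (mem_powersetCard.1 hT).1 h
        simp at this
      rw [Finset.prod_insert hiT]
      simp [pow_add, mul_assoc]
    · intro T hT U hU h
      have h1 : i ∉ T := fun h => by
        have := (mem_powersetCard.1 hT).1 h
        simp at this
      have h2 : i ∉ U := fun h => by
        have := (mem_powersetCard.1 hU).1 h
        simp at this
      rw [← Finset.erase_insert h1, ← Finset.erase_insert h2]
      rw [h]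

/-- the multiset with `d` copies of `i` and `b` copies of each element of `T` -/
def ms {n : ℕ} (b d : ℕ) (i : Fin n) (T : Finset (Fin n)) : Multiset (Fin n) :=
  Multiset.replicate d i + b • T.val

lemma count_ms {n : ℕ} (b d : ℕ) (i : Fin n) (T : Finset (Fin n)) (hi : i ∉ T) (j : Fin n) :
    (ms b d i T).count j = if j = i then d else if j ∈ T then b else 0 := by
  rw [ms, Multiset.count_add, Multiset.count_nsmul, Multiset.count_replicate]
  by_cases h : j = i
  · subst h
    simp [hi]
  · by_cases h2 : j ∈ T
    · have : Multiset.count j T.val = 1 := Multiset.count_eq_one_of_mem T.nodup h2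
      simp [h, Ne.symm h, h2, this]
    · simp [h, Ne.symm h, h2]

lemma ms_parts {n : ℕ} (b d : ℕ) (hb : 0 < b) (hd : 0 < d) (i : Fin n) (T : Finset (Fin n))
    (hi : i ∉ T) : (ms b d i T).dedup.map (ms b d i T).count =
      Multiset.replicate T.card b + {d} := by
  have h1 : (ms b d i T).dedup = (insert i T).val := by
    rw [← Multiset.toFinset_val]
    congr 1
    ext j
    rw [Multiset.mem_toFinset, ← Multiset.count_pos, count_ms b d i T hi, Finset.mem_insert]
    by_cases h : j = i
    · simp [h, hd]
    · by_cases h2 : j ∈ T <;> simp [h, h2, hb]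
  rw [h1, Finset.insert_val_of_notMem hi, Multiset.map_cons, count_ms b d i T hi, if_pos rfl,
    add_comm, Multiset.singleton_add]
  congr 1
  rw [Multiset.eq_replicate]
  constructor
  · simp
  · intro x hx
    rw [Multiset.mem_map] at hx
    obtain ⟨j, hj, rfl⟩ := hx
    have hj' : j ∈ T := hj
    rw [count_ms b d i T hi, if_neg (by rintro rfl; exact hi hj'), if_pos hj']

lemma exists_ms {n : ℕ} (b d s : ℕ) (M : Multiset (Fin n))
    (h : M.dedup.map M.count = Multiset.replicate s b + {d}) :
    ∃ i : Fin n, ∃ T : Finset (Fin n), i ∉ T ∧ T.card = s ∧ ms b d i T = M := by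
  have hd : d ∈ M.dedup.map M.count := by rw [h]; simp
  obtain ⟨i, hi, hid⟩ := Multiset.mem_map.1 hd
  have h2 : (M.dedup.erase i).map M.count = Multiset.replicate s b := by
    have h3 := Multiset.cons_erase hi
    rw [← h3, Multiset.map_cons, hid, add_comm, Multiset.singleton_add] at h
    exact (Multiset.cons_inj_right d).1 h
  rw [Multiset.eq_replicate] at h2
  have hval : (M.toFinset.erase i).val = M.dedup.erase i := by
    rw [Finset.erase_val, Multiset.toFinset_val]
  refine ⟨i, M.toFinset.erase i, by simp, ?_, ?_⟩
  · rw [← h2.1, Finset.card, hval, Multiset.card_map]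
  · ext j
    rw [count_ms _ _ _ _ (by simp)]
    by_cases hj : j = i
    · simp [hj, hid]
    · rw [if_neg hj]
      split_ifs with hjT
      · symm
        apply h2.2
        apply Multiset.mem_map_of_mem
        rw [← hval]
        exact hjT
      · simp [hj] at hjT
        exact (Multiset.count_eq_zero.2 hjT).symm

lemma msymm_eq_MM (n b d s w : ℕ) (hb : 0 < b) (hd : 0 < d) (hbd : b ≠ d) (hw2 : w = s * b + d)
    (mu : w.Partition) (hmu : mu.parts = Multiset.replicate s b + {d}) :
    msymm (Fin n) ℤ mu = MM n b s d := by
  rw [MM, Finset.sum_sigma', msymm]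
  symm
  have key : ∀ x ∈ (univ : Finset (Fin n)).sigma (fun i => powersetCard s (univ.erase i)),
      x.1 ∉ x.2 ∧ x.2.card = s := by
    rintro ⟨i, T⟩ hx
    simp only [mem_sigma, mem_univ, true_and, mem_powersetCard] at hx
    exact ⟨fun h => by simpa using hx.1 h, hx.2⟩
  refine Finset.sum_bij (fun x hx => ⟨⟨ms b d x.1 x.2, ?_⟩, ?_⟩) ?_ ?_ ?_ ?_
  · have := (key x hx).2
    simp [ms, this, hw2]
    ring
  · apply Nat.Partition.ext
    rw [hmu]
    change (ms b d x.1 x.2).dedup.map (ms b d x.1 x.2).count = _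
    rw [ms_parts b d hb hd _ _ (key x hx).1, (key x hx).2]
  · intro x hx; exact mem_univ _
  · rintro ⟨i, T⟩ hx ⟨j, U⟩ hy h
    have hT := (key _ hx).1
    have hU := (key _ hy).1
    have h := congrArg (fun z => (z.1.1 : Multiset (Fin n))) h
    simp only at h hT hU
    have hc : ∀ k, (ms b d i T).count k = (ms b d j U).count k := by
      intro k; rw [h]
    simp only [count_ms b d i T hT, count_ms b d j U hU] at hc
    have hij : i = j := by
      by_contra hne
      have := hc i
      rw [if_pos rfl, if_neg hne] at this
      split_ifs at this <;> omega
    subst hij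
    have hTU : T = U := by
      ext k
      have := hc k
      by_cases hk : k = i
      · subst hk; simp [hT, hU]
      · simp only [hk, if_false] at this
        by_cases h1 : k ∈ T <;> by_cases h2 : k ∈ U <;> simp [h1, h2] at this ⊢ <;> omega
    rw [hTU]
  · rintro ⟨⟨M, hM⟩, hM2⟩ _
    have h3 : M.dedup.map M.count = Multiset.replicate s b + {d} := by
      rw [← hmu, ← hM2]; rfl
    obtain ⟨i, T, hi, hT, hMT⟩ := exists_ms b d s M h3
    refine ⟨⟨i, T⟩, ?_, ?_⟩
    · simp only [mem_sigma, mem_univ, true_and, mem_powersetCard]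
      refine ⟨?_, hT⟩
      intro k hk
      simp only [mem_erase, mem_univ, and_true]
      rintro rfl
      exact hi hk
    · exact Subtype.ext (Subtype.ext hMT)
  · rintro ⟨i, T⟩ hx
    simp only [ms, Multiset.map_add, Multiset.prod_add, Multiset.map_replicate,
      Multiset.prod_replicate, Multiset.map_nsmul, Multiset.prod_nsmul]
    rw [Finset.prod_pow]
    rfl

/-- preimage of `MM` -/
def QQ (n b : ℕ) : ℕ → ℕ → MvPolynomial (Fin n) ℤ
  | 0, d => PP n d
  | s + 1, d => PP n d * EE n b (s + 1) - QQ n b s (d + b)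

lemma QQ_spec (n b s d : ℕ) : PhiE n (QQ n b s d) = MM n b s d := by
  induction s generalizing d with
  | zero => rw [QQ, MM_zero, PP_spec]
  | succ s ih => rw [QQ, MM_succ, map_sub, map_mul, PP_spec, EE_spec, ih]

lemma coeff_QQ (n a b c w r : ℕ) (hb : 0 < b) (l : Fin n) (hl : (l : ℕ) + 1 = c)
    (hw1 : w = r * a + c) (β : Fin n →₀ ℕ)
    (hβ : ∀ i : Fin n, β i ≠ 0 → (i : ℕ) + 1 = a)
    (hβP : 0 < r → coeff β (PP n (r * a)) = (-1) ^ (r * a + r) * (a : ℤ))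
    (hP : coeff (β + Finsupp.single l 1) (PP n w) = (-1) ^ (w + r + 1) * (w : ℤ))
    (s d : ℕ) (hd : 0 < d) (hw2 : w = s * b + d) (hasb : s * b < a) :
    coeff (β + Finsupp.single l 1) (QQ n b s d) =
      if b ∣ c ∧ c ≤ s * b then (-1) ^ (r + s + w + 1) * ((w : ℤ) - (a : ℤ) * (b : ℤ))
      else (-1) ^ (r + s + w + 1) * (w : ℤ) := by
  induction s generalizing d with
  | zero =>
    rw [if_neg (by rintro ⟨_, h⟩; omega), QQ]
    simp only [zero_mul, zero_add] at hw2
    rw [← hw2, hP]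
    ring
  | succ s ih =>
    have hs1 : (s + 1) * b = s * b + b := by ring
    rw [QQ, coeff_sub, ih (d + b) (by omega) (by omega) (by omega),
      coeff_PP_mul_EE n b (s + 1) d hb (by omega) β l
        (fun i hi => by rw [hβ i hi, mul_comm]; exact hasb),
      coeff_single_EE n b (s + 1) hb (by omega), hl]
    by_cases hcs : c = b * (s + 1)
    · have hcs' : c = s * b + b := by rw [hcs]; ring
      have hdr : d = r * a := by omega
      have hr : 0 < r := by
        rcases Nat.eq_zero_or_pos r with rfl | h
        · omega
        · exact h
      rw [if_pos hcs, if_neg (by rintro ⟨_, h⟩; omega),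
        if_pos ⟨⟨s + 1, hcs⟩, by omega⟩, hdr, hβP hr, ← hcs]
      have : w = r * a + c := hw1
      rw [show r + s + w + 1 = (r * a + r) + (c + (s + 1)) by omega,
        show r + (s + 1) + w + 1 = ((r * a + r) + (c + (s + 1))) + 1 by omega]
      ring
    · rw [if_neg hcs, mul_zero, zero_sub]
      have hiff : (b ∣ c ∧ c ≤ (s + 1) * b) ↔ (b ∣ c ∧ c ≤ s * b) := by
        constructor
        · rintro ⟨⟨k, rfl⟩, h2⟩
          refine ⟨⟨k, rfl⟩, ?_⟩
          have h3 : k ≤ s + 1 := by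
            by_contra h
            push Not at h
            nlinarith
          have h4 : k ≠ s + 1 := by rintro rfl; exact hcs rfl
          have : k ≤ s := by omega
          nlinarith
        · rintro ⟨h1, h2⟩
          exact ⟨h1, by omega⟩
      simp only [hiff]
      split_ifs <;> ring


end Helpers

/-- **Proposition (akcbld).**  Let `a, b, c, d, w` be positive integers with `a ≠ c`,
`b ≠ d`, and `r, s ≥ 0` with `w = ra + c = sb + d` and `a > sb`.  Let `λ` consist of `r`
copies of `a` and one copy of `c`, and let `μ` consist of `s` copies of `b` and one copy
of `d`.  Then the coefficient `d_{λμ}` of `X_{λ_1}⋯X_{λ_k}` in the unique polynomial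
`ψ_μ` with `m_μ = ψ_μ(e_1, …, e_n)` equals `(-1)^{r+s+w+1}·w` if `b ∤ c` or `sb < c`,
and `(-1)^{r+s+w+1}·(w - ab)` if `b ∣ c` and `sb ≥ c`. -/
theorem akcbld (n : ℕ) (hn : 1 ≤ n) (a b c d w : ℕ)
    (ha : 0 < a) (hb : 0 < b) (hc : 0 < c) (hd : 0 < d) (hw : 0 < w)
    (hac : a ≠ c) (hbd : b ≠ d) (r s : ℕ)
    (hw1 : w = r * a + c) (hw2 : w = s * b + d) (hasb : s * b < a)
    (lam : Multiset ℕ) (hlam : lam = Multiset.replicate r a + {c})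
    (hlamn : ∀ x ∈ lam, x ≤ n)
    (mu : w.Partition) (hmu : mu.parts = Multiset.replicate s b + {d})
    (hmun : Multiset.card mu.parts ≤ n)
    (ψ : MvPolynomial (Fin n) ℤ)
    (hψ : MvPolynomial.aeval (fun i : Fin n => MvPolynomial.esymm (Fin n) ℤ ((i : ℕ) + 1)) ψ
      = MvPolynomial.msymm (Fin n) ℤ mu) :
    ψ.coeff (partExp n lam) =
      if b ∣ c ∧ c ≤ s * b then (-1) ^ (r + s + w + 1) * ((w : ℤ) - (a : ℤ) * (b : ℤ))
      else (-1) ^ (r + s + w + 1) * (w : ℤ) := by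
  have hcn : c ≤ n := hlamn c (by rw [hlam]; simp)
  let l : Fin n := ⟨c - 1, by omega⟩
  have hl : (l : ℕ) + 1 = c := by simp only [l]; omega
  have hψQ : ψ = QQ n b s d := by
    apply PhiE_inj
    rw [QQ_spec, ← msymm_eq_MM n b d s w hb hd hbd hw2 mu hmu]
    exact hψ
  let β : Fin n →₀ ℕ := partExp n (Multiset.replicate r a)
  have hpart : partExp n lam = β + Finsupp.single l 1 := by
    ext i
    simp only [partExp, β, hlam, Finsupp.add_apply, Finsupp.equivFunOnFinite_symm_apply_apply,
      Multiset.count_add, Multiset.count_singleton, Finsupp.single_apply, Fin.ext_iff]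
    congr 1
    apply if_congr _ rfl rfl
    omega
  rw [hpart, hψQ]
  have hβ : ∀ i : Fin n, β i ≠ 0 → (i : ℕ) + 1 = a := by
    intro i hi
    by_contra h
    apply hi
    simp only [β, partExp, Finsupp.equivFunOnFinite_symm_apply_apply, Multiset.count_replicate]
    rw [if_neg (Ne.symm h)]
  rcases Nat.eq_zero_or_pos r with hr | hr
  · subst hr
    have hβ0 : β = 0 := by
      ext i
      simp [β, partExp]
    refine coeff_QQ n a b c w 0 hb l hl hw1 β hβ (fun h => absurd h (by omega)) ?_ s d hd hw2 hasb
    rw [hβ0, zero_add, coeff_single_PP n w hw, if_pos (by omega)]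
  · have han : a ≤ n := hlamn a 
      (by rw [hlam]; exact Multiset.mem_add.2 (Or.inl (Multiset.mem_replicate.2 ⟨hr.ne', rfl⟩)))
    obtain ⟨i, hi⟩ : ∃ i : Fin n, (i : ℕ) + 1 = a := ⟨⟨a - 1, by omega⟩, by simp; omega⟩
    have hβi : β = Finsupp.single i r := by
      ext j
      simp only [β, partExp, Finsupp.equivFunOnFinite_symm_apply_apply, Multiset.count_replicate,
        Finsupp.single_apply, Fin.ext_iff]
      apply if_congr _ rfl rfl
      omega
    refine coeff_QQ n a b c w r hb l hl hw1 β hβ ?_ ?_ s d hd hw2 hasb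
    · intro _
      obtain ⟨q, rfl⟩ : ∃ q, r = q + 1 := ⟨r - 1, by omega⟩
      rw [hβi, ← hi]
      exact coeff_pow_PP n i q
    · rw [hβi, hw1, ← hi, ← hl]
      apply coeff_main_PP
      intro h
      apply hac
      rw [← hi, ← hl, h]

end
end

section
/- Let a, b, d, w be positive integers with b ≠ d, let r ≥ 1 and s ≥ 0 be integers such that w = ra = sb + d and a > sb. Let λ be the partition of w consisting of r copies of a, and let μ be the partition of w consisting of s copies of b and one copy of d. Assume a ≤ n and μ has at most n parts. Then d_{λμ} = (−1)^{r+s+w}·a. -/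
noncomputable section

open Finset in
/-- The sum of the `k`-fold products over `t`. -/
theorem dr_powersetCard_insert {σ R : Type*} [DecidableEq σ] [CommRing R] (y : σ → R)
    (t : Finset σ) (i : σ) (hi : i ∉ t) (k : ℕ) :
    ∑ S ∈ powersetCard (k + 1) (insert i t), ∏ j ∈ S, y j
      = ∑ S ∈ powersetCard (k + 1) t, ∏ j ∈ S, y j
        + y i * ∑ S ∈ powersetCard k t, ∏ j ∈ S, y j := by
  rw [powersetCard_succ_insert hi, sum_union, sum_image, mul_sum]
  · congr 1
    refine sum_congr rfl fun S hS => ?_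
    rw [prod_insert]
    exact fun h => hi ((mem_powersetCard.1 hS).1 h)
  · intro S hS T hT h
    have h1 : i ∉ S := fun h => hi ((mem_powersetCard.1 hS).1 h)
    have h2 : i ∉ T := fun h => hi ((mem_powersetCard.1 hT).1 h)
    rw [← erase_insert h1, ← erase_insert h2, h]
  · rw [disjoint_left]
    intro S hS hS2
    obtain ⟨T, _, rfl⟩ := mem_image.1 hS2
    exact hi ((mem_powersetCard.1 hS).1 (mem_insert_self _ _))

open Finset in
/-- Newton: if the lower power sums vanish. -/
theorem dr_newton {σ A : Type*} [Fintype σ] [CommRing A] (y : σ → A) (k : ℕ) (hk : 0 < k)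
    (h : ∀ j, 0 < j → j < k → ∑ i, y i ^ j = 0) :
    (k : A) * ∑ S ∈ powersetCard k univ, ∏ j ∈ S, y j = (-1) ^ (k + 1) * ∑ i, y i ^ k := by
  have := congrArg (MvPolynomial.aeval (R := ℤ) y) (MvPolynomial.mul_esymm_eq_sum σ ℤ k)
  simp only [map_mul, map_natCast, map_pow, map_neg, map_one, map_sum, MvPolynomial.esymm,
    MvPolynomial.psum, map_prod, MvPolynomial.aeval_X] at this
  rw [this]
  congr 1
  rw [sum_eq_single (0, k)]
  · simp
  · rintro ⟨u, v⟩ huv hne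
    simp only [mem_filter, HasAntidiagonal.mem_antidiagonal] at huv
    have hu : u ≠ 0 := by
      rintro rfl
      apply hne
      simp at huv
      simp [huv.1]
    rw [h v (by omega) (by omega), mul_zero]
  · intro h
    simp at h
    omega

open Finset in
theorem dr_msymm {σ A : Type*} [Fintype σ] [DecidableEq σ] [CommRing A] [Algebra ℤ A] (x : σ → A)
    (b d s w : ℕ) (hb : 0 < b) (hd : 0 < d) (hbd : b ≠ d)
    (hw2 : w = s * b + d) (mu : w.Partition)
    (hmu : mu.parts = Multiset.replicate s b + {d}) :
    MvPolynomial.aeval x (MvPolynomial.msymm σ ℤ mu)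
      = ∑ i, x i ^ d * ∑ S ∈ powersetCard s (univ.erase i), ∏ j ∈ S, x j ^ b := by
  have hcount : ∀ (i : σ) (S : Finset σ) (j : σ),
      Multiset.count j (b • S.val + Multiset.replicate d i)
        = (if j ∈ S then b else 0) + if i = j then d else 0 := by
    intro i S j
    rw [Multiset.count_add, Multiset.count_nsmul, Multiset.count_replicate,
      Multiset.count_eq_of_nodup S.nodup]
    simp
  simp_rw [mul_sum]
  rw [sum_sigma', MvPolynomial.msymm, map_sum]
  symm
  have hmem : ∀ p ∈ (univ : Finset σ).sigma fun i => powersetCard s (univ.erase i),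
      p.1 ∉ p.2 ∧ p.2.card = s := by
    intro p hp
    simp only [mem_sigma, mem_univ, true_and, mem_powersetCard] at hp
    exact ⟨fun h => by simpa using hp.1 h, hp.2⟩
  refine sum_bij (fun p hp => ⟨⟨b • p.2.val + Multiset.replicate d p.1, ?_⟩, ?_⟩) ?_ ?_ ?_ ?_
  · have := (hmem p hp).2
    simp [this, hw2, mul_comm]
  · obtain ⟨h1, h2⟩ := hmem p hp
    apply Nat.Partition.ext
    rw [hmu]
    change Multiset.map _ (Multiset.dedup (b • p.2.val + Multiset.replicate d p.1)) = _
    have hdd : Multiset.dedup (b • p.2.val + Multiset.replicate d p.1) = p.1 ::ₘ p.2.val := by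
      rw [Multiset.Nodup.ext (Multiset.nodup_dedup _) (by simp [h1, p.2.nodup])]
      intro j
      rw [Multiset.mem_dedup, ← Multiset.count_pos, hcount]
      simp only [Multiset.mem_cons, mem_val]
      by_cases hj : j ∈ p.2 <;> by_cases hj2 : p.1 = j <;> simp [hj, hj2, hb, hd]
      exact fun h => hj2 h.symm
    rw [hdd, Multiset.map_cons, hcount, add_comm (Multiset.replicate s b), Multiset.singleton_add]
    congr 1
    · simp [h1]
    · rw [Multiset.eq_replicate]
      refine ⟨by simp [h2], ?_⟩
      intro c hc
      obtain ⟨j, hj, rfl⟩ := Multiset.mem_map.1 hc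
      rw [hcount]
      have : p.1 ≠ j := by rintro rfl; exact h1 hj
      have hj' : j ∈ p.2 := hj
      simp [hj', this]
  · intro p hp; simp
  · rintro ⟨i, S⟩ hp ⟨i', S'⟩ hp' h
    obtain ⟨h1, -⟩ := hmem _ hp
    obtain ⟨h1', -⟩ := hmem _ hp'
    have hc : ∀ j, ((if j ∈ S then b else 0) + if i = j then d else 0)
        = (if j ∈ S' then b else 0) + if i' = j then d else 0 := by
      intro j
      rw [← hcount, ← hcount]
      exact congrArg (fun q => Multiset.count j q.1.1) h
    simp only at h1 h1'
    have hii : i = i' := by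
      by_contra hne
      have := hc i
      rw [if_neg h1, if_pos rfl, if_neg (Ne.symm hne)] at this
      split_ifs at this <;> omega
    subst hii
    congr 1
    ext j
    have := hc j
    by_cases hj : j ∈ S <;> by_cases hj' : j ∈ S' <;> simp [hj, hj'] at this ⊢ <;> omega
  · rintro ⟨⟨m, hm⟩, hm2⟩ -
    have hp : Multiset.map (fun j => m.count j) m.dedup = Multiset.replicate s b + {d} := by
      rw [← hmu, ← hm2]; rfl
    have hdm : d ∈ Multiset.map (fun j => m.count j) m.dedup := by rw [hp]; simp
    obtain ⟨i, hi, hid⟩ := Multiset.mem_map.1 hdm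
    have hS : m.dedup = i ::ₘ (m.toFinset.erase i).val := by
      rw [erase_val, Multiset.toFinset_val, Multiset.cons_erase hi]
    rw [hS, Multiset.map_cons, hid, add_comm (Multiset.replicate s b), Multiset.singleton_add,
      Multiset.cons_inj_right, Multiset.eq_replicate] at hp
    refine ⟨⟨i, m.toFinset.erase i⟩, ?_, ?_⟩
    · simp only [mem_sigma, mem_univ, true_and, mem_powersetCard]
      refine ⟨erase_subset_erase _ (subset_univ _), ?_⟩
      rw [Finset.card_def, ← hp.1, Multiset.card_map]
    · apply Subtype.ext
      apply Subtype.ext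
      change b • (m.toFinset.erase i).val + Multiset.replicate d i = m
      ext j
      rw [hcount]
      by_cases hij : i = j
      · subst hij; simp [hid]
      · by_cases hj : j ∈ m
        · have := hp.2 (m.count j) (Multiset.mem_map_of_mem _ (by
            change j ∈ m.toFinset.erase i
            simp [hj, Ne.symm hij]))
          simp [hij, Ne.symm hij, hj, this]
        · simp [hij, hj]
  · intro p hp
    change _ = MvPolynomial.aeval x
      (Multiset.map MvPolynomial.X (b • p.2.val + Multiset.replicate d p.1)).prod
    rw [Multiset.map_add, Multiset.prod_add, Multiset.map_nsmul, Multiset.prod_nsmul,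
      Multiset.map_replicate, Multiset.prod_replicate, map_mul, map_pow, map_pow,
      MvPolynomial.aeval_X, mul_comm]
    congr 1
    change _ = (MvPolynomial.aeval x (∏ j ∈ p.2, MvPolynomial.X j)) ^ b
    simp [prod_pow]

open Polynomial in
theorem dr_coeff (n a r : ℕ) (i₀ : Fin n) (hi₀ : (i₀ : ℕ) + 1 = a) (t : ℂ)
    (ψ : MvPolynomial (Fin n) ℤ) (y : Fin n → ℂ[X])
    (hy : y i₀ = C t * X ^ a) (hy0 : ∀ i, i ≠ i₀ → y i = 0) :
    (MvPolynomial.aeval y ψ).coeff (r * a) = t ^ r * ((ψ.coeff (Finsupp.single i₀ r) : ℤ) : ℂ) := by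
  have hprod : ∀ m : Fin n →₀ ℕ, (∏ i, y i ^ m i).coeff (r * a)
      = if m = Finsupp.single i₀ r then t ^ r else 0 := by
    intro m
    by_cases h : ∀ i, i ≠ i₀ → m i = 0
    · have : ∏ i, y i ^ m i = C (t ^ m i₀) * X ^ (m i₀ * a) := by
        rw [Finset.prod_eq_single i₀]
        · rw [hy, mul_pow, ← pow_mul, C_pow, mul_comm a]
        · intro i _ hi; rw [h i hi, pow_zero]
        · simp
      rw [this, coeff_C_mul, coeff_X_pow]
      have hiff : (m = Finsupp.single i₀ r) ↔ r * a = m i₀ * a := by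
        constructor
        · rintro rfl; simp
        · intro h2
          have h3 : r = m i₀ := Nat.eq_of_mul_eq_mul_right (by omega) h2
          ext i
          by_cases hi : i = i₀
          · subst hi; simp [h3]
          · rw [h i hi, Finsupp.single_eq_of_ne hi]
      by_cases h2 : m = Finsupp.single i₀ r
      · rw [if_pos h2, if_pos (hiff.1 h2), h2]; simp
      · rw [if_neg h2, if_neg (fun h3 => h2 (hiff.2 h3)), mul_zero]
    · push Not at h
      obtain ⟨i, hi, hmi⟩ := h
      rw [Finset.prod_eq_zero (Finset.mem_univ i) (by rw [hy0 i hi, zero_pow hmi]), coeff_zero,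
        if_neg]
      rintro rfl
      exact hmi (Finsupp.single_eq_of_ne hi)
  rw [MvPolynomial.aeval_def, MvPolynomial.eval₂_eq', finsetSum_coeff]
  have : ∀ m ∈ ψ.support, (algebraMap ℤ ℂ[X] (ψ.coeff m) * ∏ i, y i ^ m i).coeff (r * a)
      = if m = Finsupp.single i₀ r then t ^ r * ((ψ.coeff m : ℤ) : ℂ) else 0 := by
    intro m _
    have hc : algebraMap ℤ ℂ[X] (ψ.coeff m) = C ((ψ.coeff m : ℤ) : ℂ) := by simp
    rw [hc, coeff_C_mul, hprod]
    split_ifs <;> ring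
  rw [Finset.sum_congr rfl this, Finset.sum_ite_eq']
  split_ifs with h
  · rfl
  · rw [MvPolynomial.notMem_support_iff.1 h]; simp

open Polynomial in
theorem dr_psum (n a : ℕ) (han : a ≤ n) (ζ : ℂ) (hζ : IsPrimitiveRoot ζ a)
    (x : Fin n → ℂ[X]) (hx : ∀ i, x i = if (i : ℕ) < a then C (ζ ^ (i : ℕ)) * X else 0)
    (k : ℕ) (hk : 0 < k) :
    ∑ i, x i ^ k = if a ∣ k then (a : ℂ[X]) * X ^ k else 0 := by
  have h1 : ∑ i, x i ^ k = C (∑ i ∈ Finset.range a, (ζ ^ k) ^ i) * X ^ k := by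
    have h2 : ∀ i : Fin n, x i ^ k
        = (fun j : ℕ => if j < a then C ((ζ ^ k) ^ j) * X ^ k else 0) (i : ℕ) := by
      intro i
      rw [hx]
      simp only
      split_ifs
      · rw [mul_pow, ← C_pow, ← pow_mul, ← pow_mul, mul_comm k]
      · rw [zero_pow hk.ne']
    rw [Finset.sum_congr rfl (fun i _ => h2 i), Fin.sum_univ_eq_sum_range
      (fun j : ℕ => if j < a then C ((ζ ^ k) ^ j) * X ^ k else 0) n, ← Finset.sum_filter]
    have : (Finset.range n).filter (· < a) = Finset.range a := by
      ext j; simp; omega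
    rw [this, map_sum, Finset.sum_mul]
  rw [h1]
  split_ifs with h
  · rw [(hζ.pow_eq_one_iff_dvd k).2 h]; simp
  · have hne : ζ ^ k ≠ 1 := fun h' => h ((hζ.pow_eq_one_iff_dvd k).1 h')
    rw [geom_sum_eq hne, ← pow_mul, mul_comm k a, pow_mul, hζ.pow_eq_one]
    simp

/-- Let `a, b, d, w` be positive integers with `b ≠ d`, and let `r ≥ 1`, `s ≥ 0` be
integers with `w = ra = sb + d` and `a > sb`.  Let `λ` consist of `r` copies of `a`,
and let `μ` consist of `s` copies of `b` and one copy of `d`.  Then the coefficient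
`d_{λμ}` of `X_{λ_1}⋯X_{λ_k}` in the unique polynomial `ψ_μ` with
`m_μ = ψ_μ(e_1, …, e_n)` equals `(-1)^{r+s+w}·a`. -/
theorem d_replicate_eq (n : ℕ) (hn : 1 ≤ n) (a b d w : ℕ)
    (ha : 0 < a) (hb : 0 < b) (hd : 0 < d) (hw : 0 < w)
    (hbd : b ≠ d) (r s : ℕ) (hr : 1 ≤ r)
    (hw1 : w = r * a) (hw2 : w = s * b + d) (hasb : s * b < a)
    (lam : Multiset ℕ) (hlam : lam = Multiset.replicate r a)
    (han : a ≤ n)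
    (mu : w.Partition) (hmu : mu.parts = Multiset.replicate s b + {d})
    (hmun : Multiset.card mu.parts ≤ n)
    (ψ : MvPolynomial (Fin n) ℤ)
    (hψ : MvPolynomial.aeval (fun i : Fin n => MvPolynomial.esymm (Fin n) ℤ ((i : ℕ) + 1)) ψ
      = MvPolynomial.msymm (Fin n) ℤ mu) :
    ψ.coeff (partExp n lam) = (-1) ^ (r + s + w) * (a : ℤ) := by
  obtain ⟨ζ, hζ⟩ : ∃ ζ : ℂ, IsPrimitiveRoot ζ a :=
    ⟨_, Complex.isPrimitiveRoot_exp a ha.ne'⟩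
  let x : Fin n → Polynomial ℂ := fun i =>
    if (i : ℕ) < a then Polynomial.C (ζ ^ (i : ℕ)) * Polynomial.X else 0
  have hp := dr_psum n a han ζ hζ x (fun i => rfl)
  let i₀ : Fin n := ⟨a - 1, by omega⟩
  have hi₀ : (i₀ : ℕ) + 1 = a := by simp only [i₀]; omega
  let y : Fin n → Polynomial ℂ := fun i =>
    ∑ S ∈ Finset.powersetCard ((i : ℕ) + 1) Finset.univ, ∏ j ∈ S, x j
  have hy : y i₀ = Polynomial.C ((-1) ^ (a + 1)) * Polynomial.X ^ a := by
    have h := dr_newton x a ha (fun j hj hja => by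
      rw [hp j hj, if_neg (Nat.not_dvd_of_pos_of_lt hj hja)])
    rw [hp a ha, if_pos dvd_rfl] at h
    have ha' : (a : Polynomial ℂ) ≠ 0 := Nat.cast_ne_zero.2 ha.ne'
    simp only [y, hi₀]
    apply mul_left_cancel₀ ha'
    rw [h]
    simp only [map_pow, map_neg, map_one]
    ring
  have hy0 : ∀ i, i ≠ i₀ → y i = 0 := by
    intro i hi
    have hia : (i : ℕ) + 1 ≠ a := fun h => hi (Fin.ext (by omega))
    rcases Nat.lt_or_gt_of_ne hia with hlt | hgt
    · have h := dr_newton x ((i : ℕ) + 1) (by omega) (fun j hj hja => by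
        rw [hp j hj, if_neg (Nat.not_dvd_of_pos_of_lt hj (by omega))])
      rw [hp _ (by omega), if_neg (Nat.not_dvd_of_pos_of_lt (by omega) hlt), mul_zero] at h
      exact (mul_eq_zero.1 h).resolve_left (Nat.cast_ne_zero.2 (by omega))
    · apply Finset.sum_eq_zero
      intro S hS
      have hcard := (Finset.mem_powersetCard.1 hS).2
      obtain ⟨j, hj, hja⟩ : ∃ j ∈ S, a ≤ (j : ℕ) := by
        by_contra hcon
        push Not at hcon
        have : (S.map Fin.valEmbedding).card ≤ (Finset.range a).card :=
          Finset.card_le_card (by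
            intro v hv
            obtain ⟨j, hj, rfl⟩ := Finset.mem_map.1 hv
            exact Finset.mem_range.2 (hcon j hj))
        rw [Finset.card_map, Finset.card_range] at this
        omega
      apply Finset.prod_eq_zero hj
      simp only [x]
      rw [if_neg (by omega)]
  -- the elementary symmetric functions of `x ^ b` without one variable
  have hE : ∀ i, ∀ k ≤ s, ∑ S ∈ Finset.powersetCard k (Finset.univ.erase i), ∏ j ∈ S, x j ^ b
      = (-(x i ^ b)) ^ k := by
    intro i k
    induction k with
    | zero => intro _; simp
    | succ k ih =>
      intro hk
      have hpz : ∀ j, 0 < j → j ≤ k + 1 → ∑ i, (x i ^ b) ^ j = 0 := by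
        intro j hj hjk
        simp_rw [← pow_mul]
        have hlt : b * j < a := lt_of_le_of_lt (by
          rw [mul_comm]; exact Nat.mul_le_mul_right b (hjk.trans hk)) hasb
        have hpos : 0 < b * j := Nat.mul_pos hb hj
        rw [hp _ hpos, if_neg (Nat.not_dvd_of_pos_of_lt hpos hlt)]
      have h := dr_newton (fun i => x i ^ b) (k + 1) (by omega)
        (fun j hj hjk => hpz j hj hjk.le)
      rw [hpz (k + 1) (by omega) le_rfl, mul_zero] at h
      have h0 := (mul_eq_zero.1 h).resolve_left (Nat.cast_ne_zero.2 (by omega))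
      rw [← Finset.insert_erase (Finset.mem_univ i),
        dr_powersetCard_insert _ _ _ (Finset.notMem_erase _ _), ih (by omega)] at h0
      rw [eq_neg_of_add_eq_zero_left h0, pow_succ]
      ring
  have key := congrArg (MvPolynomial.aeval (R := ℤ) x) hψ
  rw [dr_msymm x b d s w hb hd hbd hw2 mu hmu] at key
  have hL : MvPolynomial.aeval x (MvPolynomial.aeval
      (fun i : Fin n => MvPolynomial.esymm (Fin n) ℤ ((i : ℕ) + 1)) ψ)
      = MvPolynomial.aeval y ψ := by
    rw [← AlgHom.comp_apply, MvPolynomial.comp_aeval]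
    congr 2
    funext i
    simp [MvPolynomial.esymm, y]
  have hR : ∑ i, x i ^ d * ∑ S ∈ Finset.powersetCard s (Finset.univ.erase i), ∏ j ∈ S, x j ^ b
      = Polynomial.C ((-1) ^ s * (a : ℂ)) * Polynomial.X ^ (r * a) := by
    have : ∀ i ∈ Finset.univ, x i ^ d * ∑ S ∈ Finset.powersetCard s (Finset.univ.erase i),
        ∏ j ∈ S, x j ^ b = (-1) ^ s * x i ^ w := by
      intro i _
      rw [hE i s le_rfl, neg_pow, ← pow_mul, hw2, pow_add, mul_comm s b]
      ring
    rw [Finset.sum_congr rfl this, ← Finset.mul_sum, hp w hw, if_pos (hw1 ▸ dvd_mul_left a r), hw1]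
    simp only [map_mul, map_pow, map_neg, map_one, map_natCast]
    ring
  rw [hL, hR] at key
  have hc := dr_coeff n a r i₀ hi₀ _ ψ y hy hy0
  rw [key, Polynomial.coeff_C_mul, Polynomial.coeff_X_pow, if_pos rfl, mul_one] at hc
  have hpe : partExp n lam = Finsupp.single i₀ r := by
    ext i
    simp only [partExp, hlam, Finsupp.equivFunOnFinite_symm_apply_apply, Multiset.count_replicate]
    by_cases hi : i = i₀
    · subst hi; simp [hi₀]
    · rw [Finsupp.single_eq_of_ne hi, if_neg]
      intro h
      exact hi (Fin.ext (by omega))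
  rw [hpe]
  generalize MvPolynomial.coeff (Finsupp.single i₀ r) ψ = c at hc ⊢
  have hc' : (-1) ^ s * (a : ℤ) = ((-1) ^ (a + 1)) ^ r * c := by exact_mod_cast hc
  have hsq : ((-1 : ℤ) ^ (a + 1)) ^ r * ((-1) ^ (a + 1)) ^ r = 1 := by
    rw [← mul_pow, ← mul_pow]; simp
  calc c = ((-1) ^ (a + 1)) ^ r * (((-1) ^ (a + 1)) ^ r * c) := by
        rw [← mul_assoc, hsq, one_mul]
    _ = (-1) ^ (r + s + w) * (a : ℤ) := by
        rw [← hc', hw1, ← pow_mul]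
        ring

end
end

section
/- Let p be a prime, let t ≥ j ≥ 0 be integers, let w' ≥ 1, and set w = w'·p^t. Let λ' be a partition of w' and set λ = p^t·λ'; assume all parts of λ are at most n. Let μ be a partition of w with at most n parts such that there does not exist a partition μ' with μ = p^{j+1}*μ'. Then p^{t−j} divides d_{λμ}. -/
noncomputable section

open MvPolynomial

theorem orbit_dvd_sum {S R : Type*} [Fintype S] [CommRing R] (φ : Equiv.Perm S) (f : S → R)
    (p : ℕ) (hp : p.Prime) (a b : ℕ) (hφ : φ ^ (p ^ b) = 1) (hf : ∀ s, f (φ s) = f s)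
    (h : ∀ s, f s ≠ 0 → (φ ^ (p ^ a)) s ≠ s) : ((p : R) ^ (a + 1)) ∣ ∑ s, f s := by
  classical
  let G := Subgroup.zpowers φ
  have hG : ∀ (g : G) (s : S), f (g • s) = f s := by
    rintro ⟨g, hg⟩ s
    obtain ⟨k, rfl⟩ := Subgroup.mem_zpowers_iff.1 hg
    change f ((φ ^ k) s) = f s
    clear hg
    have hinv : ∀ s, f (φ⁻¹ s) = f s := fun s => by
      rw [← hf (φ⁻¹ s)]; simp
    induction k using Int.induction_on generalizing s with
    | zero => simp
    | succ i ih =>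
      rw [zpow_add_one, Equiv.Perm.mul_apply, ih, hf]
    | pred i ih =>
      rw [zpow_sub_one, Equiv.Perm.mul_apply, ih, hinv]
  rw [← (MulAction.selfEquivSigmaOrbits G S).symm.sum_comp, Fintype.sum_sigma]
  refine Finset.dvd_sum fun ω _ => ?_
  set s := ω.out with hs
  have h1 : ∀ y : MulAction.orbit G s,
      f ((MulAction.selfEquivSigmaOrbits G S).symm ⟨ω, y⟩) = f s := by
    rintro ⟨y, hy⟩
    obtain ⟨g, rfl⟩ := hy
    have : (MulAction.selfEquivSigmaOrbits G S).symm ⟨ω, ⟨g • s, ⟨g, rfl⟩⟩⟩ = g • s := rfl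
    exact (congrArg f this).trans (hG g s)
  rw [Finset.sum_congr rfl fun y _ => h1 y, Finset.sum_const, nsmul_eq_mul]
  by_cases h0 : f s = 0
  · simp [h0]
  refine Dvd.dvd.mul_right ?_ _
  rw [Finset.card_univ, ← MulAction.minimalPeriod_eq_card (a := φ) (b := s)]
  have key : ∀ k, Function.minimalPeriod (φ • ·) s ∣ k ↔ (φ ^ k) s = s := fun k => by
    rw [← MulAction.pow_smul_eq_iff_minimalPeriod_dvd]; rfl
  obtain ⟨i, hi, hi'⟩ := (Nat.dvd_prime_pow hp).1 ((key (p ^ b)).2 (by rw [hφ]; rfl))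
  rw [hi']
  have hai : a + 1 ≤ i := by
    by_contra hc
    exact h s h0 ((key _).1 (hi' ▸ pow_dvd_pow p (by omega)))
  rw [Nat.cast_pow]
  exact pow_dvd_pow _ hai

theorem dvd_msymm {R : Type*} [CommRing R] [IsDomain R] [Algebra ℤ R] (n p t j w : ℕ) (hp : p.Prime) (hjt : j < t)
    (hw : p ^ t ∣ w) (mu : w.Partition)
    (hmu : ¬ ∃ mu' : Multiset ℕ, mu.parts = p ^ (j + 1) • mu')
    (ζ : R) (hζ : IsPrimitiveRoot ζ (p ^ t)) (σ : Equiv.Perm (Fin n)) (hσ : σ ^ (p ^ t) = 1)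
    (x : Fin n → R) (hx : ∀ i, x (σ i) = ζ * x i) :
    (p : R) ^ (t - j) ∣ aeval x (msymm (Fin n) ℤ mu) := by
  classical
  have hxk : ∀ k i, x ((σ ^ k) i) = ζ ^ k * x i := by
    intro k i
    induction k with
    | zero => simp
    | succ k ih => rw [pow_succ', Equiv.Perm.mul_apply, hx, ih]; ring
  rw [msymm, map_sum]
  have h0 : ∀ s : {a : Sym (Fin n) w // Nat.Partition.ofSym a = mu},
      aeval x ((s.1.1.map (X : Fin n → MvPolynomial (Fin n) ℤ)).prod) = (s.1.1.map x).prod := by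
    intro s
    rw [map_multiset_prod, Multiset.map_map]
    congr 1
    exact Multiset.map_congr rfl fun i _ => by simp
  simp_rw [h0]
  obtain ⟨c, hc⟩ : ∃ c, t - j = c + 1 := ⟨t - j - 1, by omega⟩
  rw [hc]
  set φ : Equiv.Perm {a : Sym (Fin n) w // Nat.Partition.ofSym a = mu} :=
    Nat.Partition.ofSymShapeEquiv mu σ with hφ
  have hφ1 : ∀ s, (φ s).1.1 = s.1.1.map σ := fun s => rfl
  have hφk : ∀ k s, ((φ ^ k) s).1.1 = s.1.1.map (σ ^ k : Equiv.Perm (Fin n)) := by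
    intro k s
    induction k with
    | zero => simp
    | succ k ih =>
      rw [pow_succ', Equiv.Perm.mul_apply, hφ1, ih, Multiset.map_map, pow_succ']
      rfl
  refine orbit_dvd_sum φ _ p hp c t ?_ ?_ ?_
  · ext s : 1
    apply Subtype.ext; apply Subtype.ext
    refine (hφk _ s).trans ?_
    rw [hσ]; simp
  · intro s
    rw [hφ1, Multiset.map_map]
    have : (x ∘ σ) = fun i => ζ * x i := funext hx
    rw [this, Multiset.prod_map_mul, Multiset.map_const', Multiset.prod_replicate]
    have hcard : Multiset.card s.1.1 = w := s.1.2
    rw [hcard, (hζ.pow_eq_one_iff_dvd _).2 hw, one_mul]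
  · intro s hs hfix
    have hne : ∀ i ∈ s.1.1, x i ≠ 0 := by
      intro i hi h
      exact hs (Multiset.prod_eq_zero (h ▸ Multiset.mem_map_of_mem x hi))
    set τ : Equiv.Perm (Fin n) := σ ^ (p ^ c) with hτ
    have hmap : s.1.1.map τ = s.1.1 := by
      rw [← hφk, hfix]
    have hcount : ∀ i, s.1.1.count (τ i) = s.1.1.count i := by
      intro i
      conv_lhs => rw [← hmap]
      exact Multiset.count_map_eq_count' _ _ τ.injective _
    apply hmu
    obtain ⟨u, hu⟩ := Multiset.exists_smul_of_dvd_count mu.parts (k := p ^ (j + 1)) (by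
      intro v _
      rw [← s.2]
      change p ^ (j + 1) ∣ Multiset.count v (s.1.1.dedup.map s.1.1.count)
      have hd := orbit_dvd_sum (R := ℤ) τ
        (fun i => if i ∈ s.1.1 ∧ v = s.1.1.count i then 1 else 0) p hp j (j + 1) ?_ ?_ ?_
      · rw [Finset.sum_boole] at hd
        rw [← Nat.cast_pow, Int.natCast_dvd_natCast] at hd
        convert hd using 1
        rw [Multiset.count_map]
        rw [← Multiset.toFinset_val, ← Finset.filter_val, Finset.card_val]
        congr 1
        ext i
        simp only [Finset.mem_filter, Multiset.mem_toFinset, Finset.mem_univ, true_and]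
      · rw [hτ, ← pow_mul, ← pow_add, show c + (j + 1) = t by omega, hσ]
      · intro i
        have : τ i ∈ s.1.1 ↔ i ∈ s.1.1 := by
          rw [← Multiset.count_pos, hcount, Multiset.count_pos]
        simp only [this, hcount]
      · intro i hi hi2
        have hi3 : i ∈ s.1.1 := by
          by_contra h
          exact hi (if_neg fun h' => h h'.1)
        rw [hτ, ← pow_mul, ← pow_add] at hi2
        have := hxk (p ^ (c + j)) i
        rw [hi2] at this
        have h1 : ζ ^ (p ^ (c + j)) = 1 :=
          mul_right_cancel₀ (hne i hi3) (by rw [one_mul]; exact this.symm)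
        have h2 := (hζ.pow_eq_one_iff_dvd _).1 h1
        have h3 := (Nat.pow_dvd_pow_iff_le_right hp.one_lt).1 h2
        omega)
    exact ⟨u, hu⟩

theorem exists_roots {R : Type*} [CommRing R] [IsDomain R] [Algebra ℤ R] (n q m : ℕ) (hm : m = n / q) (hq : 0 < q)
    (ζ : R) (hζ : IsPrimitiveRoot ζ q) (z : Fin m → R) :
    ∃ (σ : Equiv.Perm (Fin n)) (x : Fin n → R), σ ^ q = 1 ∧ (∀ i, x (σ i) = ζ * x i) ∧
      ∀ k ≤ n, aeval x (esymm (Fin n) ℤ k) =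
        if q ∣ k then aeval (fun l => - z l ^ q) (esymm (Fin m) ℤ (k / q)) else 0 := by
  classical
  have : NeZero q := ⟨hq.ne'⟩
  have hmq : m * q ≤ n := hm ▸ Nat.div_mul_le_self n q
  have e : Fin n ≃ (Fin m × Fin q) ⊕ Fin (n - m * q) := Fintype.equivOfCardEq (by simp; omega)
  let σ' : Equiv.Perm ((Fin m × Fin q) ⊕ Fin (n - m * q)) :=
    Equiv.sumCongr (Equiv.prodCongr (Equiv.refl _) (Equiv.addRight 1)) (Equiv.refl _)
  let x' : (Fin m × Fin q) ⊕ Fin (n - m * q) → R :=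
    Sum.elim (fun a => -(ζ ^ (a.2 : ℕ) * z a.1)) (fun _ => 0)
  have hx' : ∀ i, x' (σ' i) = ζ * x' i := by
    rintro (⟨l, a⟩ | i)
    · have : ζ ^ ((a + 1 : Fin q) : ℕ) = ζ ^ ((a : ℕ) + 1) := by
        rw [Fin.val_add]
        refine pow_eq_pow_of_modEq ?_ hζ.pow_eq_one
        refine (Nat.mod_modEq _ _).trans (Nat.ModEq.add_left _ ?_)
        rw [Fin.val_one']
        exact Nat.mod_modEq _ _
      simp only [x', σ', Equiv.sumCongr_apply, Sum.map_inl, Equiv.prodCongr_apply, Prod.map_apply,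
        Equiv.coe_addRight, Sum.elim_inl, this, Equiv.refl_apply]
      ring
    · simp [x', σ']
  have hσk : ∀ k i, ((σ' ^ k) i) = Sum.map (fun a => (a.1, a.2 + k • (1 : Fin q))) id i := by
    intro k i
    induction k with
    | zero => rcases i with i | i <;> simp
    | succ k ih =>
      rw [pow_succ', Equiv.Perm.mul_apply, ih]
      rcases i with i | i
      · simp [σ', add_assoc, succ_nsmul]
      · simp [σ']
  refine ⟨(e.trans σ').trans e.symm, x' ∘ e, ?_, ?_, ?_⟩
  · have : ∀ k i, (((e.trans σ').trans e.symm : Equiv.Perm (Fin n)) ^ k) i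
        = e.symm ((σ' ^ k) (e i)) := by
      intro k i
      induction k with
      | zero => simp
      | succ k ih => rw [pow_succ', Equiv.Perm.mul_apply, ih, pow_succ' σ']; simp
    ext i : 1
    rw [this, hσk]
    have hq1 : q • (1 : Fin q) = 0 := by
      have := card_nsmul_eq_zero (G := Fin q) (x := 1)
      simpa using this
    rw [hq1]
    have : Sum.map (fun a : Fin m × Fin q => (a.1, a.2 + 0)) (id : Fin (n - m * q) → _) (e i)
        = e i := by
      rcases e i with a | a <;> simp
    rw [this]; simp
  · intro i
    simp [hx']
  · intro k hk
    have hprod : ∏ i : Fin n, (Polynomial.X + Polynomial.C ((x' ∘ e) i)) =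
        Polynomial.X ^ (n - m * q) * Polynomial.expand R q
          (∏ l : Fin m, (Polynomial.X + Polynomial.C (- z l ^ q))) := by
      rw [show (∏ i : Fin n, (Polynomial.X + Polynomial.C ((x' ∘ e) i))) =
        ∏ i, (Polynomial.X + Polynomial.C (x' i)) from
          e.prod_comp (fun i => Polynomial.X + Polynomial.C (x' i))]
      rw [Fintype.prod_sum_type, mul_comm, Fintype.prod_prod_type, map_prod]
      congr 1
      · simp [x']
      · refine Finset.prod_congr rfl fun l _ => ?_
        have := X_pow_sub_C_eq_prod hζ (α := z l) hq rfl
        rw [Finset.prod_range] at this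
        simp only [x', Sum.elim_inl, map_neg, ← sub_eq_add_neg, map_sub,
          Polynomial.expand_X, Polynomial.expand_C]
        exact this.symm
    have h1 := Finset.prod_X_add_C_coeff (Finset.univ : Finset (Fin n)) (x' ∘ e) (k := n - k)
      (by simp)
    rw [hprod] at h1
    rw [aeval_esymm_eq_multiset_esymm]
    rw [Finset.card_univ, Fintype.card_fin, Nat.sub_sub_self hk, ← Finset.esymm_map_val] at h1
    rw [← h1, Polynomial.coeff_X_pow_mul']
    split_ifs with h2 h3 h3
    · obtain ⟨c, rfl⟩ := h3
      have hc : c ≤ m := by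
        by_contra hc; push Not at hc
        have : q * (m + 1) ≤ q * c := Nat.mul_le_mul_left q hc
        have := Nat.lt_div_mul_add hq (a := n)
        rw [← hm] at this
        nlinarith
      have : n - q * c - (n - m * q) = q * (m - c) := by
        rw [Nat.mul_sub, mul_comm q m]; omega
      rw [this, Polynomial.coeff_expand_mul' hq, Nat.mul_div_cancel_left _ hq,
        aeval_esymm_eq_multiset_esymm, Finset.prod_X_add_C_coeff _ _ (by simp),
        ← Finset.esymm_map_val]
      congr 1
      rw [Finset.card_univ, Fintype.card_fin, Nat.sub_sub_self hc]
    · rw [Polynomial.coeff_expand hq, if_neg]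
      rintro ⟨d, hd⟩
      apply h3
      have : k + q * d = q * m := by rw [mul_comm q m]; omega
      exact (Nat.dvd_add_left (dvd_mul_right q d)).1 (this ▸ dvd_mul_right q m)
    · obtain ⟨c, rfl⟩ := h3
      exfalso
      have : m < c := by
        by_contra hc; push Not at hc
        have := Nat.mul_le_mul_left q hc
        rw [mul_comm q m] at this
        omega
      have := Nat.mul_le_mul_left q this
      have h4 := Nat.lt_div_mul_add hq (a := n)
      rw [← hm] at h4
      rw [Nat.mul_succ, mul_comm q m] at this
      omega
    · rfl

theorem int_dvd_of_dvd (a b : ℤ) (ha : a ≠ 0)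
    (h : (a : integralClosure ℤ ℂ) ∣ (b : integralClosure ℤ ℂ)) : a ∣ b := by
  obtain ⟨c, hc⟩ := h
  have h1 : (b : ℂ) = a * (c : ℂ) := by
    have := congrArg (Subtype.val) hc
    simpa using this
  have h2 : (c : ℂ) = algebraMap ℚ ℂ (b / a) := by
    have : (a : ℂ) ≠ 0 := by exact_mod_cast ha
    simp only [eq_ratCast]
    push_cast
    field_simp
    rw [h1]; ring
  have h3 : IsIntegral ℤ ((b : ℚ) / a) := by
    rw [← isIntegral_algebraMap_iff (algebraMap ℚ ℂ).injective, ← h2]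
    exact c.2
  obtain ⟨y, hy⟩ := IsIntegrallyClosed.isIntegral_iff.1 h3
  refine ⟨y, ?_⟩
  have : (a : ℚ) ≠ 0 := by exact_mod_cast ha
  simp only [eq_intCast] at hy
  field_simp at hy
  have h5 : y * a = b := by exact_mod_cast hy
  rw [← h5, mul_comm]

theorem C_dvd_of_expand {m : ℕ} (q : ℕ) (hq : 0 < q) (a : ℤ) (ha : a ≠ 0)
    (P : MvPolynomial (Fin m) ℤ)
    (h : (a : MvPolynomial (Fin m) (integralClosure ℤ ℂ)) ∣ aeval (fun l => - X l ^ q) P) :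
    C a ∣ P := by
  set θ : MvPolynomial (Fin m) ℤ →ₐ[ℤ] MvPolynomial (Fin m) ℤ := aeval (fun l => - X l) with hθ
  have hinv : ∀ P, θ (θ P) = P := by
    intro P
    have : θ.comp θ = AlgHom.id ℤ _ := by
      ext i : 1
      simp [hθ]
    exact AlgHom.congr_fun this P
  have hexp : aeval (fun l => - X l ^ q : Fin m → MvPolynomial (Fin m) (integralClosure ℤ ℂ)) P =
      expand q (map (Int.castRingHom (integralClosure ℤ ℂ)) (θ P)) := by
    clear h
    induction P using MvPolynomial.induction_on with
    | C a => simp [hθ]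
    | add p q hp hq => simp only [map_add, hp, hq]
    | mul_X p i hp => rw [map_mul, hp, map_mul]; simp only [aeval_X, map_mul, hθ, map_neg, map_X, expand_X]
  have hQ : C a ∣ θ P := by
    rw [C_dvd_iff_dvd_coeff]
    intro d
    rw [hexp] at h
    have h' : (C (a : integralClosure ℤ ℂ)) ∣
        expand q (map (Int.castRingHom (integralClosure ℤ ℂ)) (θ P)) := by
      simpa using h
    rw [C_dvd_iff_dvd_coeff] at h'
    have h2 := h' (q • d)
    rw [coeff_expand_smul q hq.ne', coeff_map] at h2
    exact int_dvd_of_dvd _ _ ha h2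
  have := map_dvd θ hQ
  rw [hinv] at this
  simpa [hθ] using this

theorem C_dvd_of_esymm {m : ℕ} (a : ℤ) (ha : a ≠ 0) (ψ : MvPolynomial (Fin m) ℤ)
    (h : C a ∣ aeval (fun i : Fin m => esymm (Fin m) ℤ ((i : ℕ) + 1)) ψ) : C a ∣ ψ := by
  obtain ⟨P', hP'⟩ := h
  have hC : (C a : MvPolynomial (Fin m) ℤ) ≠ 0 := by simpa using ha
  rw [← esymmAlgHom_apply] at hP'
  have hsym : P'.IsSymmetric := by
    intro e
    have h1 : rename e (esymmAlgHom (Fin m) ℤ m ψ : MvPolynomial (Fin m) ℤ) =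
      (esymmAlgHom (Fin m) ℤ m ψ : MvPolynomial (Fin m) ℤ) := (esymmAlgHom (Fin m) ℤ m ψ).2 e
    rw [hP', map_mul, rename_C] at h1
    exact mul_left_cancel₀ hC h1
  obtain ⟨ψ', h'⟩ := esymmAlgHom_fin_surjective ℤ (le_refl m) ⟨P', hsym⟩
  refine ⟨ψ', esymmAlgHom_fin_injective ℤ (le_refl m) ?_⟩
  apply Subtype.ext
  rw [hP', map_mul, h']
  simp

/-- **Proposition (val).**  Let `p` be prime, `t ≥ j ≥ 0`, `w' ≥ 1` and `w = w'·p^t`.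
Let `λ'` be a partition of `w'` and `λ = p^t·λ'` (every part multiplied by `p^t`),
with all parts of `λ` at most `n`.  Let `μ` be a partition of `w` with at most `n`
parts which is not of the form `p^{j+1} * μ'` (the multiset sum of `p^{j+1}` copies of
a partition `μ'`).  Then `p^{t-j}` divides the coefficient `d_{λμ}` of
`X_{λ_1}⋯X_{λ_k}` in the unique polynomial `ψ_μ` with `m_μ = ψ_μ(e_1, …, e_n)`. -/
theorem pow_dvd_d (n : ℕ) (hn : 1 ≤ n) (p : ℕ) (hp : p.Prime)
    (t j : ℕ) (hjt : j ≤ t) (w' : ℕ) (hw' : 1 ≤ w') (w : ℕ) (hw : w = w' * p ^ t)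
    (lam' : w'.Partition)
    (lam : Multiset ℕ) (hlam : lam = lam'.parts.map fun x => p ^ t * x)
    (hlamn : ∀ x ∈ lam, x ≤ n)
    (mu : w.Partition) (hmun : Multiset.card mu.parts ≤ n)
    (hmu : ¬ ∃ mu' : Multiset ℕ, mu.parts = p ^ (j + 1) • mu')
    (ψ : MvPolynomial (Fin n) ℤ)
    (hψ : MvPolynomial.aeval (fun i : Fin n => MvPolynomial.esymm (Fin n) ℤ ((i : ℕ) + 1)) ψ
      = MvPolynomial.msymm (Fin n) ℤ mu) :
    (p : ℤ) ^ (t - j) ∣ ψ.coeff (partExp n lam) := by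
  classical
  rcases hjt.eq_or_lt with rfl | hlt
  · simp
  have hq : 0 < p ^ t := pow_pos hp.pos t
  have ha : (p : ℤ) ^ (t - j) ≠ 0 := pow_ne_zero _ (by exact_mod_cast hp.ne_zero)
  -- a primitive root of unity in the ring of algebraic integers
  have hζ1 := Complex.isPrimitiveRoot_exp (p ^ t) hq.ne'
  obtain ⟨ζ0, hζ2⟩ : ∃ ζ0 : integralClosure ℤ ℂ, IsPrimitiveRoot ζ0 (p ^ t) :=
    ⟨⟨_, hζ1.isIntegral hq⟩, IsPrimitiveRoot.of_map_of_injective (f := (integralClosure ℤ ℂ).val) hζ1 Subtype.val_injective⟩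
  clear hζ1
  generalize hqq : p ^ t = q at *
  have hζ : IsPrimitiveRoot (C ζ0 : MvPolynomial (Fin (n / q)) (integralClosure ℤ ℂ)) q :=
    hζ2.map_of_injective (f := C) (C_injective _ _)
  obtain ⟨σ, x, hσ, hx, he⟩ := exists_roots n q _ rfl hq _ hζ X
  have h1 := dvd_msymm n p t j w hp hlt (by rw [hqq, hw]; exact dvd_mul_left _ _) mu hmu _
    (by rw [hqq]; exact hζ) σ (by rw [hqq]; exact hσ) x hx
  -- the injection of indices
  let f : Fin (n / q) → Fin n := fun l => ⟨q * (l + 1) - 1, by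
    have h2 : q * (l + 1) ≤ q * (n / q) := Nat.mul_le_mul_left q l.2
    have h3 := Nat.mul_div_le n q
    have h4 : 0 < q * ((l : ℕ) + 1) := by positivity
    omega⟩
  have hfv : ∀ l, ((f l : Fin n) : ℕ) + 1 = q * (l + 1) := by
    intro l
    have h4 : 0 < q * ((l : ℕ) + 1) := by positivity
    simp only [f]; omega
  have hf : Function.Injective f := by
    intro l l' h
    have h2 : q * ((l : ℕ) + 1) = q * (l' + 1) := by rw [← hfv, ← hfv, h]
    have := Nat.eq_of_mul_eq_mul_left hq h2
    exact Fin.ext (by omega)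
  have hfr : ∀ i : Fin n, q ∣ (i : ℕ) + 1 → i ∈ Set.range f := by
    rintro i ⟨c, hc⟩
    have hc0 : 0 < c := by
      rcases Nat.eq_zero_or_pos c with rfl | h
      · simp at hc
      · exact h
    have hcn : c ≤ n / q := (Nat.le_div_iff_mul_le hq).2 (by rw [mul_comm, ← hc]; exact i.2)
    refine ⟨⟨c - 1, by omega⟩, Fin.ext ?_⟩
    have := hfv ⟨c - 1, by omega⟩
    simp only [Nat.sub_add_cancel hc0, ← hc] at this
    omega
  have hlamE : partExp n lam = (partExp (n / q) lam'.parts).mapDomain f := by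
    ext i
    by_cases hi : i ∈ Set.range f
    · obtain ⟨l, rfl⟩ := hi
      rw [Finsupp.mapDomain_apply hf]
      simp only [partExp, Finsupp.equivFunOnFinite_symm_apply_apply]
      rw [hfv, hlam]
      exact Multiset.count_map_eq_count' (fun x => q * x) _
        (fun a b h => Nat.eq_of_mul_eq_mul_left hq h) _
    · rw [Finsupp.mapDomain_of_notMem_range _ _ hi]
      simp only [partExp, Finsupp.equivFunOnFinite_symm_apply_apply]
      rw [Multiset.count_eq_zero, hlam]
      intro hmem
      obtain ⟨y, _, hy⟩ := Multiset.mem_map.1 hmem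
      exact hi (hfr i ⟨y, hy.symm⟩)
  rw [hlamE, ← coeff_killCompl hf]
  refine (C_dvd_iff_dvd_coeff _ _).1 ?_ _
  refine C_dvd_of_esymm _ ha _ (C_dvd_of_expand q hq _ ha _ ?_)
  rw [← hψ] at h1
  convert h1 using 1
  · push_cast; rfl
  · rw [← AlgHom.comp_apply, ← AlgHom.comp_apply, ← AlgHom.comp_apply]
    congr 1
    ext i : 1
    simp only [AlgHom.comp_apply, aeval_X]
    rw [he ((i : ℕ) + 1) i.2]
    by_cases hi : i ∈ Set.range f
    · obtain ⟨l, rfl⟩ := hi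
      rw [hfv, if_pos (dvd_mul_right _ _), Nat.mul_div_cancel_left _ hq, killCompl, aeval_X,
        dif_pos ⟨l, rfl⟩, Equiv.ofInjective_symm_apply, aeval_X]
    · rw [if_neg fun h => hi (hfr i h), killCompl, aeval_X, dif_neg hi, map_zero, map_zero]

end
end
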